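/- arXiv:1212.3769 — 3 statements merged into one kernel-verified Lean document; each statement's English description precedes it below -/
import Mathlib

section
/- Let r > 0, s = r + 1, β ∈ ℝ. Then there exists a constant C = C(r) > 0 such that for all n ∈ ℕ and all β ∈ ℝ, E(W^r_{β,∞}; Z^s_n) ≤ C·n^{−r}, where Z^s_n is the Zygmund sum Z^s_n(f;x) = Σ_{k=0}^{n−1} (1 − k^s/n^s) A_k(f;x) and W^r_{β,∞} is the Weyl–Nagy class. -/
open MeasureTheory Real Filter Set

noncomputable section

/-- The `k`-th Fourier cosine coefficient of a `2π`-periodic function. -/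
def fourierA (f : ℝ → ℝ) (k : ℕ) : ℝ := (1 / π) * ∫ t in (-π)..π, f t * Real.cos (k * t)

/-- The `k`-th Fourier sine coefficient of a `2π`-periodic function. -/
def fourierB (f : ℝ → ℝ) (k : ℕ) : ℝ := (1 / π) * ∫ t in (-π)..π, f t * Real.sin (k * t)

/-- The harmonicTerm `A_k(f;x)`. -/
def harmonicTerm (f : ℝ → ℝ) (k : ℕ) (x : ℝ) : ℝ :=
  if k = 0 then fourierA f 0 / 2
  else fourierA f k * Real.cos (k * x) + fourierB f k * Real.sin (k * x)

/-- `2π`-periodicity. -/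
def Periodic2pi (f : ℝ → ℝ) : Prop := ∀ x, f (x + 2 * π) = f x

/-- The set `S_∞`: measurable `2π`-periodic functions essentially bounded by 1. -/
def SInf (φ : ℝ → ℝ) : Prop :=
  Measurable φ ∧ Periodic2pi φ ∧ (∀ᵐ t ∂(volume : Measure ℝ), |φ t| ≤ 1)

/-- `φ` is the `(ψ,β)`-derivative of `f`: `φ ∈ S_∞` and the series
`Σ (1/ψ k)(a_k(f) cos(kx+βπ/2) + b_k(f) sin(kx+βπ/2))` is the Fourier series of `φ`. -/
def IsPsiDeriv (ψ : ℕ → ℝ) (β : ℝ) (f φ : ℝ → ℝ) : Prop :=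
  SInf φ ∧ fourierA φ 0 = 0 ∧
    ∀ k : ℕ, 1 ≤ k →
      fourierA φ k = (1 / ψ k) *
        (fourierA f k * Real.cos (β * π / 2) + fourierB f k * Real.sin (β * π / 2)) ∧
      fourierB φ k = (1 / ψ k) *
        (fourierB f k * Real.cos (β * π / 2) - fourierA f k * Real.sin (β * π / 2))

/-- The class `C^ψ_{β,∞}`. -/
def ClassC (ψ : ℕ → ℝ) (β : ℝ) (f : ℝ → ℝ) : Prop :=
  Continuous f ∧ Periodic2pi f ∧ ∃ φ, IsPsiDeriv ψ β f φ

/-- Multipliers of the sums `U^ψ_{n,p}` (with `φ(k) = (k-n+p)/ψ(k)`). -/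
def lambdaU (ψ : ℕ → ℝ) (n p k : ℕ) : ℝ :=
  if k ≤ n - p then 1
  else 1 - (((k : ℝ) - n + p) / ψ k) / ((p : ℝ) / ψ n)

/-- The sums `U^ψ_{n,p}(f;x)`. -/
def Usum (ψ : ℕ → ℝ) (n p : ℕ) (f : ℝ → ℝ) (x : ℝ) : ℝ :=
  ∑ k ∈ Finset.range n, lambdaU ψ n p k * harmonicTerm f k x

/-- `E(C^ψ_{β,∞}; T) = sup_{f ∈ C^ψ_{β,∞}} ‖f - T f‖_C`. -/
def classSup (ψ : ℕ → ℝ) (β : ℝ) (T : (ℝ → ℝ) → ℝ → ℝ) : ℝ :=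
  sSup {e | ∃ f, ClassC ψ β f ∧ e = ⨆ x : ℝ, |f x - T f x|}

/-- The characteristic `η(ψ;t) = ψ⁻¹(ψ(t)/2)` (inverse taken on `[1,∞)`). -/
def eta (ψ : ℝ → ℝ) (t : ℝ) : ℝ := Function.invFunOn ψ (Set.Ici 1) (ψ t / 2)

/-- The set `M`: positive convex functions on `[1,∞)` vanishing at infinity. -/
def MClass (ψ : ℝ → ℝ) : Prop :=
  (∀ t ≥ (1 : ℝ), 0 < ψ t) ∧ ConvexOn ℝ (Set.Ici 1) ψ ∧ Tendsto ψ atTop (nhds 0)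

/-- The set `F = {ψ ∈ M : η'(ψ;t) ≤ K for all t ≥ 1}`. -/
def FClass (ψ : ℝ → ℝ) : Prop :=
  MClass ψ ∧ ∃ K : ℝ, ∀ t ≥ (1 : ℝ), DifferentiableAt ℝ (eta ψ) t ∧ deriv (eta ψ) t ≤ K

/-- The generalized Zygmund sum `Z^φ_n(f;x) = Σ_{k=0}^{n-1} (1 - φ(k)/φ(n)) A_k(f;x)`;
with `φ(k) = k^s` it is the classical Zygmund sum `Z^s_n`. -/
def ZygmundSum (φ : ℕ → ℝ) (n : ℕ) (f : ℝ → ℝ) (x : ℝ) : ℝ :=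
  ∑ k ∈ Finset.range n, (1 - φ k / φ n) * harmonicTerm f k x

/-- The trigonometric polynomial `∑_{k < M} c k e^{ikt}`. -/
def trigPoly (M : ℕ) (c : ℕ → ℝ) (t : ℝ) : ℂ :=
  ∑ k ∈ Finset.range M, (c k : ℂ) * Complex.exp (Complex.I * ((k * t : ℝ) : ℂ))

/-- The unnormalised exponential Fourier coefficient `∫ g(t) e^{-ikt} dt` over a period. -/
def expCoeff (g : ℝ → ℝ) (k : ℕ) : ℂ :=
  ∫ t in (-π)..π, (g t : ℂ) * Complex.exp (-(Complex.I * ((k * t : ℝ) : ℂ)))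

theorem integral_exp_int_mul_I (m : ℤ) :
    ∫ t in (-π)..π, Complex.exp (Complex.I * ((m * t : ℝ) : ℂ)) =
      if m = 0 then (2 * π : ℂ) else 0 := by
  split_ifs with h
  · subst h
    simp
    ring
  · have hc : Complex.I * (m : ℂ) ≠ 0 := mul_ne_zero Complex.I_ne_zero (by exact_mod_cast h)
    have := integral_exp_mul_complex (a := -π) (b := π) hc
    push_cast at this ⊢
    simp only [← mul_assoc]
    rw [this, div_eq_zero_iff]
    left
    rw [sub_eq_zero, Complex.exp_eq_exp_iff_exists_int]
    exact ⟨m, by ring⟩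

@[fun_prop]
theorem continuous_trigPoly (M : ℕ) (c : ℕ → ℝ) : Continuous (trigPoly M c) := by
  unfold trigPoly
  fun_prop

theorem trigPoly_add_two_pi (M : ℕ) (c : ℕ → ℝ) (t : ℝ) :
    trigPoly M c (t + 2 * π) = trigPoly M c t := by
  unfold trigPoly
  refine Finset.sum_congr rfl fun k _ => ?_
  congr 1
  rw [Complex.exp_eq_exp_iff_exists_int]
  exact ⟨k, by push_cast; ring⟩

theorem integral_norm_trigPoly_sq (M : ℕ) (c : ℕ → ℝ) :
    ∫ t in (-π)..π, ‖trigPoly M c t‖ ^ 2 = 2 * π * ∑ k ∈ Finset.range M, c k ^ 2 := by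
  have key : ∀ t : ℝ, ((‖trigPoly M c t‖ ^ 2 : ℝ) : ℂ) =
      ∑ k ∈ Finset.range M, ∑ j ∈ Finset.range M, ((c k * c j : ℝ) : ℂ) *
        Complex.exp (Complex.I * ((((k : ℤ) - (j : ℤ) : ℤ) * t : ℝ) : ℂ)) := by
    intro t
    rw [Complex.ofReal_pow, ← Complex.mul_conj', trigPoly, map_sum, Finset.sum_mul_sum]
    refine Finset.sum_congr rfl fun k _ => Finset.sum_congr rfl fun j _ => ?_
    rw [map_mul, ← Complex.exp_conj, map_mul, Complex.conj_I, Complex.conj_ofReal,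
      Complex.conj_ofReal, mul_mul_mul_comm, ← Complex.exp_add]
    push_cast
    ring_nf
  apply Complex.ofReal_injective
  rw [← intervalIntegral.integral_ofReal]
  simp_rw [key]
  rw [intervalIntegral.integral_finsetSum
    (fun k _ => Continuous.intervalIntegrable (by fun_prop) _ _)]
  push_cast
  rw [Finset.mul_sum]
  refine Finset.sum_congr rfl fun k hk => ?_
  rw [intervalIntegral.integral_finsetSum
    (fun k _ => Continuous.intervalIntegrable (by fun_prop) _ _)]
  have := fun j : ℕ => integral_exp_int_mul_I ((k : ℤ) - j)
  push_cast at this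
  simp_rw [intervalIntegral.integral_const_mul, this, sub_eq_zero, Nat.cast_inj]
  simp only [mul_ite, mul_zero, Finset.sum_ite_eq, hk, if_true]
  ring

theorem exp_sub_one_mul_trigPoly (M : ℕ) (c : ℕ → ℝ) (h0 : c 0 = 0) (hM : c M = 0) (t : ℝ) :
    (Complex.exp (Complex.I * ((-t : ℝ) : ℂ)) - 1) * trigPoly M c t =
      trigPoly M (fun k => c (k + 1) - c k) t := by
  have h1 := Finset.sum_range_succ
    (fun k => (c k : ℂ) * Complex.exp (Complex.I * ((k * t : ℝ) : ℂ))) M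
  rw [Finset.sum_range_succ'] at h1
  simp only [h0, hM, Complex.ofReal_zero, zero_mul, add_zero] at h1
  unfold trigPoly
  rw [sub_mul, one_mul]
  conv_lhs => rw [← h1, Finset.mul_sum, h1]
  rw [← Finset.sum_sub_distrib]
  refine Finset.sum_congr rfl fun k _ => ?_
  rw [mul_left_comm, ← Complex.exp_add, Complex.ofReal_sub, sub_mul]
  congr 3
  push_cast
  ring

theorem abs_le_norm_exp_sub_one {t : ℝ} (h1 : -π ≤ t) (h2 : t ≤ π) :
    |t| ≤ π / 2 * ‖Complex.exp (Complex.I * ((-t : ℝ) : ℂ)) - 1‖ := by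
  have hs : 2 / π * |t / 2| ≤ |Real.sin (t / 2)| := by
    apply Real.mul_abs_le_abs_sin
    rw [abs_div, abs_two]
    have := abs_le.2 ⟨h1, h2⟩
    linarith
  rw [Complex.norm_exp_I_mul_ofReal_sub_one, neg_div, Real.sin_neg, norm_mul, norm_neg,
    Real.norm_eq_abs, Real.norm_eq_abs, abs_two]
  rw [abs_div, abs_two] at hs
  calc |t| = π * (2 / π * (|t| / 2)) := by field_simp
    _ ≤ π * |Real.sin (t / 2)| := by gcongr
    _ = _ := by ring

theorem integral_inv_one_add_mul_sq_le {N : ℝ} (hN : 0 < N) :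
    ∫ t in (-π)..π, (1 + (N * t) ^ 2)⁻¹ ≤ π / N := by
  rw [intervalIntegral.integral_comp_mul_left (fun x => (1 + x ^ 2)⁻¹) hN.ne',
    integral_inv_one_add_sq, smul_eq_mul, div_eq_inv_mul]
  gcongr
  have := Real.arctan_lt_pi_div_two (N * π)
  have := Real.neg_pi_div_two_lt_arctan (N * -π)
  linarith

/-- The `L¹` norm of a trigonometric polynomial of degree at most `2N` whose coefficients are
bounded by `A` and have increments bounded by `D A / N` is `O(A)`. -/
theorem integral_norm_trigPoly_le {M : ℕ} {c : ℕ → ℝ} {N A D : ℝ} (hN : 0 < N) (hA : 0 < A)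
    (h0 : c 0 = 0) (hM : c M = 0) (hMN : M ≤ 2 * N) (hc : ∀ k < M, |c k| ≤ A)
    (hd : ∀ k < M, |c (k + 1) - c k| ≤ D * A / N) :
    ∫ t in (-π)..π, ‖trigPoly M c t‖ ≤ π / 2 * (5 + π ^ 2 * D ^ 2) * A := by
  set d : ℕ → ℝ := fun k => c (k + 1) - c k
  have hpt : ∀ t ∈ Icc (-π) π, ‖trigPoly M c t‖ ≤ 1 / 2 * (N * A * (1 + (N * t) ^ 2)⁻¹ +
      (N * A)⁻¹ * (‖trigPoly M c t‖ ^ 2 + N ^ 2 * (π ^ 2 / 4) * ‖trigPoly M d t‖ ^ 2)) := by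
    intro t ht
    set p := ‖trigPoly M c t‖
    have hq : (N * t) ^ 2 * p ^ 2 ≤ N ^ 2 * (π ^ 2 / 4) * ‖trigPoly M d t‖ ^ 2 := by
      rw [← exp_sub_one_mul_trigPoly M c h0 hM, norm_mul]
      have h := pow_le_pow_left₀ (abs_nonneg t) (abs_le_norm_exp_sub_one ht.1 ht.2) 2
      rw [sq_abs] at h
      calc (N * t) ^ 2 * p ^ 2 = N ^ 2 * p ^ 2 * t ^ 2 := by ring
        _ ≤ N ^ 2 * p ^ 2 * (π / 2 * ‖Complex.exp (Complex.I * ((-t : ℝ) : ℂ)) - 1‖) ^ 2 := by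
          gcongr
        _ = _ := by ring
    have hu : 0 < 1 + (N * t) ^ 2 := by positivity
    have hL : 0 < N * A := by positivity
    have hamgm : p ≤ 1 / 2 * (N * A * (1 + (N * t) ^ 2)⁻¹ +
        (N * A)⁻¹ * (p ^ 2 * (1 + (N * t) ^ 2))) := by
      generalize 1 + (N * t) ^ 2 = u at hu
      generalize N * A = L at hL
      have : 1 / 2 * (L * u⁻¹ + L⁻¹ * (p ^ 2 * u)) - p = (L - p * u) ^ 2 / (2 * L * u) := by
        field_simp
        ring
      have : 0 ≤ (L - p * u) ^ 2 / (2 * L * u) := by positivity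
      linarith
    refine hamgm.trans ?_
    gcongr
    linarith
  have hsum : ∀ (b : ℕ → ℝ) (B : ℝ), (∀ k < M, |b k| ≤ B) →
      ∑ k ∈ Finset.range M, b k ^ 2 ≤ 2 * N * B ^ 2 := by
    intro b B hb
    calc ∑ k ∈ Finset.range M, b k ^ 2 ≤ ∑ k ∈ Finset.range M, B ^ 2 :=
          Finset.sum_le_sum fun k hk => by
            rw [← sq_abs]
            exact pow_le_pow_left₀ (abs_nonneg _) (hb k (Finset.mem_range.1 hk)) 2
      _ = M * B ^ 2 := by simp
      _ ≤ _ := by gcongr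
  have hcont : Continuous fun t : ℝ => (1 + (N * t) ^ 2)⁻¹ :=
    Continuous.inv₀ (by fun_prop) fun t => by positivity
  calc ∫ t in (-π)..π, ‖trigPoly M c t‖
      ≤ ∫ t in (-π)..π, 1 / 2 * (N * A * (1 + (N * t) ^ 2)⁻¹ +
      (N * A)⁻¹ * (‖trigPoly M c t‖ ^ 2 + N ^ 2 * (π ^ 2 / 4) * ‖trigPoly M d t‖ ^ 2)) := by
        refine intervalIntegral.integral_mono_on (by linarith [pi_pos])
          (Continuous.intervalIntegrable (by fun_prop) _ _)
          (Continuous.intervalIntegrable (by fun_prop) _ _) hpt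
    _ = 1 / 2 * (N * A * (∫ t in (-π)..π, (1 + (N * t) ^ 2)⁻¹) +
      (N * A)⁻¹ * (2 * π * (∑ k ∈ Finset.range M, c k ^ 2) +
        N ^ 2 * (π ^ 2 / 4) * (2 * π * ∑ k ∈ Finset.range M, d k ^ 2))) := by
        rw [intervalIntegral.integral_const_mul, intervalIntegral.integral_add,
          intervalIntegral.integral_const_mul, intervalIntegral.integral_const_mul,
          intervalIntegral.integral_add, intervalIntegral.integral_const_mul,
          integral_norm_trigPoly_sq, integral_norm_trigPoly_sq]
        all_goals exact Continuous.intervalIntegrable (by fun_prop) _ _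
    _ ≤ 1 / 2 * (N * A * (π / N) + (N * A)⁻¹ * (2 * π * (2 * N * A ^ 2) +
        N ^ 2 * (π ^ 2 / 4) * (2 * π * (2 * N * (D * A / N) ^ 2)))) := by
        gcongr
        · exact integral_inv_one_add_mul_sq_le hN
        · exact hsum c A hc
        · exact hsum d _ hd
    _ = _ := by
        field_simp
        ring

theorem exp_I_mul_ofReal (x : ℝ) :
    Complex.exp (Complex.I * (x : ℂ)) = Real.cos x + Real.sin x * Complex.I := by
  rw [mul_comm, Complex.exp_mul_I, Complex.ofReal_cos, Complex.ofReal_sin]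

theorem intervalIntegrable_ofReal {g : ℝ → ℝ} {a b : ℝ} (hg : IntervalIntegrable g volume a b) :
    IntervalIntegrable (fun t => (g t : ℂ)) volume a b :=
  ⟨hg.1.ofReal, hg.2.ofReal⟩

theorem SInf.intervalIntegrable {φ : ℝ → ℝ} (hφ : SInf φ) (a b : ℝ) :
    IntervalIntegrable φ volume a b := by
  refine (intervalIntegrable_const (c := (1 : ℝ))).mono_fun hφ.1.aestronglyMeasurable ?_
  filter_upwards [ae_restrict_of_ae hφ.2.2] with t ht
  simpa using ht

theorem expCoeff_eq {g : ℝ → ℝ} (hg : IntervalIntegrable g volume (-π) π) (k : ℕ) :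
    expCoeff g k = π * (fourierA g k - Complex.I * fourierB g k) := by
  have h1 : IntervalIntegrable (fun t => g t * Real.cos (k * t)) volume (-π) π :=
    hg.mul_continuousOn (by fun_prop)
  have h2 : IntervalIntegrable (fun t => g t * Real.sin (k * t)) volume (-π) π :=
    hg.mul_continuousOn (by fun_prop)
  have : ∀ t : ℝ, (g t : ℂ) * Complex.exp (-(Complex.I * ((k * t : ℝ) : ℂ))) =
      ((g t * Real.cos (k * t) : ℝ) : ℂ) - Complex.I * ((g t * Real.sin (k * t) : ℝ) : ℂ) := by
    intro t
    rw [← mul_neg, ← Complex.ofReal_neg, exp_I_mul_ofReal, Real.cos_neg, Real.sin_neg]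
    push_cast
    ring
  unfold expCoeff fourierA fourierB
  simp_rw [this]
  rw [intervalIntegral.integral_sub (intervalIntegrable_ofReal h1) ((intervalIntegrable_ofReal h2).const_mul _),
    intervalIntegral.integral_const_mul, intervalIntegral.integral_ofReal,
    intervalIntegral.integral_ofReal]
  have := pi_ne_zero
  push_cast
  field_simp

theorem harmonicTerm_eq_re {f : ℝ → ℝ} (hf : IntervalIntegrable f volume (-π) π) {k : ℕ}
    (hk : k ≠ 0) (x : ℝ) :
    harmonicTerm f k x =
      ((π : ℂ)⁻¹ * expCoeff f k * Complex.exp (Complex.I * ((k * x : ℝ) : ℂ))).re := by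
  rw [expCoeff_eq hf, inv_mul_cancel_left₀ (by exact_mod_cast pi_ne_zero), harmonicTerm,
    if_neg hk, exp_I_mul_ofReal]
  generalize Real.cos _ = u
  generalize Real.sin _ = v
  simp

@[fun_prop]
theorem continuous_harmonicTerm (f : ℝ → ℝ) (k : ℕ) : Continuous (harmonicTerm f k) := by
  unfold harmonicTerm
  split_ifs <;> fun_prop

theorem harmonicTerm_periodic (f : ℝ → ℝ) (k : ℕ) : Periodic2pi (harmonicTerm f k) := by
  intro x
  unfold harmonicTerm
  rw [mul_add, Real.cos_add_nat_mul_two_pi, Real.sin_add_nat_mul_two_pi]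

theorem expCoeff_harmonicTerm {f : ℝ → ℝ} (hf : IntervalIntegrable f volume (-π) π) (j k : ℕ) :
    expCoeff (harmonicTerm f j) k = if j = k then expCoeff f k else 0 := by
  rcases eq_or_ne j 0 with rfl | hj
  · have h := integral_exp_int_mul_I (-(k : ℤ))
    have h0 : ∀ t, harmonicTerm f 0 t = fourierA f 0 / 2 := fun t => by simp [harmonicTerm]
    have hB : fourierB f 0 = 0 := by simp [fourierB]
    unfold expCoeff
    simp_rw [h0]
    rw [intervalIntegral.integral_const_mul]
    push_cast at h ⊢
    simp only [neg_mul, mul_neg] at h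
    rw [h]
    by_cases hk : k = 0
    · subst hk
      have := expCoeff_eq hf 0
      unfold expCoeff at this
      push_cast at this
      rw [if_pos (by simp), if_pos rfl, Nat.cast_zero, this, hB]
      push_cast
      ring
    · simp [hk, Ne.symm hk]
  · obtain ⟨z, hz⟩ : ∃ z : ℂ, z = (π : ℂ)⁻¹ * expCoeff f j := ⟨_, rfl⟩
    have hpt : ∀ t : ℝ, (harmonicTerm f j t : ℂ) *
        Complex.exp (-(Complex.I * ((k * t : ℝ) : ℂ))) =
        z / 2 * Complex.exp (Complex.I * ((((j : ℤ) - (k : ℤ) : ℤ) * t : ℝ) : ℂ)) +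
        (starRingEnd ℂ) z / 2 *
          Complex.exp (Complex.I * (((-(j : ℤ) - (k : ℤ) : ℤ) * t : ℝ) : ℂ)) := by
      intro t
      rw [harmonicTerm_eq_re hf hj, ← hz, Complex.re_eq_add_conj, map_mul, ← Complex.exp_conj,
        map_mul, Complex.conj_I, Complex.conj_ofReal, div_mul_eq_mul_div, add_mul, mul_assoc z,
        mul_assoc _ (Complex.exp _), ← Complex.exp_add, ← Complex.exp_add, add_div]
      push_cast
      ring_nf
    unfold expCoeff
    simp_rw [hpt]
    rw [intervalIntegral.integral_add (Continuous.intervalIntegrable (by fun_prop) _ _)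
      (Continuous.intervalIntegrable (by fun_prop) _ _), intervalIntegral.integral_const_mul,
      intervalIntegral.integral_const_mul, integral_exp_int_mul_I, integral_exp_int_mul_I,
      if_neg (show ¬(-(j : ℤ) - k = 0) by omega)]
    by_cases hjk : j = k
    · subst hjk
      have : (π : ℂ) ≠ 0 := by exact_mod_cast pi_ne_zero
      rw [if_pos (sub_self _), if_pos rfl, hz]
      change _ = expCoeff f j
      field_simp
      ring
    · rw [if_neg (by omega), if_neg hjk]
      simp

theorem expCoeff_sum_harmonicTerm {f : ℝ → ℝ} (hf : IntervalIntegrable f volume (-π) π)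
    (M : ℕ) (b : ℕ → ℝ) (k : ℕ) :
    expCoeff (fun x => ∑ j ∈ Finset.range M, b j * harmonicTerm f j x) k =
      if k < M then b k * expCoeff f k else 0 := by
  have := fun j => expCoeff_harmonicTerm hf j k
  unfold expCoeff at this ⊢
  push_cast at this ⊢
  simp_rw [Finset.sum_mul, mul_assoc]
  rw [intervalIntegral.integral_finsetSum
    (fun k _ => Continuous.intervalIntegrable (by fun_prop) _ _)]
  simp_rw [intervalIntegral.integral_const_mul, this, mul_ite, mul_zero, Finset.sum_ite_eq',
    Finset.mem_range]

theorem expCoeff_of_isPsiDeriv {ψ : ℕ → ℝ} {β : ℝ} {f φ : ℝ → ℝ}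
    (hf : IntervalIntegrable f volume (-π) π) (hφ : IsPsiDeriv ψ β f φ) {k : ℕ} (hk : 1 ≤ k)
    (hψ : ψ k ≠ 0) :
    expCoeff f k =
      ψ k * Complex.exp (Complex.I * ((-(β * π / 2) : ℝ) : ℂ)) * expCoeff φ k := by
  obtain ⟨hA, hB⟩ := hφ.2.2 k hk
  rw [expCoeff_eq hf, expCoeff_eq (hφ.1.intervalIntegrable _ _), hA, hB,
    exp_I_mul_ofReal, Real.cos_neg, Real.sin_neg]
  have h1 : (Real.cos (β * π / 2) : ℂ) ^ 2 + (Real.sin (β * π / 2) : ℂ) ^ 2 = 1 := by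
    exact_mod_cast Real.cos_sq_add_sin_sq (β * π / 2)
  have hψ' : (ψ k : ℂ) ≠ 0 := by exact_mod_cast hψ
  generalize Real.cos _ = u at *
  generalize Real.sin _ = v at *
  push_cast
  field_simp
  linear_combination (-(fourierA f k : ℂ) + Complex.I * fourierB f k) * h1 +
    ((fourierA f k - Complex.I * fourierB f k) * v ^ 2 - (u - v * Complex.I) * fourierB f k * v) *
      Complex.I_sq

/-- A Fourier multiplier maps a function bounded by one to a function bounded by the `L¹` norm
of its kernel. -/
theorem norm_sum_mul_expCoeff_le {φ : ℝ → ℝ} (hφ : SInf φ) (M : ℕ) (c : ℕ → ℝ) (x : ℝ) :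
    ‖∑ k ∈ Finset.range M,
      (c k : ℂ) * expCoeff φ k * Complex.exp (Complex.I * ((k * x : ℝ) : ℂ))‖ ≤
      ∫ t in (-π)..π, ‖trigPoly M c t‖ := by
  have hint : ∀ {F : ℝ → ℂ}, Continuous F →
      IntervalIntegrable (fun t => (φ t : ℂ) * F t) volume (-π) π := fun hF =>
    (intervalIntegrable_ofReal (hφ.intervalIntegrable _ _)).mul_continuousOn hF.continuousOn
  have hrep : ∑ k ∈ Finset.range M,
      (c k : ℂ) * expCoeff φ k * Complex.exp (Complex.I * ((k * x : ℝ) : ℂ)) =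
      ∫ t in (-π)..π, (φ t : ℂ) * trigPoly M c (x - t) := by
    unfold trigPoly
    simp_rw [Finset.mul_sum]
    rw [intervalIntegral.integral_finsetSum (fun k _ => hint (by fun_prop))]
    refine Finset.sum_congr rfl fun k _ => ?_
    unfold expCoeff
    rw [← intervalIntegral.integral_const_mul, ← intervalIntegral.integral_mul_const]
    refine intervalIntegral.integral_congr fun t _ => ?_
    have : Complex.exp (Complex.I * ((k * (x - t) : ℝ) : ℂ)) =
        Complex.exp (-(Complex.I * ((k * t : ℝ) : ℂ))) *
          Complex.exp (Complex.I * ((k * x : ℝ) : ℂ)) := by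
      rw [← Complex.exp_add]
      congr 1
      push_cast
      ring
    rw [this]
    ring
  have hper : Function.Periodic (fun t => ‖trigPoly M c t‖) (2 * π) := fun t => by
    simp only [trigPoly_add_two_pi]
  have hpi : -π ≤ π := by linarith [pi_pos]
  rw [hrep]
  calc ‖∫ t in (-π)..π, (φ t : ℂ) * trigPoly M c (x - t)‖
      ≤ ∫ t in (-π)..π, ‖trigPoly M c (x - t)‖ := by
        refine intervalIntegral.norm_integral_le_of_norm_le hpi ?_
          (Continuous.intervalIntegrable (by fun_prop) _ _)
        filter_upwards [hφ.2.2] with t ht _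
        rw [norm_mul, Complex.norm_real, Real.norm_eq_abs]
        exact mul_le_of_le_one_left (norm_nonneg _) ht
    _ = ∫ t in (x - π)..(x - -π), ‖trigPoly M c t‖ :=
        intervalIntegral.integral_comp_sub_left (fun t => ‖trigPoly M c t‖) x
    _ = ∫ t in (-π)..π, ‖trigPoly M c t‖ := by
        have := hper.intervalIntegral_add_eq (x - π) (-π)
        convert! this using 2 <;> ring

/-- A continuous `2π`-periodic function with vanishing Fourier coefficients is zero. -/
theorem eq_zero_of_expCoeff_eq_zero {g : ℝ → ℝ} (hg : Continuous g) (hp : Periodic2pi g)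
    (h : ∀ k, expCoeff g k = 0) (x : ℝ) : g x = 0 := by
  have : Fact (0 < 2 * π) := ⟨two_pi_pos⟩
  have hp' : Function.Periodic (fun t => (g t : ℂ)) (2 * π) := fun t => by
    simp only [hp t]
  let G : C(AddCircle (2 * π), ℂ) :=
    ⟨hp'.lift, continuous_coinduced_dom.2 (by
      change Continuous fun t => (g t : ℂ)
      fun_prop)⟩
  have hG : ∀ t : ℝ, G (t : AddCircle (2 * π)) = g t := fun t => rfl
  have hcoeff : ∀ n : ℤ, fourierCoeff G n = 0 := by
    intro n
    rw [fourierCoeff_eq_intervalIntegral G n (-π), show -π + 2 * π = π by ring]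
    simp only [hG, smul_eq_mul]
    refine smul_eq_zero_of_right _ ?_
    obtain ⟨k, rfl | rfl⟩ := n.eq_nat_or_neg
    · rw [← h k]
      refine intervalIntegral.integral_congr fun t _ => ?_
      simp only [fourier_coe_apply]
      rw [mul_comm]
      congr 2
      push_cast
      field_simp
    · rw [← map_zero (starRingEnd ℂ), ← h k]
      unfold expCoeff
      rw [← intervalIntegral.intervalIntegral_conj]
      refine intervalIntegral.integral_congr fun t _ => ?_
      simp only [fourier_coe_apply, map_mul, Complex.conj_ofReal, ← Complex.exp_conj, map_neg,
        Complex.conj_I]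
      rw [mul_comm]
      congr 2
      push_cast
      field_simp
  have hs : Summable (fourierCoeff G) := by
    rw [show fourierCoeff G = 0 from funext hcoeff]
    exact summable_zero
  have := has_pointwise_sum_fourier_series_of_summable hs (x : AddCircle (2 * π))
  simp only [hcoeff, zero_smul, hG] at this
  exact_mod_cast this.unique hasSum_zero

/-- The continuous piecewise linear cut-off equal to `1` on `(-∞, 1]` and to `0` on `[2, ∞)`. -/
def cutoff (x : ℝ) : ℝ := max 0 (min 1 (2 - x))

theorem cutoff_nonneg (x : ℝ) : 0 ≤ cutoff x := le_max_left _ _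

theorem cutoff_le_one (x : ℝ) : cutoff x ≤ 1 := max_le zero_le_one (min_le_left _ _)

theorem cutoff_of_le {x : ℝ} (h : x ≤ 1) : cutoff x = 1 := by
  rw [cutoff, min_eq_left (by linarith), max_eq_right zero_le_one]

theorem cutoff_of_ge {x : ℝ} (h : 2 ≤ x) : cutoff x = 0 := by
  rw [cutoff, min_eq_right (by linarith), max_eq_left (by linarith)]

theorem cutoff_antitone : Antitone cutoff := fun x y h => by
  unfold cutoff
  gcongr

theorem abs_cutoff_sub_le (x y : ℝ) : |cutoff x - cutoff y| ≤ |x - y| := by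
  unfold cutoff
  have h1 := abs_max_sub_max_le_max 0 (min 1 (2 - x)) 0 (min 1 (2 - y))
  have h2 := abs_min_sub_min_le_max 1 (2 - x) 1 (2 - y)
  rw [sub_self, abs_zero, max_eq_right (a := (0 : ℝ)) (b := |_|) (abs_nonneg _)] at h1 h2
  rw [abs_sub_comm x y, show y - x = 2 - x - (2 - y) by ring]
  exact h1.trans h2

/-- The dyadic partition of unity on the positive integers subordinate to the blocks
`(2 ^ (i - 1), 2 ^ (i + 1))`. -/
def dyadicBump (i k : ℕ) : ℝ := cutoff (k / 2 ^ i) - cutoff (2 * k / 2 ^ i)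

theorem dyadicBump_nonneg (i k : ℕ) : 0 ≤ dyadicBump i k := by
  refine sub_nonneg.2 (cutoff_antitone ?_)
  gcongr
  linarith [(Nat.cast_nonneg k : (0 : ℝ) ≤ k)]

theorem dyadicBump_le_one (i k : ℕ) : dyadicBump i k ≤ 1 := by
  unfold dyadicBump
  linarith [cutoff_nonneg (2 * k / 2 ^ i), cutoff_le_one (k / 2 ^ i)]

theorem dyadicBump_of_le {i k : ℕ} (h : (k : ℝ) ≤ 2 ^ i / 2) : dyadicBump i k = 0 := by
  have : (0 : ℝ) < 2 ^ i := by positivity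
  rw [dyadicBump, cutoff_of_le, cutoff_of_le, sub_self]
  · rw [div_le_one this]
    linarith
  · rw [div_le_one this]
    linarith

theorem dyadicBump_zero_right (i : ℕ) : dyadicBump i 0 = 0 :=
  dyadicBump_of_le (by simp; positivity)

theorem dyadicBump_of_ge {i k : ℕ} (h : 2 ^ (i + 1) ≤ k) : dyadicBump i k = 0 := by
  have h' : (2 : ℝ) * 2 ^ i ≤ k := by
    rw [← pow_succ']
    exact_mod_cast h
  have : (0 : ℝ) < 2 ^ i := by positivity
  rw [dyadicBump, cutoff_of_ge, cutoff_of_ge, sub_self]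
  · rw [le_div_iff₀ this]
    linarith
  · rwa [le_div_iff₀ this]

theorem abs_dyadicBump_succ_sub_le (i k : ℕ) :
    |dyadicBump i (k + 1) - dyadicBump i k| ≤ 3 / 2 ^ i := by
  unfold dyadicBump
  have h1 := abs_cutoff_sub_le ((k + 1 : ℕ) / 2 ^ i) (k / 2 ^ i)
  have h2 := abs_cutoff_sub_le (2 * (k + 1 : ℕ) / 2 ^ i) (2 * k / 2 ^ i)
  rw [show ((k + 1 : ℕ) : ℝ) / 2 ^ i - k / 2 ^ i = 1 / 2 ^ i by push_cast; ring,
    abs_of_pos (by positivity : (0 : ℝ) < 1 / 2 ^ i)] at h1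
  rw [show 2 * ((k + 1 : ℕ) : ℝ) / 2 ^ i - 2 * k / 2 ^ i = 2 / 2 ^ i by push_cast; ring,
    abs_of_pos (by positivity : (0 : ℝ) < 2 / 2 ^ i)] at h2
  calc _ = |(cutoff ((k + 1 : ℕ) / 2 ^ i) - cutoff (k / 2 ^ i)) -
        (cutoff (2 * (k + 1 : ℕ) / 2 ^ i) - cutoff (2 * k / 2 ^ i))| := by ring_nf
    _ ≤ _ := abs_sub _ _
    _ ≤ 1 / 2 ^ i + 2 / 2 ^ i := add_le_add h1 h2
    _ = _ := by ring

theorem hasSum_dyadicBump {k : ℕ} (hk : 1 ≤ k) : HasSum (fun i => dyadicBump i k) 1 := by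
  rw [hasSum_iff_tendsto_nat_of_nonneg (fun i => dyadicBump_nonneg i k)]
  have hk' : (1 : ℝ) ≤ k := by exact_mod_cast hk
  have htel : ∀ I : ℕ, ∑ i ∈ Finset.range I, dyadicBump i k = cutoff (2 * k / 2 ^ I) := by
    intro I
    have := Finset.sum_range_sub (fun i => cutoff (2 * k / 2 ^ i)) I
    rw [pow_zero, div_one, cutoff_of_ge (by linarith : (2 : ℝ) ≤ 2 * k), sub_zero] at this
    rw [← this]
    refine Finset.sum_congr rfl fun i _ => ?_
    rw [dyadicBump, pow_succ', mul_div_mul_left _ _ two_ne_zero]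
  refine tendsto_const_nhds.congr' ?_
  filter_upwards [eventually_ge_atTop (2 * k)] with I hI
  rw [htel, cutoff_of_le]
  rw [div_le_one (by positivity)]
  exact_mod_cast hI.trans Nat.lt_two_pow_self.le

/-- The symbol of `f ↦ f - Z_n f` composed with the `r`-fold integration. -/
def zygSymbol (r : ℝ) (n k : ℕ) : ℝ := min (k * (n : ℝ) ^ (-(r + 1))) ((k : ℝ) ^ (-r))

theorem zygSymbol_nonneg (r : ℝ) (n k : ℕ) : 0 ≤ zygSymbol r n k := by
  unfold zygSymbol
  positivity

theorem zygSymbol_eq {r : ℝ} (hr : 0 < r) {n k : ℕ} (hn : 1 ≤ n) (hk : 1 ≤ k) :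
    zygSymbol r n k =
      (if k < n then (k : ℝ) ^ (r + 1) / (n : ℝ) ^ (r + 1) else 1) * (k : ℝ) ^ (-r) := by
  have hk' : (0 : ℝ) < k := by exact_mod_cast hk
  have hn' : (0 : ℝ) < n := by exact_mod_cast hn
  have e : (k : ℝ) = (k : ℝ) ^ (r + 1) * (k : ℝ) ^ (-r) := by
    rw [← Real.rpow_add hk']
    simp
  have e1 : (k : ℝ) * (n : ℝ) ^ (-(r + 1)) =
      (k : ℝ) ^ (r + 1) / (n : ℝ) ^ (r + 1) * (k : ℝ) ^ (-r) := by
    rw [Real.rpow_neg hn'.le]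
    nth_rw 1 [e]
    ring
  unfold zygSymbol
  rw [e1]
  split_ifs with h
  · refine min_eq_left (mul_le_of_le_one_left (by positivity) ?_)
    rw [div_le_one (by positivity)]
    gcongr
  · rw [one_mul]
    refine min_eq_right (le_mul_of_one_le_left (by positivity) ?_)
    rw [one_le_div (by positivity)]
    have : (n : ℝ) ≤ k := by exact_mod_cast not_lt.1 h
    gcongr

theorem abs_zygSymbol_succ_sub_le {r : ℝ} (hr : 0 < r) (n : ℕ) {k : ℕ} (hk : 1 ≤ k) :
    |zygSymbol r n (k + 1) - zygSymbol r n k| ≤ (r + 1) * zygSymbol r n k / k := by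
  have hk' : (0 : ℝ) < k := by exact_mod_cast hk
  have hk1 : (0 : ℝ) < k + 1 := by linarith
  set a : ℝ := k * (n : ℝ) ^ (-(r + 1)) with ha
  set b : ℝ := (k : ℝ) ^ (-r) with hb
  set a' : ℝ := (k + 1 : ℕ) * (n : ℝ) ^ (-(r + 1)) with ha'
  set b' : ℝ := ((k + 1 : ℕ) : ℝ) ^ (-r) with hb'
  have ha0 : 0 ≤ a := by positivity
  have hb0 : 0 ≤ b := by positivity
  have haa : a' = a + a / k := by
    rw [ha, ha']
    push_cast
    field_simp
  have hak : 0 ≤ a / k := by positivity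
  have hbb : b' ≤ b := by
    rw [hb, hb']
    exact Real.rpow_le_rpow_of_nonpos hk' (by push_cast; linarith) (by linarith)
  have hbern : 1 - (r + 1) / k ≤ ((k : ℝ) / (k + 1)) ^ r := by
    have h1 := one_add_mul_self_le_rpow_one_add (s := -(1 / ((k : ℝ) + 1)))
      (by rw [neg_le_neg_iff, div_le_one hk1]; linarith) (p := r + 1) (by linarith)
    have h2 : 1 + -(1 / ((k : ℝ) + 1)) = k / (k + 1) := by
      field_simp
      ring
    rw [h2] at h1
    have h3 : ((k : ℝ) / (k + 1)) ^ (r + 1) ≤ ((k : ℝ) / (k + 1)) ^ r :=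
      Real.rpow_le_rpow_of_exponent_ge (by positivity) (by rw [div_le_one hk1]; linarith)
        (by linarith)
    have h4 : (r + 1) / ((k : ℝ) + 1) ≤ (r + 1) / k := by
      gcongr
      linarith
    have h5 : (r + 1) * -(1 / ((k : ℝ) + 1)) = -((r + 1) / (k + 1)) := by ring
    linarith
  have hbr : b' = b * ((k : ℝ) / (k + 1)) ^ r := by
    rw [hb, hb', Real.div_rpow hk'.le hk1.le, Real.rpow_neg hk'.le, Real.rpow_neg (by positivity)]
    push_cast
    field_simp
  have hblow : b - (r + 1) * b / k ≤ b' := by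
    rw [hbr]
    calc b - (r + 1) * b / k = b * (1 - (r + 1) / k) := by ring
      _ ≤ _ := by gcongr
  change |min a' b' - min a b| ≤ (r + 1) * min a b / k
  have hm0 : 0 ≤ min a b := le_min ha0 hb0
  have hmk : 0 ≤ min a b / k := by positivity
  have hsplit : (r + 1) * min a b / k = r * (min a b / k) + min a b / k := by ring
  have hrm : 0 ≤ r * (min a b / k) := by positivity
  rw [abs_le]
  constructor
  · have : min a b - (r + 1) * min a b / k ≤ min a' b' := by
      refine le_min ?_ ?_
      · linarith [min_le_left a b]
      · rcases le_total 0 (1 - (r + 1) / (k : ℝ)) with h | h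
        · calc min a b - (r + 1) * min a b / k = min a b * (1 - (r + 1) / k) := by ring
            _ ≤ b * (1 - (r + 1) / k) := by
              gcongr
              exact min_le_right _ _
            _ = b - (r + 1) * b / k := by ring
            _ ≤ b' := hblow
        · calc min a b - (r + 1) * min a b / k = min a b * (1 - (r + 1) / k) := by ring
            _ ≤ 0 := mul_nonpos_of_nonneg_of_nonpos hm0 h
            _ ≤ b' := by positivity
    linarith
  · have : min a' b' ≤ min a b + min a b / k := by
      rcases min_choice a b with h | h <;> rw [h]
      · exact (min_le_left _ _).trans haa.le
      · have : 0 ≤ b / k := by positivity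
        exact (min_le_right _ _).trans (by linarith)
    linarith

/-- The size of `zygSymbol` on the `i`-th dyadic block. -/
def blockSize (r : ℝ) (n i : ℕ) : ℝ :=
  min (2 * 2 ^ i * (n : ℝ) ^ (-(r + 1))) ((2 ^ i / 2 : ℝ) ^ (-r))

theorem blockSize_pos (r : ℝ) {n : ℕ} (hn : 1 ≤ n) (i : ℕ) : 0 < blockSize r n i := by
  have hn' : (0 : ℝ) < n := by exact_mod_cast hn
  unfold blockSize
  positivity

theorem zygSymbol_le_blockSize {r : ℝ} (hr : 0 < r) (n : ℕ) {i k : ℕ}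
    (h1 : (2 ^ i / 2 : ℝ) ≤ k) (h2 : (k : ℝ) ≤ 2 * 2 ^ i) :
    zygSymbol r n k ≤ blockSize r n i := by
  unfold zygSymbol blockSize
  refine min_le_min ?_ ?_
  · gcongr
  · exact Real.rpow_le_rpow_of_nonpos (by positivity) h1 (by linarith)

theorem abs_dyadicBump_mul_zygSymbol_le {r : ℝ} (hr : 0 < r) {n : ℕ} (hn : 1 ≤ n) {i k : ℕ}
    (hk : k < 2 ^ (i + 1)) : |dyadicBump i k * zygSymbol r n k| ≤ blockSize r n i := by
  have hk' : (k : ℝ) ≤ 2 * 2 ^ i := by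
    rw [← pow_succ']
    exact_mod_cast hk.le
  rw [abs_of_nonneg (mul_nonneg (dyadicBump_nonneg _ _) (zygSymbol_nonneg _ _ _))]
  rcases le_total (k : ℝ) (2 ^ i / 2) with h | h
  · rw [dyadicBump_of_le h, zero_mul]
    exact (blockSize_pos r hn i).le
  · exact (mul_le_of_le_one_left (zygSymbol_nonneg _ _ _) (dyadicBump_le_one _ _)).trans
      (zygSymbol_le_blockSize hr n h hk')

theorem abs_dyadicBump_mul_zygSymbol_succ_sub_le {r : ℝ} (hr : 0 < r) {n : ℕ} (hn : 1 ≤ n)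
    {i k : ℕ} (hk : k < 2 ^ (i + 1)) :
    |dyadicBump i (k + 1) * zygSymbol r n (k + 1) - dyadicBump i k * zygSymbol r n k| ≤
      (2 * r + 5) * blockSize r n i / 2 ^ i := by
  have hN : (0 : ℝ) < 2 ^ i := by positivity
  have hA := blockSize_pos r hn i
  have hk2 : ((k + 1 : ℕ) : ℝ) ≤ 2 * 2 ^ i := by
    rw [← pow_succ']
    exact_mod_cast hk
  have hk1 : (k : ℝ) ≤ ((k + 1 : ℕ) : ℝ) := by
    push_cast
    linarith
  rcases le_total ((k + 1 : ℕ) : ℝ) (2 ^ i / 2) with h | h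
  · rw [dyadicBump_of_le h, dyadicBump_of_le (hk1.trans h)]
    simp only [zero_mul, sub_self, abs_zero]
    positivity
  have hfirst : |(dyadicBump i (k + 1) - dyadicBump i k) * zygSymbol r n (k + 1)| ≤
      3 / 2 ^ i * blockSize r n i := by
    rw [abs_mul, abs_of_nonneg (zygSymbol_nonneg _ _ _)]
    gcongr
    · exact zygSymbol_nonneg _ _ _
    · exact abs_dyadicBump_succ_sub_le i k
    · exact zygSymbol_le_blockSize hr n h hk2
  have hsecond : |dyadicBump i k * (zygSymbol r n (k + 1) - zygSymbol r n k)| ≤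
      (r + 1) * blockSize r n i / (2 ^ i / 2) := by
    rcases le_or_gt (k : ℝ) (2 ^ i / 2) with h' | h'
    · rw [dyadicBump_of_le h', zero_mul, abs_zero]
      positivity
    · have hk0 : 1 ≤ k := by
        have : (0 : ℝ) < k := lt_trans (by positivity) h'
        exact_mod_cast this
      rw [abs_mul, abs_of_nonneg (dyadicBump_nonneg _ _)]
      refine (mul_le_of_le_one_left (abs_nonneg _) (dyadicBump_le_one _ _)).trans
        ((abs_zygSymbol_succ_sub_le hr n hk0).trans ?_)
      have := zygSymbol_le_blockSize hr n h'.le (hk1.trans hk2)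
      gcongr
  calc _ = |(dyadicBump i (k + 1) - dyadicBump i k) * zygSymbol r n (k + 1) +
        dyadicBump i k * (zygSymbol r n (k + 1) - zygSymbol r n k)| := by ring_nf
    _ ≤ _ := abs_add_le _ _
    _ ≤ 3 / 2 ^ i * blockSize r n i + (r + 1) * blockSize r n i / (2 ^ i / 2) :=
        add_le_add hfirst hsecond
    _ = _ := by
        field_simp
        ring

theorem blockSize_le_geometric (r : ℝ) (n i : ℕ) :
    blockSize r n i ≤ 2 ^ r * ((2 : ℝ) ^ (-r)) ^ i := by
  refine (min_le_right _ _).trans (le_of_eq ?_)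
  rw [Real.div_rpow (by positivity) zero_le_two, ← Real.rpow_natCast ((2 : ℝ) ^ (-r)),
    ← Real.rpow_mul zero_le_two, mul_comm (-r), Real.rpow_mul zero_le_two, Real.rpow_natCast,
    Real.rpow_neg zero_le_two r, div_inv_eq_mul, mul_comm]

theorem two_rpow_neg_lt_one {r : ℝ} (hr : 0 < r) : (2 : ℝ) ^ (-r) < 1 :=
  Real.rpow_lt_one_of_one_lt_of_neg one_lt_two (by linarith)

theorem summable_blockSize {r : ℝ} (hr : 0 < r) {n : ℕ} (hn : 1 ≤ n) :
    Summable (blockSize r n) :=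
  Summable.of_nonneg_of_le (fun i => (blockSize_pos r hn i).le) (blockSize_le_geometric r n)
    ((summable_geometric_of_lt_one (by positivity) (two_rpow_neg_lt_one hr)).mul_left _)

theorem tsum_blockSize_le {r : ℝ} (hr : 0 < r) {n : ℕ} (hn : 1 ≤ n) :
    ∑' i, blockSize r n i ≤ (4 + 2 ^ r / (1 - (2 : ℝ) ^ (-r))) * (n : ℝ) ^ (-r) := by
  have hn' : (0 : ℝ) < n := by exact_mod_cast hn
  have hgeo := summable_geometric_of_lt_one (by positivity) (two_rpow_neg_lt_one hr)
  set j := Nat.log 2 n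
  have hj1 : (2 : ℝ) ^ j ≤ n := by exact_mod_cast Nat.pow_log_le_self 2 (by omega)
  have hj2 : (n : ℝ) ≤ 2 ^ (j + 1) := by
    exact_mod_cast (Nat.lt_pow_succ_log_self one_lt_two n).le
  have hpow : (n : ℝ) * (n : ℝ) ^ (-(r + 1)) = (n : ℝ) ^ (-r) := by
    nth_rw 1 [← Real.rpow_one (n : ℝ)]
    rw [← Real.rpow_add hn']
    ring_nf
  have hhead : ∑ i ∈ Finset.range (j + 1), blockSize r n i ≤ 4 * (n : ℝ) ^ (-r) := by
    calc ∑ i ∈ Finset.range (j + 1), blockSize r n i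
        ≤ ∑ i ∈ Finset.range (j + 1), 2 * 2 ^ i * (n : ℝ) ^ (-(r + 1)) :=
          Finset.sum_le_sum fun i _ => min_le_left _ _
      _ = 2 * (2 ^ (j + 1) - 1) * (n : ℝ) ^ (-(r + 1)) := by
          rw [← Finset.sum_mul, ← Finset.mul_sum, geom_sum_eq (by norm_num)]
          norm_num
      _ ≤ 2 * (2 * n) * (n : ℝ) ^ (-(r + 1)) := by
          gcongr
          rw [pow_succ']
          linarith
      _ = 4 * (n * (n : ℝ) ^ (-(r + 1))) := by ring
      _ = _ := by rw [hpow]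
  have htail : ∑' i, blockSize r n (i + (j + 1)) ≤
      2 ^ r / (1 - (2 : ℝ) ^ (-r)) * (n : ℝ) ^ (-r) := by
    have hle : ∀ i, blockSize r n (i + (j + 1)) ≤
        2 ^ r * (n : ℝ) ^ (-r) * ((2 : ℝ) ^ (-r)) ^ i := by
      intro i
      refine (blockSize_le_geometric r n _).trans ?_
      have : ((2 : ℝ) ^ (-r)) ^ (j + 1) ≤ (n : ℝ) ^ (-r) := by
        rw [← Real.rpow_natCast ((2 : ℝ) ^ (-r)), ← Real.rpow_mul zero_le_two, mul_comm (-r),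
          Real.rpow_mul zero_le_two, Real.rpow_natCast]
        exact Real.rpow_le_rpow_of_nonpos hn' hj2 (by linarith)
      calc 2 ^ r * ((2 : ℝ) ^ (-r)) ^ (i + (j + 1))
          = 2 ^ r * ((2 : ℝ) ^ (-r)) ^ (j + 1) * ((2 : ℝ) ^ (-r)) ^ i := by ring
        _ ≤ _ := by gcongr
    calc _ ≤ ∑' i, 2 ^ r * (n : ℝ) ^ (-r) * ((2 : ℝ) ^ (-r)) ^ i :=
          ((summable_nat_add_iff (j + 1)).2 (summable_blockSize hr hn)).tsum_le_tsum hle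
            (hgeo.mul_left _)
      _ = _ := by
          rw [tsum_mul_left, tsum_geometric_of_lt_one (by positivity) (two_rpow_neg_lt_one hr)]
          ring
  rw [← (summable_blockSize hr hn).sum_add_tsum_nat_add (j + 1), add_mul]
  exact add_le_add hhead htail

/-- The `L¹` constant of the dyadic blocks. -/
def blockConst (r : ℝ) : ℝ := (5 + π ^ 2 * (2 * r + 5) ^ 2) / 2

theorem abs_block_le {r : ℝ} (hr : 0 < r) {n : ℕ} (hn : 1 ≤ n) {β : ℝ} {f φ : ℝ → ℝ}
    (hf : IntervalIntegrable f volume (-π) π)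
    (hφ : IsPsiDeriv (fun k : ℕ => (k : ℝ) ^ (-r)) β f φ) {ρ : ℕ → ℝ}
    (hρ : ∀ k, 1 ≤ k → ρ k * (k : ℝ) ^ (-r) = zygSymbol r n k) (i : ℕ) (x : ℝ) :
    |∑ k ∈ Finset.range (2 ^ (i + 1)), dyadicBump i k * ρ k * harmonicTerm f k x| ≤
      blockConst r * blockSize r n i := by
  set c : ℕ → ℝ := fun k => dyadicBump i k * zygSymbol r n k
  set w : ℂ := Complex.exp (Complex.I * ((-(β * π / 2) : ℝ) : ℂ)) with hw
  have hnw : ‖w‖ = 1 := by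
    rw [hw, mul_comm, Complex.norm_exp_ofReal_mul_I]
  have hrep : ∑ k ∈ Finset.range (2 ^ (i + 1)), dyadicBump i k * ρ k * harmonicTerm f k x =
      ((π : ℂ)⁻¹ * w * ∑ k ∈ Finset.range (2 ^ (i + 1)),
        (c k : ℂ) * expCoeff φ k * Complex.exp (Complex.I * ((k * x : ℝ) : ℂ))).re := by
    rw [Finset.mul_sum, Complex.re_sum]
    refine Finset.sum_congr rfl fun k _ => ?_
    rcases Nat.eq_zero_or_pos k with rfl | hk
    · simp [c, dyadicBump_zero_right]
    · have hk' : (0 : ℝ) < k := by exact_mod_cast hk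
      rw [harmonicTerm_eq_re hf hk.ne',
        expCoeff_of_isPsiDeriv hf hφ hk (Real.rpow_pos_of_pos hk' _).ne', ← hw,
        ← Complex.re_ofReal_mul]
      simp only [c, ← hρ k hk]
      congr 1
      push_cast
      ring
  have hN : (0 : ℝ) < 2 ^ i := by positivity
  have hL1 := integral_norm_trigPoly_le (M := 2 ^ (i + 1)) (c := c) hN (blockSize_pos r hn i)
    (by simp [c, dyadicBump_zero_right]) (by simp [c, dyadicBump_of_ge le_rfl])
    (by push_cast; rw [pow_succ']) (fun k hk => abs_dyadicBump_mul_zygSymbol_le hr hn hk)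
    (fun k hk => abs_dyadicBump_mul_zygSymbol_succ_sub_le hr hn hk)
  rw [hrep]
  refine (Complex.abs_re_le_norm _).trans ?_
  rw [norm_mul, norm_mul, hnw, mul_one, norm_inv, Complex.norm_real, Real.norm_eq_abs,
    abs_of_pos pi_pos]
  calc _ ≤ π⁻¹ * (π / 2 * (5 + π ^ 2 * (2 * r + 5) ^ 2) * blockSize r n i) := by
        gcongr
        exact (norm_sum_mul_expCoeff_le hφ.1 _ _ _).trans hL1
    _ = _ := by
        have := pi_ne_zero
        unfold blockConst
        field_simp

theorem expCoeff_sub {f g : ℝ → ℝ} (hf : Continuous f) (hg : Continuous g) (k : ℕ) :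
    expCoeff (fun x => f x - g x) k = expCoeff f k - expCoeff g k := by
  unfold expCoeff
  push_cast
  simp_rw [sub_mul]
  exact intervalIntegral.integral_sub (Continuous.intervalIntegrable (by fun_prop) _ _)
    (Continuous.intervalIntegrable (by fun_prop) _ _)

theorem hasSum_expCoeff {Q : ℕ → ℝ → ℝ} (hQ : ∀ i, Continuous (Q i)) {u : ℕ → ℝ}
    (hu : Summable u) (hQu : ∀ i x, |Q i x| ≤ u i) (k : ℕ) :
    HasSum (fun i => expCoeff (Q i) k) (expCoeff (fun x => ∑' i, Q i x) k) := by
  refine intervalIntegral.hasSum_integral_of_dominated_convergence (fun i _ => u i)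
    (fun i => Continuous.aestronglyMeasurable (by have := hQ i; fun_prop)) (fun i => ?_)
    (Eventually.of_forall fun _ _ => hu) intervalIntegrable_const
    (Eventually.of_forall fun t _ => ?_)
  · refine Eventually.of_forall fun t _ => ?_
    rw [norm_mul, ← mul_neg, ← Complex.ofReal_neg, mul_comm Complex.I,
      Complex.norm_exp_ofReal_mul_I, mul_one, Complex.norm_real]
    exact hQu i t
  · have : Summable fun i => Q i t := Summable.of_norm_bounded hu fun i => hQu i t
    exact (Complex.hasSum_ofReal.2 this.hasSum).mul_right _

theorem abs_sub_zygmundSum_le {r : ℝ} (hr : 0 < r) {n : ℕ} (hn : 1 ≤ n) {β : ℝ} {f : ℝ → ℝ}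
    (hf : ClassC (fun k : ℕ => (k : ℝ) ^ (-r)) β f) (x : ℝ) :
    |f x - ZygmundSum (fun k : ℕ => (k : ℝ) ^ (r + 1)) n f x| ≤
      blockConst r * (4 + 2 ^ r / (1 - (2 : ℝ) ^ (-r))) * (n : ℝ) ^ (-r) := by
  obtain ⟨hfc, hfp, φ, hφ⟩ := hf
  have hfi : IntervalIntegrable f volume (-π) π := hfc.intervalIntegrable _ _
  set ρ : ℕ → ℝ := fun k => if k < n then (k : ℝ) ^ (r + 1) / (n : ℝ) ^ (r + 1) else 1 with hρ
  set Z := ZygmundSum (fun k : ℕ => (k : ℝ) ^ (r + 1)) n f with hZ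
  have hZc : Continuous Z := by
    rw [hZ]
    unfold ZygmundSum
    fun_prop
  set Q : ℕ → ℝ → ℝ := fun i x =>
    ∑ k ∈ Finset.range (2 ^ (i + 1)), dyadicBump i k * ρ k * harmonicTerm f k x with hQ
  have hQc : ∀ i, Continuous (Q i) := fun i => by
    simp only [hQ]
    fun_prop
  have hQb : ∀ i x, |Q i x| ≤ blockConst r * blockSize r n i :=
    abs_block_le hr hn hfi hφ fun k hk => (zygSymbol_eq hr hn hk).symm
  have hs : Summable fun i => blockConst r * blockSize r n i :=
    (summable_blockSize hr hn).mul_left _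
  have hD : Continuous fun x => f x - Z x := hfc.sub hZc
  have hGc : Continuous fun x => ∑' i, Q i x := continuous_tsum hQc hs hQb
  have hcoeffZ : ∀ k, expCoeff (fun x => f x - Z x) k = ρ k * expCoeff f k := by
    intro k
    rw [expCoeff_sub hfc hZc]
    have := expCoeff_sum_harmonicTerm hfi n
      (fun k => 1 - (k : ℝ) ^ (r + 1) / (n : ℝ) ^ (r + 1)) k
    change expCoeff Z k = _ at this
    rw [this, hρ]
    dsimp only
    split_ifs
    · push_cast
      ring
    · simp
  have hcoeffG : ∀ k, expCoeff (fun x => ∑' i, Q i x) k = ρ k * expCoeff f k := by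
    intro k
    refine (hasSum_expCoeff hQc hs hQb k).unique ?_
    have hQk : ∀ i, expCoeff (Q i) k = (dyadicBump i k : ℂ) * (ρ k * expCoeff f k) := by
      intro i
      rw [expCoeff_sum_harmonicTerm hfi (2 ^ (i + 1)) (fun k => dyadicBump i k * ρ k) k]
      split_ifs with h
      · push_cast
        ring
      · rw [dyadicBump_of_ge (not_lt.1 h)]
        simp
    simp_rw [hQk]
    rcases Nat.eq_zero_or_pos k with rfl | hk
    · have : ρ 0 = 0 := by
        simp only [hρ]
        rw [if_pos (by omega), Nat.cast_zero, Real.zero_rpow (by linarith), zero_div]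
      simp [this, hasSum_zero]
    · have h1 := Complex.hasSum_ofReal.2 (hasSum_dyadicBump hk)
      simpa using h1.mul_right ((ρ k : ℂ) * expCoeff f k)
  have hzero := eq_zero_of_expCoeff_eq_zero (g := fun x => (f x - Z x) - ∑' i, Q i x)
    (hD.sub hGc)
    (fun t => by
      have := fun k => harmonicTerm_periodic f k t
      simp only [hfp t, hZ, ZygmundSum, hQ, this])
    (fun k => by rw [expCoeff_sub hD hGc, hcoeffZ, hcoeffG, sub_self]) x
  have hB : 0 ≤ blockConst r := by
    unfold blockConst
    positivity
  rw [sub_eq_zero.1 hzero, ← Real.norm_eq_abs, mul_assoc]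
  refine (tsum_of_norm_bounded hs.hasSum fun i => hQb i x).trans ?_
  rw [tsum_mul_left]
  exact mul_le_mul_of_nonneg_left (tsum_blockSize_le hr hn) hB

/-- for `r > 0`, `s = r + 1` there is `C = C(r) > 0` with
`E(W^r_{β,∞}; Z^s_n) ≤ C n^{-r}` for all `n` and `β`; here `W^r_{β,∞} = C^ψ_{β,∞}` with
`ψ(k) = k^{-r}`. -/
theorem statement5 (r : ℝ) (hr : 0 < r) :
    ∃ C > (0 : ℝ), ∀ (β : ℝ) (n : ℕ), 1 ≤ n →
      classSup (fun k : ℕ => (k : ℝ) ^ (-r)) β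
        (ZygmundSum (fun k : ℕ => (k : ℝ) ^ (r + 1)) n) ≤ C * (n : ℝ) ^ (-r) := by
  have h2 : 0 < 1 - (2 : ℝ) ^ (-r) := sub_pos.2 (two_rpow_neg_lt_one hr)
  have hC : 0 < blockConst r * (4 + 2 ^ r / (1 - (2 : ℝ) ^ (-r))) := by
    unfold blockConst
    positivity
  refine ⟨_, hC, fun β n hn => Real.sSup_le ?_ (by positivity)⟩
  rintro e ⟨f, hf, rfl⟩
  exact Real.iSup_le (fun x => abs_sub_zygmundSum_le hr hn hf x) (by positivity)
end
end

section
/- Let α > 0, β ∈ ℝ, ψ(t) = e^{−αt}, and let p = p(n) be a sequence of natural numbers with 1 ≤ p(n) ≤ n such that p(n) → ∞ and n − p(n) → ∞ as n → ∞. Then lim_{n→∞} E(C^{α,1}_{β,∞}; U^ψ_{n,p(n)}) / E(C^{α,1}_{β,∞}; V_{n,p(n)}) = 0, i.e. on the class C^{α,1}_{β,∞} the sums U^ψ_{n,p} provide a strictly better order of approximation than the classical de la Vallée Poussin sums V_{n,p}. -/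
open MeasureTheory Real Filter Set

noncomputable section

/-- The de la Vallée Poussin sum `V_{n,p}(f;x)`. -/
def Vsum (n p : ℕ) (f : ℝ → ℝ) (x : ℝ) : ℝ :=
  ∑ k ∈ Finset.range n,
    (if k ≤ n - p then (1 : ℝ) else 1 - ((k : ℝ) - n + p) / p) * harmonicTerm f k x

/-- The integral of `cos (j t + θ)` over a period vanishes for a nonzero integer `j`. -/
lemma integral_cos_int_mul_add (j : ℤ) (hj : j ≠ 0) (θ : ℝ) :
    ∫ t in (-π)..π, Real.cos (j * t + θ) = 0 := by
  have hj' : (j : ℝ) ≠ 0 := by exact_mod_cast hj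
  rw [intervalIntegral.integral_comp_mul_add _ hj', integral_cos]
  have h : Real.sin (j * π + θ) = Real.sin (j * -π + θ) := by
    have := Real.sin_add_int_mul_two_pi (j * -π + θ) j
    rw [← this]
    ring_nf
  rw [h]
  simp

lemma integral_cos_mul_cos (N k : ℕ) (hN : 1 ≤ N) (θ η : ℝ) :
    ∫ t in (-π)..π, Real.cos (N * t + θ) * Real.cos (k * t + η) =
      if k = N then π * Real.cos (θ - η) else 0 := by
  have h : ∀ t : ℝ, Real.cos (N * t + θ) * Real.cos (k * t + η) =
      (1 / 2) * (Real.cos (((N + k : ℤ) : ℝ) * t + (θ + η)) +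
        Real.cos (((N - k : ℤ) : ℝ) * t + (θ - η))) := by
    intro t
    rw [Real.cos_add_cos]
    push_cast
    ring_nf
  simp_rw [h]
  rw [intervalIntegral.integral_const_mul, intervalIntegral.integral_add
    (Continuous.intervalIntegrable (by fun_prop) _ _)
    (Continuous.intervalIntegrable (by fun_prop) _ _),
    integral_cos_int_mul_add _ (by omega)]
  split_ifs with hk
  · subst hk
    simp
    ring
  · rw [integral_cos_int_mul_add _ (by omega)]
    simp

lemma fourierA_const_mul_cos (c θ : ℝ) (N k : ℕ) (hN : 1 ≤ N) :
    fourierA (fun t => c * Real.cos (N * t + θ)) k = if k = N then c * Real.cos θ else 0 := by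
  have h := integral_cos_mul_cos N k hN θ 0
  simp only [add_zero, sub_zero] at h
  simp only [fourierA, mul_assoc]
  rw [intervalIntegral.integral_const_mul, h]
  split_ifs
  · field_simp
  · simp

lemma fourierB_const_mul_cos (c θ : ℝ) (N k : ℕ) (hN : 1 ≤ N) :
    fourierB (fun t => c * Real.cos (N * t + θ)) k = if k = N then -(c * Real.sin θ) else 0 := by
  have h := integral_cos_mul_cos N k hN θ (-(π / 2))
  simp only [← sub_eq_add_neg, Real.cos_sub_pi_div_two, sub_neg_eq_add,
    Real.cos_add_pi_div_two] at h
  simp only [fourierB, mul_assoc]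
  rw [intervalIntegral.integral_const_mul, h]
  split_ifs
  · field_simp
  · simp

lemma harmonicTerm_const_mul_cos (c : ℝ) (N k : ℕ) (hN : 1 ≤ N) (x : ℝ) :
    harmonicTerm (fun t => c * Real.cos (N * t + 0)) k x =
      if k = N then c * Real.cos (N * x) else 0 := by
  unfold harmonicTerm
  rw [fourierA_const_mul_cos _ _ _ _ hN, fourierA_const_mul_cos _ _ _ _ hN,
    fourierB_const_mul_cos _ _ _ _ hN]
  by_cases hk : k = N
  · subst hk
    simp [show k ≠ 0 by omega]
  · simp [hk, show ¬ (0 = N) by omega]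

lemma periodic2pi_const_mul_cos (c θ : ℝ) (N : ℕ) :
    Periodic2pi (fun t => c * Real.cos (N * t + θ)) := by
  intro x
  have := Real.cos_add_nat_mul_two_pi (N * x + θ) N
  simp only
  rw [← this]
  ring_nf

lemma classC_const_mul_cos (ψ : ℕ → ℝ) (β : ℝ) (N : ℕ) (hN : 1 ≤ N) (hψ : ψ N ≠ 0) :
    ClassC ψ β (fun t => ψ N * Real.cos (N * t + 0)) := by
  refine ⟨by fun_prop, periodic2pi_const_mul_cos _ _ _,
    fun t => 1 * Real.cos (N * t + β * π / 2), ⟨by fun_prop, periodic2pi_const_mul_cos _ _ _,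
      ae_of_all _ fun t => by simpa using Real.abs_cos_le_one _⟩, ?_, ?_⟩
  · rw [fourierA_const_mul_cos _ _ _ _ hN, if_neg (by omega)]
  · intro k _
    rw [fourierA_const_mul_cos _ _ _ _ hN, fourierB_const_mul_cos _ _ _ _ hN,
      fourierA_const_mul_cos _ _ _ _ hN, fourierB_const_mul_cos _ _ _ _ hN]
    by_cases hk : k = N
    · subst hk
      simp only [if_true, Real.cos_zero, Real.sin_zero]
      constructor <;> field_simp <;> ring
    · simp [hk]

lemma sub_Vsum_const_mul_cos (c : ℝ) (n p : ℕ) (hp : 1 ≤ p) (hpn : p ≤ n) (x : ℝ) :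
    c * Real.cos ((n - p + 1 : ℕ) * x + 0) -
      Vsum n p (fun t => c * Real.cos ((n - p + 1 : ℕ) * t + 0)) x =
      c / p * Real.cos ((n - p + 1 : ℕ) * x) := by
  have hp0 : (p : ℝ) ≠ 0 := by positivity
  unfold Vsum
  simp_rw [harmonicTerm_const_mul_cos c (n - p + 1) _ (by omega), mul_ite, mul_zero]
  rw [Finset.sum_ite_eq', add_zero]
  split_ifs with h1 h2
  · omega
  · have : ((n - p + 1 : ℕ) : ℝ) = n - p + 1 := by push_cast [Nat.cast_sub hpn]; ring
    rw [this]
    field_simp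
    ring
  · have : p = 1 := by
      simp only [Finset.mem_range] at h1
      omega
    subst this
    simp

/-- Lower bound for the deviation of de la Vallée Poussin sums on the class. -/
lemma le_classSup_Vsum (ψ : ℕ → ℝ) (β : ℝ) (n p : ℕ) (hp : 1 ≤ p) (hpn : p ≤ n)
    (hψ : 0 < ψ (n - p + 1))
    (hb : BddAbove {e | ∃ f, ClassC ψ β f ∧ e = ⨆ x : ℝ, |f x - Vsum n p f x|}) :
    ψ (n - p + 1) / p ≤ classSup ψ β (Vsum n p) := by
  refine le_trans ?_ (le_csSup hb ⟨_, classC_const_mul_cos ψ β (n - p + 1) (by omega) hψ.ne', rfl⟩)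
  simp_rw [sub_Vsum_const_mul_cos _ n p hp hpn]
  have hpos : 0 ≤ ψ (n - p + 1) / p := by positivity
  refine le_trans ?_ (le_ciSup (f := fun x : ℝ =>
    |ψ (n - p + 1) / p * Real.cos ((n - p + 1 : ℕ) * x)|) ⟨ψ (n - p + 1) / p, ?_⟩ 0)
  · simp [abs_of_nonneg hpos]
  · rintro _ ⟨x, rfl⟩
    simp only [abs_mul, abs_of_nonneg hpos]
    exact mul_le_of_le_one_right hpos (Real.abs_cos_le_one _)

/-- A continuous `2π`-periodic function is the sum of its Fourier series wherever the coefficients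
are summable. -/
lemma hasSum_harmonicTerm (f : ℝ → ℝ) (hf : Continuous f) (hper : Periodic2pi f)
    (hA : Summable fun k => |fourierA f k|) (hB : Summable fun k => |fourierB f k|) (x : ℝ) :
    HasSum (fun k => harmonicTerm f k x) (f x) := by
  have : Fact (0 < 2 * π) := ⟨Real.two_pi_pos⟩
  have hperC : Function.Periodic (fun t => (f t : ℂ)) (2 * π) := fun t => by
    simp only
    rw [hper t]
  let F : C(AddCircle (2 * π), ℂ) := ⟨hperC.lift, by
    apply continuous_coinduced_dom.mpr
    exact Complex.continuous_ofReal.comp hf⟩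
  have hF : ∀ t : ℝ, F (t : AddCircle (2 * π)) = f t := fun t => hperC.lift_coe t
  have hfour : ∀ (j : ℤ) (t : ℝ), fourier j (t : AddCircle (2 * π)) =
      (Real.cos (j * t) : ℂ) + (Real.sin (j * t) : ℂ) * Complex.I := by
    intro j t
    rw [fourier_coe_apply, Complex.ofReal_cos, Complex.ofReal_sin, ← Complex.exp_mul_I]
    congr 1
    have : (π : ℂ) ≠ 0 := by exact_mod_cast Real.pi_ne_zero
    push_cast
    field_simp
  have hcoef : ∀ j : ℤ, fourierCoeff F j =
      ((((1 / (2 * π)) * ∫ t in (-π)..π, f t * Real.cos (j * t) : ℝ)) : ℂ) -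
      ((((1 / (2 * π)) * ∫ t in (-π)..π, f t * Real.sin (j * t) : ℝ)) : ℂ) * Complex.I := by
    intro j
    rw [fourierCoeff_eq_intervalIntegral _ _ (-π), show -π + 2 * π = π by ring]
    have h1 : ∀ t : ℝ, fourier (-j) (t : AddCircle (2 * π)) • F (t : AddCircle (2 * π)) =
        ((f t * Real.cos (j * t) : ℝ) : ℂ) - ((f t * Real.sin (j * t) : ℝ) : ℂ) * Complex.I := by
      intro t
      rw [hfour, hF]
      push_cast
      simp only [neg_mul, Complex.cos_neg, Complex.sin_neg, smul_eq_mul]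
      ring
    simp_rw [h1]
    rw [intervalIntegral.integral_sub
      (Continuous.intervalIntegrable (by fun_prop) _ _)
      (Continuous.intervalIntegrable (by fun_prop) _ _),
      intervalIntegral.integral_mul_const, intervalIntegral.integral_ofReal,
      intervalIntegral.integral_ofReal, Complex.real_smul]
    push_cast
    ring
  have hpos : ∀ k : ℕ, fourierCoeff F (k : ℤ) =
      ((fourierA f k / 2 : ℝ) : ℂ) - ((fourierB f k / 2 : ℝ) : ℂ) * Complex.I := by
    intro k
    rw [hcoef, fourierA, fourierB]
    push_cast
    ring
  have hneg : ∀ k : ℕ, fourierCoeff F (-(k : ℤ)) =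
      ((fourierA f k / 2 : ℝ) : ℂ) + ((fourierB f k / 2 : ℝ) : ℂ) * Complex.I := by
    intro k
    rw [hcoef, fourierA, fourierB]
    simp only [Int.cast_neg, Int.cast_natCast, neg_mul, Real.cos_neg, Real.sin_neg, mul_neg,
      intervalIntegral.integral_neg]
    push_cast
    ring
  have hbound : Summable fun k => |fourierA f k| / 2 + |fourierB f k| / 2 :=
    (hA.div_const 2).add (hB.div_const 2)
  have hsum : Summable (fourierCoeff F) := by
    apply Summable.of_nat_of_neg
    · refine Summable.of_norm_bounded hbound fun k => ?_
      rw [hpos]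
      refine (norm_sub_le _ _).trans (le_of_eq ?_)
      simp
    · refine Summable.of_norm_bounded hbound fun k => ?_
      rw [hneg]
      refine (norm_add_le _ _).trans (le_of_eq ?_)
      simp
  have hs := (has_pointwise_sum_fourier_series_of_summable hsum (x : AddCircle (2 * π))).nat_add_neg
  rw [hF] at hs
  have hterm : ∀ k : ℕ, fourierCoeff F (k : ℤ) • fourier (k : ℤ) (x : AddCircle (2 * π)) +
      fourierCoeff F (-(k : ℤ)) • fourier (-(k : ℤ)) (x : AddCircle (2 * π)) =
      ((fourierA f k * Real.cos (k * x) + fourierB f k * Real.sin (k * x) : ℝ) : ℂ) := by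
    intro k
    rw [hpos, hneg, hfour, hfour]
    push_cast
    simp only [neg_mul, Complex.cos_neg, Complex.sin_neg, smul_eq_mul]
    linear_combination (-(fourierB f k : ℂ) * Complex.sin (k * x)) * Complex.I_mul_I
  simp only [hterm] at hs
  have h0 : fourierCoeff F 0 • fourier (0 : ℤ) (x : AddCircle (2 * π)) =
      ((fourierA f 0 / 2 : ℝ) : ℂ) := by
    have := hpos 0
    simp only [Nat.cast_zero] at this
    rw [this]
    simp [fourierB]
  rw [h0, ← Complex.ofReal_add, Complex.hasSum_ofReal] at hs
  have h1 : HasSum (fun k : ℕ => if k = 0 then fourierA f 0 / 2 else 0) (fourierA f 0 / 2) :=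
    hasSum_ite_eq 0 _
  have h2 := hs.sub h1
  rw [add_sub_cancel_right] at h2
  refine (congrArg (HasSum · (f x)) (funext fun k => ?_)).mp h2
  unfold harmonicTerm
  split_ifs with hk
  · subst hk
    simp only [CharP.cast_eq_zero, zero_mul, Real.cos_zero, Real.sin_zero]
    ring
  · simp

lemma abs_fourier_integral_le (φ g : ℝ → ℝ) (hφ : ∀ᵐ t ∂(volume : Measure ℝ), |φ t| ≤ 1)
    (hg : ∀ t, |g t| ≤ 1) : |(1 / π) * ∫ t in (-π)..π, φ t * g t| ≤ 2 := by
  have h : ‖∫ t in (-π)..π, φ t * g t‖ ≤ 1 * |π - -π| := by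
    apply intervalIntegral.norm_integral_le_of_norm_le_const_ae
    filter_upwards [hφ] with t ht _
    rw [Real.norm_eq_abs, abs_mul]
    exact mul_le_one₀ ht (abs_nonneg _) (hg t)
  have hπ := Real.pi_pos
  rw [Real.norm_eq_abs, show π - -π = 2 * π by ring, abs_of_pos (by positivity : 0 < 2 * π)] at h
  rw [abs_mul, abs_of_pos (by positivity : 0 < 1 / π)]
  calc 1 / π * |∫ t in (-π)..π, φ t * g t| ≤ 1 / π * (1 * (2 * π)) := by gcongr
    _ = 2 := by field_simp

lemma abs_mul_add_mul_le {a b c s C : ℝ} (ha : |a| ≤ C) (hb : |b| ≤ C) (hc : |c| ≤ 1)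
    (hs : |s| ≤ 1) : |a * c + b * s| ≤ 2 * C := by
  have hC : 0 ≤ C := (abs_nonneg a).trans ha
  calc |a * c + b * s| ≤ |a| * |c| + |b| * |s| := by
        simpa only [abs_mul] using abs_add_le (a * c) (b * s)
    _ ≤ C * 1 + C * 1 := by gcongr
    _ = 2 * C := by ring

lemma abs_fourier_le_of_classC (ψ : ℕ → ℝ) (hψ : ∀ k, 0 < ψ k) (β : ℝ) (f : ℝ → ℝ)
    (hf : ClassC ψ β f) (k : ℕ) (hk : 1 ≤ k) :
    |fourierA f k| ≤ 4 * ψ k ∧ |fourierB f k| ≤ 4 * ψ k := by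
  obtain ⟨_, _, φ, ⟨_, _, hφ⟩, _, h⟩ := hf
  obtain ⟨h1, h2⟩ := h k hk
  have hA : |fourierA φ k| ≤ 2 := abs_fourier_integral_le φ _ hφ fun t => Real.abs_cos_le_one _
  have hB : |fourierB φ k| ≤ 2 := abs_fourier_integral_le φ _ hφ fun t => Real.abs_sin_le_one _
  have hψk := hψ k
  have hcs := Real.sin_sq_add_cos_sq (β * π / 2)
  have hc := Real.abs_cos_le_one (β * π / 2)
  have hs := Real.abs_sin_le_one (β * π / 2)
  have eA : fourierA f k = ψ k * (fourierA φ k * Real.cos (β * π / 2) +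
      fourierB φ k * -Real.sin (β * π / 2)) := by
    rw [h1, h2]
    field_simp
    linear_combination (-fourierA f k) * hcs
  have eB : fourierB f k = ψ k * (fourierA φ k * Real.sin (β * π / 2) +
      fourierB φ k * Real.cos (β * π / 2)) := by
    rw [h1, h2]
    field_simp
    linear_combination (-fourierB f k) * hcs
  constructor
  · rw [eA, abs_mul, abs_of_pos hψk]
    nlinarith [abs_mul_add_mul_le hA hB hc ((abs_neg _).trans_le hs)]
  · rw [eB, abs_mul, abs_of_pos hψk]
    nlinarith [abs_mul_add_mul_le hA hB hs hc]

lemma abs_harmonicTerm_le_of_classC (ψ : ℕ → ℝ) (hψ : ∀ k, 0 < ψ k) (β : ℝ) (f : ℝ → ℝ)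
    (hf : ClassC ψ β f) (k : ℕ) (hk : 1 ≤ k) (x : ℝ) : |harmonicTerm f k x| ≤ 8 * ψ k := by
  obtain ⟨hA, hB⟩ := abs_fourier_le_of_classC ψ hψ β f hf k hk
  rw [harmonicTerm, if_neg (by omega)]
  linarith [abs_mul_add_mul_le hA hB (Real.abs_cos_le_one (k * x)) (Real.abs_sin_le_one (k * x))]

lemma hasSum_harmonicTerm_of_classC (ψ : ℕ → ℝ) (hψ : ∀ k, 0 < ψ k) (hsum : Summable ψ) (β : ℝ)
    (f : ℝ → ℝ) (hf : ClassC ψ β f) (x : ℝ) : HasSum (fun k => harmonicTerm f k x) (f x) := by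
  refine hasSum_harmonicTerm f hf.1 hf.2.1 ?_ ?_ x
  · rw [← summable_nat_add_iff 1]
    refine Summable.of_nonneg_of_le (fun _ => abs_nonneg _) (fun k =>
      (abs_fourier_le_of_classC ψ hψ β f hf (k + 1) (by omega)).1)
      (((summable_nat_add_iff 1).2 hsum).mul_left 4)
  · rw [← summable_nat_add_iff 1]
    refine Summable.of_nonneg_of_le (fun _ => abs_nonneg _) (fun k =>
      (abs_fourier_le_of_classC ψ hψ β f hf (k + 1) (by omega)).2)
      (((summable_nat_add_iff 1).2 hsum).mul_left 4)

lemma abs_sub_Usum_le (ψ : ℕ → ℝ) (hψ : ∀ k, 0 < ψ k) (hsum : Summable ψ) (β : ℝ)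
    (f : ℝ → ℝ) (hf : ClassC ψ β f) (n p : ℕ) (hp : 1 ≤ p) (hpn : p ≤ n) (x : ℝ) :
    |f x - Usum ψ n p f x| ≤ p * (8 * ψ n) + ∑' k, 8 * ψ (k + n) := by
  have hs := hasSum_harmonicTerm_of_classC ψ hψ hsum β f hf x
  have hdecomp : f x - Usum ψ n p f x =
      ∑ k ∈ Finset.range n, (1 - lambdaU ψ n p k) * harmonicTerm f k x +
        ∑' k, harmonicTerm f (k + n) x := by
    rw [← hs.tsum_eq, ← hs.summable.sum_add_tsum_nat_add n, Usum]
    simp only [sub_mul, one_mul, Finset.sum_sub_distrib]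
    ring
  have hp0 : (0 : ℝ) < p := by exact_mod_cast hp
  rw [hdecomp]
  refine (abs_add_le _ _).trans (add_le_add ?_ ?_)
  · have hn : n = (n - p) + p := by omega
    rw [show Finset.range n = Finset.range ((n - p) + p) by rw [← hn], Finset.sum_range_add,
      Finset.sum_eq_zero, zero_add]
    · refine (Finset.abs_sum_le_sum_abs _ _).trans ?_
      refine (Finset.sum_le_card_nsmul _ _ (8 * ψ n) fun j hj => ?_).trans (by simp)
      rw [Finset.mem_range] at hj
      have hψn := hψ n
      rcases Nat.eq_zero_or_pos j with rfl | hj0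
      · simp only [lambdaU, add_zero, le_refl, if_true, sub_self, zero_mul, abs_zero]
        positivity
      · have hψk := hψ (n - p + j)
        have hcast : ((n - p + j : ℕ) : ℝ) - n + p = j := by
          push_cast [Nat.cast_sub hpn]
          ring
        rw [lambdaU, if_neg (by omega), hcast, sub_sub_cancel, abs_mul,
          abs_of_nonneg (by positivity)]
        have hjp : (j : ℝ) ≤ p := by exact_mod_cast hj.le
        calc (j : ℝ) / ψ (n - p + j) / (p / ψ n) * |harmonicTerm f (n - p + j) x|
            ≤ (j : ℝ) / ψ (n - p + j) / (p / ψ n) * (8 * ψ (n - p + j)) := by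
              gcongr
              exact abs_harmonicTerm_le_of_classC ψ hψ β f hf _ (by omega) x
          _ = (j / p) * (8 * ψ n) := by field_simp
          _ ≤ 1 * (8 * ψ n) := by
              gcongr
              exact (div_le_one hp0).2 hjp
          _ = 8 * ψ n := one_mul _
    · intro k hk
      rw [Finset.mem_range] at hk
      simp [lambdaU, hk.le]
  · rw [← Real.norm_eq_abs]
    refine tsum_of_norm_bounded
      (((summable_nat_add_iff n).2 hsum).mul_left 8).hasSum fun k => ?_
    exact abs_harmonicTerm_le_of_classC ψ hψ β f hf _ (by omega) x

/-- Upper bound for the deviation of the sums `U^ψ_{n,p}` on the class for `ψ(k) = e^{-αk}`. -/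
lemma classSup_Usum_exp_le (α β : ℝ) (hα : 0 < α) (n p : ℕ) (hp : 1 ≤ p) (hpn : p ≤ n) :
    classSup (fun k : ℕ => Real.exp (-α * k)) β (Usum (fun k : ℕ => Real.exp (-α * k)) n p) ≤
      8 * (1 + (1 - Real.exp (-α))⁻¹) * p * Real.exp (-α * n) := by
  have hr : Real.exp (-α) < 1 := Real.exp_lt_one_iff.2 (by linarith)
  have hgeo : HasSum (fun k : ℕ => Real.exp (-α * k)) (1 - Real.exp (-α))⁻¹ := by
    convert hasSum_geometric_of_lt_one (Real.exp_pos _).le hr using 2 with k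
    rw [← Real.exp_nat_mul, mul_comm]
  have hinv : 0 < (1 - Real.exp (-α))⁻¹ := inv_pos.2 (by linarith)
  have htail : ∑' k : ℕ, 8 * Real.exp (-α * (k + n : ℕ)) =
      8 * Real.exp (-α * n) * (1 - Real.exp (-α))⁻¹ := by
    rw [← hgeo.tsum_eq, ← tsum_mul_left]
    congr 1
    funext k
    rw [mul_assoc, ← Real.exp_add]
    push_cast
    ring_nf
  have hp' : (1 : ℝ) ≤ p := by exact_mod_cast hp
  refine Real.sSup_le ?_ (by positivity)
  rintro _ ⟨f, hf, rfl⟩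
  refine Real.iSup_le (fun x => ?_) (by positivity)
  refine (abs_sub_Usum_le _ (fun k => Real.exp_pos _) hgeo.summable β f hf n p hp hpn x).trans ?_
  rw [htail]
  have : 8 * Real.exp (-α * n) * (1 - Real.exp (-α))⁻¹ * 1 ≤
      8 * Real.exp (-α * n) * (1 - Real.exp (-α))⁻¹ * p := by gcongr
  linarith

/-- for `α > 0`, `β ∈ ℝ`, `ψ(t) = e^{-αt}` and `1 ≤ p(n) ≤ n` with
`p(n) → ∞` and `n - p(n) → ∞`, the ratio
`E(C^{α,1}_{β,∞}; U^ψ_{n,p(n)}) / E(C^{α,1}_{β,∞}; V_{n,p(n)})` tends to `0`. -/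
theorem statement6 (α β : ℝ) (hα : 0 < α) (p : ℕ → ℕ)
    (hp : ∀ n : ℕ, 1 ≤ n → 1 ≤ p n ∧ p n ≤ n)
    (hp1 : Tendsto p atTop atTop)
    (hp2 : Tendsto (fun n : ℕ => n - p n) atTop atTop) :
    Tendsto (fun n : ℕ =>
      classSup (fun k : ℕ => Real.exp (-α * k)) β
          (Usum (fun k : ℕ => Real.exp (-α * k)) n (p n)) /
        classSup (fun k : ℕ => Real.exp (-α * k)) β (Vsum n (p n)))
      atTop (nhds 0) := by
  set C : ℝ := 8 * (1 + (1 - Real.exp (-α))⁻¹) * Real.exp α with hC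
  have hr : Real.exp (-α) < 1 := Real.exp_lt_one_iff.2 (by linarith)
  have hinv : 0 < (1 - Real.exp (-α))⁻¹ := inv_pos.2 (by linarith)
  have hlim : Tendsto (fun n : ℕ => C * ((p n : ℝ) ^ 2 * Real.exp (-α * p n))) atTop (nhds 0) := by
    have h := (tendsto_rpow_mul_exp_neg_mul_atTop_nhds_zero 2 α hα).comp
      (tendsto_natCast_atTop_atTop.comp hp1)
    simpa using h.const_mul C
  have hnonneg : ∀ T, 0 ≤ classSup (fun k : ℕ => Real.exp (-α * k)) β T := by
    intro T
    refine Real.sSup_nonneg ?_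
    rintro _ ⟨f, _, rfl⟩
    exact Real.iSup_nonneg fun x => abs_nonneg _
  refine tendsto_of_tendsto_of_tendsto_of_le_of_le' tendsto_const_nhds hlim
    (Eventually.of_forall fun n => div_nonneg (hnonneg _) (hnonneg _)) ?_
  filter_upwards [eventually_ge_atTop 1] with n hn
  obtain ⟨h1, h2⟩ := hp n hn
  have hp0 : (0 : ℝ) < p n := by exact_mod_cast h1
  by_cases hb : BddAbove {e | ∃ f, ClassC (fun k : ℕ => Real.exp (-α * k)) β f ∧
      e = ⨆ x : ℝ, |f x - Vsum n (p n) f x|}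
  · have hV := le_classSup_Vsum _ β n (p n) h1 h2 (Real.exp_pos _) hb
    have hU := classSup_Usum_exp_le α β hα n (p n) h1 h2
    have hpos : 0 < Real.exp (-α * (n - p n + 1 : ℕ)) / p n := by positivity
    refine (div_le_div₀ (by positivity) hU hpos hV).trans (le_of_eq ?_)
    have hexp : Real.exp (-α * n) =
        Real.exp α * Real.exp (-α * p n) * Real.exp (-α * (n - p n + 1 : ℕ)) := by
      rw [← Real.exp_add, ← Real.exp_add]
      push_cast [Nat.cast_sub h2]
      ring_nf
    rw [hexp, hC]
    field_simp
  · have : classSup (fun k : ℕ => Real.exp (-α * k)) β (Vsum n (p n)) = 0 :=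
      Real.sSup_of_not_bddAbove hb
    rw [this, div_zero]
    positivity
end
end

section
/- Let ψ ∈ M' = {ψ ∈ M : ∫_1^∞ ψ(t)/t dt < ∞}, β ∈ ℝ, n, p ∈ ℕ with p ≤ n, and let α(n) be a sequence of real numbers with α(n) ≥ K/n for all n, where K > 0 is a constant. Then there is a constant C (depending only on ψ and K, uniform in β, n, p and f) such that for every f ∈ C^ψ_{β,∞}: |ρ_{n,p}(f;0) − (−1)^s·(ψ(n)/π)·∫_{I_{α_n}} f^ψ_β(t/n)·sin(t + βπ/2)/t dt| ≤ C·r_n, where ρ_{n,p}(f;0) = f(0) − U^ψ_{n,p}(f;0); the set I_{α_n} equals (−n/p, −α(n)n) ∪ (α(n)n, n/p) if α(n) ≤ 1/p, equals (−α(n)n, −n/p) ∪ (n/p, α(n)n) if 1/p < α(n) ≤ 1, and equals (−n, −n/p) ∪ (n/p, n) if α(n) > 1; s = 1 if α(n) ≤ 1/p and s = 0 if α(n) > 1/p; and r_n = ψ(n) + ∫_{1/α(n)}^∞ ψ(t+n)/t dt + ∫_{α(n)}^∞ (ψ(n) − ψ(n + 1/t))/t dt. -/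
open MeasureTheory Real Filter Set

noncomputable section

/-- The set `M' = {ψ ∈ M : ∫_1^∞ ψ(t)/t dt < ∞}`. -/
def MprimeClass (ψ : ℝ → ℝ) : Prop :=
  MClass ψ ∧ IntegrableOn (fun t => ψ t / t) (Set.Ici 1)

/-! ### Monotonicity and convexity of functions of the class `M` -/

lemma MClass.antitoneOn {ψ : ℝ → ℝ} (h : MClass ψ) : AntitoneOn ψ (Ici 1) := by
  intro x hx y hy hxy
  by_contra! hlt
  have hne : x < y := lt_of_le_of_ne hxy (by rintro rfl; exact lt_irrefl _ hlt)
  have hge : ∀ z > y, ψ y ≤ ψ z := by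
    intro z hz
    have hs := h.2.1.slope_mono_adjacent hx (mem_Ici.2 (le_trans hy hz.le)) hne hz
    have h1 : 0 < (ψ y - ψ x) / (y - x) := div_pos (by linarith) (by linarith)
    have h2 : 0 < (ψ z - ψ y) / (z - y) := lt_of_lt_of_le h1 hs
    have h3 : 0 < ψ z - ψ y := by
      rcases div_pos_iff.1 h2 with h | h <;> linarith [h.1, h.2]
    linarith
  have h4 : ψ y ≤ 0 := by
    refine ge_of_tendsto h.2.2 ?_
    filter_upwards [eventually_gt_atTop y] with z hz using hge z hz
  linarith [h.1 x hx]

lemma MClass.pos {ψ : ℝ → ℝ} (h : MClass ψ) {t : ℝ} (ht : 1 ≤ t) : 0 < ψ t := h.1 t ht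

lemma MClass.le {ψ : ℝ → ℝ} (h : MClass ψ) {s t : ℝ} (hs : 1 ≤ s) (hst : s ≤ t) :
    ψ t ≤ ψ s := h.antitoneOn (mem_Ici.2 hs) (mem_Ici.2 (hs.trans hst)) hst

/-- Chord slopes of `ψ` from a base point shrink in absolute value. -/
lemma MClass.chord {ψ : ℝ → ℝ} (h : MClass ψ) {s u v : ℝ} (hs : 1 ≤ s) (hu : 0 < u)
    (huv : u ≤ v) : u * (ψ s - ψ (s + v)) ≤ v * (ψ s - ψ (s + u)) := by
  have hv : 0 < v := hu.trans_le huv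
  have hc := h.2.1.2 (mem_Ici.2 hs) (mem_Ici.2 (show (1 : ℝ) ≤ s + v by linarith))
    (show 0 ≤ 1 - u / v by rw [sub_nonneg, div_le_one hv]; exact huv)
    (show 0 ≤ u / v by positivity) (by ring)
  have e : (1 - u / v) • s + (u / v) • (s + v) = s + u := by
    simp only [smul_eq_mul]; field_simp; ring
  rw [e] at hc
  simp only [smul_eq_mul] at hc
  have := mul_le_mul_of_nonneg_left hc hv.le
  have e2 : v * ((1 - u / v) * ψ s + u / v * ψ (s + v)) = (v - u) * ψ s + u * ψ (s + v) := by
    field_simp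
  rw [e2] at this
  linarith

/-- Increments of `ψ` over unit steps decrease in absolute value. -/
lemma MClass.step_le {ψ : ℝ → ℝ} (h : MClass ψ) {s : ℝ} (hs : 1 ≤ s) :
    ψ (s + 1) - ψ (s + 2) ≤ ψ s - ψ (s + 1) := by
  have := h.chord hs one_pos (show (1 : ℝ) ≤ 2 by norm_num)
  linarith

/-- Measurability of an antitone function on a half-line, after truncation. -/
lemma MClass.measurable_trunc {ψ : ℝ → ℝ} (h : MClass ψ) :
    Measurable (fun t => ψ (max t 1)) := by
  have : Antitone (fun t => ψ (max t 1)) := fun s t hst =>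
    h.le (le_max_right _ _) (max_le_max_right _ hst)
  exact this.measurable

/-! ### Summation by parts -/

lemma sum_Ico_mul_sub (c S : ℕ → ℝ) {m M : ℕ} (hmM : m ≤ M) :
    ∑ k ∈ Finset.Ico m M, c k * (S (k + 1) - S k) =
      c M * S M - c m * S m + ∑ k ∈ Finset.Ico m M, (c k - c (k + 1)) * S (k + 1) := by
  induction M, hmM using Nat.le_induction with
  | base => simp
  | succ M hM ih =>
    rw [Finset.sum_Ico_succ_top hM, Finset.sum_Ico_succ_top hM, ih]; ring

lemma abs_sum_Ico_mul_sub_le (c S : ℕ → ℝ) {m M : ℕ} {B : ℝ} (hmM : m ≤ M)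
    (hS : ∀ k, |S k| ≤ B) (hc : ∀ k ≥ m, 0 ≤ c k) (hd : ∀ k ≥ m, c (k + 1) ≤ c k) :
    |∑ k ∈ Finset.Ico m M, c k * (S (k + 1) - S k)| ≤ 2 * (c m * B) := by
  rw [sum_Ico_mul_sub c S hmM]
  have h1 : |∑ k ∈ Finset.Ico m M, (c k - c (k + 1)) * S (k + 1)| ≤ (c m - c M) * B := by
    have h2 : ∑ k ∈ Finset.Ico m M, (c k - c (k + 1)) = c m - c M := by
      have := Finset.sum_Ico_sub c hmM
      rw [← neg_sub (c M), ← this, ← Finset.sum_neg_distrib]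
      simp
    rw [← h2, Finset.sum_mul]
    refine (Finset.abs_sum_le_sum_abs _ _).trans (Finset.sum_le_sum fun k hk => ?_)
    have hk' := (Finset.mem_Ico.1 hk).1
    rw [abs_mul, abs_of_nonneg (sub_nonneg.2 (hd k hk'))]
    exact mul_le_mul_of_nonneg_left (hS _) (sub_nonneg.2 (hd k hk'))
  have h3 : |c M * S M| ≤ c M * B := by
    rw [abs_mul, abs_of_nonneg (hc M hmM)]
    exact mul_le_mul_of_nonneg_left (hS _) (hc M hmM)
  have h4 : |c m * S m| ≤ c m * B := by
    rw [abs_mul, abs_of_nonneg (hc m le_rfl)]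
    exact mul_le_mul_of_nonneg_left (hS _) (hc m le_rfl)
  rw [abs_le] at *
  constructor <;> linarith [h1.1, h1.2, h3.1, h3.2, h4.1, h4.2]

/-! ### Trigonometric telescoping -/

/-- Antidifference of `k ↦ cos (k t + θ)`. -/
def cosAnti (t θ : ℝ) (k : ℕ) : ℝ :=
  Real.sin ((k - 1 / 2) * t + θ) / (2 * Real.sin (t / 2))

/-- Antidifference of `k ↦ cosAnti t θ (k + 1)`. -/
def cosAntiTwo (t θ : ℝ) (k : ℕ) : ℝ :=
  -Real.cos (k * t + θ) / (4 * Real.sin (t / 2) ^ 2)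

lemma cosAnti_sub {t θ : ℝ} (ht : Real.sin (t / 2) ≠ 0) (k : ℕ) :
    cosAnti t θ (k + 1) - cosAnti t θ k = Real.cos (k * t + θ) := by
  have e1 : (((k + 1 : ℕ) : ℝ) - 1 / 2) * t + θ = (k * t + θ) + t / 2 := by push_cast; ring
  have e2 : ((k : ℝ) - 1 / 2) * t + θ = (k * t + θ) - t / 2 := by ring
  unfold cosAnti
  rw [e1, e2, Real.sin_add, Real.sin_sub]
  field_simp
  ring

lemma cosAntiTwo_sub {t θ : ℝ} (ht : Real.sin (t / 2) ≠ 0) (k : ℕ) :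
    cosAntiTwo t θ (k + 1) - cosAntiTwo t θ k = cosAnti t θ (k + 1) := by
  have e1 : (((k + 1 : ℕ) : ℝ) - 1 / 2) * t + θ = (k * t + θ) + t / 2 := by push_cast; ring
  have e2 : ((k + 1 : ℕ) : ℝ) * t + θ = ((k * t + θ) + t / 2) + t / 2 := by push_cast; ring
  have e3 : (k : ℝ) * t + θ = ((k * t + θ) + t / 2) - t / 2 := by ring
  unfold cosAnti cosAntiTwo
  rw [e1, e2]
  nth_rewrite 2 [e3]
  rw [Real.cos_add, Real.cos_sub]
  field_simp
  ring

lemma abs_sin_half_ge {t : ℝ} (htp : |t| ≤ π) : |t| / π ≤ |Real.sin (t / 2)| := by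
  have h := Real.mul_abs_le_abs_sin (x := t / 2) (by rw [abs_div, abs_two]; linarith)
  rw [abs_div, abs_two] at h
  have : 2 / π * (|t| / 2) = |t| / π := by ring
  linarith

lemma sin_half_ne {t : ℝ} (ht : t ≠ 0) (htp : |t| ≤ π) : Real.sin (t / 2) ≠ 0 := by
  have := abs_sin_half_ge htp
  have h2 : 0 < |t| / π := div_pos (abs_pos.2 ht) pi_pos
  exact abs_pos.1 (h2.trans_le this)

lemma abs_cosAnti_le {t θ : ℝ} (ht : t ≠ 0) (htp : |t| ≤ π) (k : ℕ) :
    |cosAnti t θ k| ≤ π / (2 * |t|) := by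
  have h := abs_sin_half_ge htp
  have ht' : 0 < |t| := abs_pos.2 ht
  unfold cosAnti
  rw [abs_div, abs_mul, abs_two]
  calc _ ≤ 1 / (2 * (|t| / π)) := by
        gcongr
        exact Real.abs_sin_le_one _
    _ = _ := by field_simp

lemma abs_cosAntiTwo_le {t θ : ℝ} (ht : t ≠ 0) (htp : |t| ≤ π) (k : ℕ) :
    |cosAntiTwo t θ k| ≤ π ^ 2 / (4 * t ^ 2) := by
  have h := abs_sin_half_ge htp
  have ht' : 0 < |t| := abs_pos.2 ht
  unfold cosAntiTwo
  rw [abs_div, abs_mul, abs_neg, abs_pow, abs_of_pos (show (0 : ℝ) < 4 by norm_num), ← sq_abs t]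
  calc _ ≤ 1 / (4 * (|t| / π) ^ 2) := by
        gcongr
        exact Real.abs_cos_le_one _
    _ = _ := by field_simp

lemma abs_cosAnti_sub_le {t θ : ℝ} (ht : t ≠ 0) (htp : |t| ≤ π) (k : ℕ) :
    |cosAnti t θ k - Real.sin (k * t + θ) / t| ≤ 2 := by
  have hs := sin_half_ne ht htp
  have hcot : |Real.cos (t / 2) / (2 * Real.sin (t / 2)) - 1 / t| ≤ 3 / 2 := by
    wlog hpos : 0 < t generalizing t
    · have := this (t := -t) (neg_ne_zero.2 ht) (by rwa [abs_neg])
        (sin_half_ne (neg_ne_zero.2 ht) (by rwa [abs_neg]))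
        (by rcases lt_or_gt_of_ne ht with h | h
            · linarith
            · exact absurd h hpos)
      rw [neg_div, Real.cos_neg, Real.sin_neg] at this
      rw [← abs_neg]
      convert this using 2
      rw [div_neg, mul_neg, div_neg]; ring
    rw [abs_of_pos hpos] at htp
    have hsl := abs_sin_half_ge (t := t) (by rwa [abs_of_pos hpos])
    have hs0 : 0 < Real.sin (t / 2) :=
      Real.sin_pos_of_pos_of_lt_pi (by linarith) (by linarith [pi_pos])
    rw [abs_of_pos hpos, abs_of_pos hs0] at hsl
    have e : Real.cos (t / 2) / (2 * Real.sin (t / 2)) - 1 / t =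
        (t / 2 * Real.cos (t / 2) - Real.sin (t / 2)) / (t * Real.sin (t / 2)) := by
      field_simp
    rw [e, abs_div, abs_of_pos (mul_pos hpos hs0), div_le_iff₀ (mul_pos hpos hs0)]
    have hc := Real.one_sub_sq_div_two_le_cos (x := t / 2)
    have hc1 := Real.cos_le_one (t / 2)
    have hsle := Real.sin_le (show 0 ≤ t / 2 by linarith)
    have hsge := Real.sin_gt_sub_cube (x := t / 2) (by linarith)
    have hpi := Real.pi_lt_d2
    have hp3 := Real.pi_gt_three
    have hsl' : t ≤ Real.sin (t / 2) * π := (div_le_iff₀ pi_pos).1 hsl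
    have hsl2 : t / 3.15 ≤ Real.sin (t / 2) := by
      rw [div_le_iff₀ (by norm_num)]; nlinarith
    have key : t * (t / 3.15) ≤ t * Real.sin (t / 2) := by gcongr
    rw [abs_le]
    constructor
    · nlinarith [mul_le_mul_of_nonneg_left hc (show 0 ≤ t / 2 by linarith), sq_nonneg t,
        mul_le_mul_of_nonneg_left (show t ≤ 3.15 by linarith) (sq_nonneg t)]
    · nlinarith [mul_le_mul_of_nonneg_left hc1 (show 0 ≤ t / 2 by linarith), sq_nonneg t,
        mul_le_mul_of_nonneg_left (show t ≤ 3.15 by linarith) (sq_nonneg t)]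
  have e2 : ((k : ℝ) - 1 / 2) * t + θ = (k * t + θ) - t / 2 := by ring
  have e : cosAnti t θ k - Real.sin (k * t + θ) / t =
      Real.sin (k * t + θ) * (Real.cos (t / 2) / (2 * Real.sin (t / 2)) - 1 / t) -
        Real.cos (k * t + θ) / 2 := by
    unfold cosAnti
    rw [e2, Real.sin_sub]
    field_simp
    ring
  rw [e]
  refine (abs_sub _ _).trans ?_
  rw [abs_mul, abs_div, abs_two]
  have := mul_le_mul (Real.abs_sin_le_one (k * t + θ)) hcot (abs_nonneg _) zero_le_one
  linarith [Real.abs_cos_le_one (k * t + θ)]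

/-! ### Pointwise bounds for the kernels -/

lemma MClass.antitoneOn_shift {ψ : ℝ → ℝ} (h : MClass ψ) {n : ℕ} (hn : 1 ≤ n) :
    AntitoneOn (fun u : ℝ => ψ (n + u)) (Ici 0) := by
  intro u hu v hv huv
  have hn' : (1 : ℝ) ≤ n := by exact_mod_cast hn
  exact h.le (by linarith [mem_Ici.1 hu]) (by linarith)

lemma MClass.intervalIntegrable_shift {ψ : ℝ → ℝ} (h : MClass ψ) {n : ℕ} (hn : 1 ≤ n) {x y : ℝ}
    (hx : 0 ≤ x) (hy : 0 ≤ y) : IntervalIntegrable (fun u : ℝ => ψ (n + u)) volume x y := by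
  refine AntitoneOn.intervalIntegrable ((h.antitoneOn_shift hn).mono ?_)
  intro u hu
  exact mem_Ici.2 ((le_min hx hy).trans hu.1)

lemma MClass.shift_pos {ψ : ℝ → ℝ} (h : MClass ψ) {n : ℕ} (hn : 1 ≤ n) {u : ℝ} (hu : 0 ≤ u) :
    0 < ψ (n + u) := by
  have hn' : (1 : ℝ) ≤ n := by exact_mod_cast hn
  exact h.pos (by linarith)

/-- Bound near the origin for the tail kernel. -/
lemma MClass.abs_tail_le_integral {ψ : ℝ → ℝ} (h : MClass ψ) {n M : ℕ} (hn : 1 ≤ n)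
    {t θ : ℝ} (ht : t ≠ 0) (htp : |t| ≤ π) :
    |∑ k ∈ Finset.Ico n M, ψ k * Real.cos (k * t + θ)| ≤
      ψ n + (1 + π) * ∫ u in (0 : ℝ)..(1 / |t|), ψ (n + u) := by
  have hn' : (1 : ℝ) ≤ n := by exact_mod_cast hn
  have ht0 : 0 < |t| := abs_pos.2 ht
  have hx0 : 0 < 1 / |t| := by positivity
  set x := 1 / |t| with hx
  set m := ⌊x⌋₊ with hm
  have hmx : (m : ℝ) ≤ x := Nat.floor_le hx0.le
  have hxm : x < m + 1 := Nat.lt_floor_add_one x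
  have hint : ∀ y z, 0 ≤ y → 0 ≤ z → IntervalIntegrable (fun u : ℝ => ψ (n + u)) volume y z :=
    fun y z hy hz => h.intervalIntegrable_shift hn hy hz
  have hψ0 : ∀ k ≥ n, 0 ≤ ψ ((k : ℕ) : ℝ) := fun k hk =>
    (h.pos (by exact_mod_cast hn.trans hk)).le
  have hfirst : ∀ b ≤ n + (m + 1),
      |∑ k ∈ Finset.Ico n b, ψ k * Real.cos (k * t + θ)| ≤
        ψ n + ∫ u in (0 : ℝ)..x, ψ (n + u) := by
    intro b hb
    calc |∑ k ∈ Finset.Ico n b, ψ k * Real.cos (k * t + θ)|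
        ≤ ∑ k ∈ Finset.Ico n b, ψ k := by
          refine (Finset.abs_sum_le_sum_abs _ _).trans (Finset.sum_le_sum fun k hk => ?_)
          have := hψ0 k (Finset.mem_Ico.1 hk).1
          rw [abs_mul, abs_of_nonneg this]
          exact mul_le_of_le_one_right this (Real.abs_cos_le_one _)
      _ ≤ ∑ k ∈ Finset.Ico n (n + (m + 1)), ψ k := by
          refine Finset.sum_le_sum_of_subset_of_nonneg
            (Finset.Ico_subset_Ico_right hb) fun k hk _ => hψ0 k (Finset.mem_Ico.1 hk).1
      _ = ψ n + ∑ i ∈ Finset.range m, ψ (n + ((0 : ℝ) + ((i + 1 : ℕ) : ℝ))) := by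
          rw [Finset.sum_Ico_eq_sum_range, Nat.add_sub_cancel_left, Finset.sum_range_succ']
          rw [add_comm]
          congr 1
          refine Finset.sum_congr rfl fun i _ => ?_
          push_cast
          congr 1
          ring
      _ ≤ ψ n + ∫ u in (0 : ℝ)..(0 + m), ψ (n + u) := by
          gcongr
          exact AntitoneOn.sum_le_integral (f := fun u : ℝ => ψ (n + u))
            ((h.antitoneOn_shift hn).mono fun u hu => mem_Ici.2 hu.1)
      _ ≤ ψ n + ∫ u in (0 : ℝ)..x, ψ (n + u) := by
          gcongr
          rw [zero_add, ← intervalIntegral.integral_add_adjacent_intervals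
            (hint 0 m le_rfl (Nat.cast_nonneg _)) (hint m x (Nat.cast_nonneg _) hx0.le)]
          have : 0 ≤ ∫ u in (m : ℝ)..x, ψ (n + u) :=
            intervalIntegral.integral_nonneg hmx fun u hu =>
              (h.shift_pos hn ((Nat.cast_nonneg _).trans hu.1)).le
          linarith
  have hI0 : 0 ≤ ∫ u in (0 : ℝ)..x, ψ (n + u) :=
    intervalIntegral.integral_nonneg hx0.le fun u hu => (h.shift_pos hn hu.1).le
  have hexp : ψ n + (1 + π) * ∫ u in (0 : ℝ)..x, ψ (n + u) =
      (ψ n + ∫ u in (0 : ℝ)..x, ψ (n + u)) + π * ∫ u in (0 : ℝ)..x, ψ (n + u) := by ring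
  rw [hexp]
  rcases le_total M (n + (m + 1)) with hM | hM
  · exact (hfirst M hM).trans (le_add_of_nonneg_right (mul_nonneg pi_pos.le hI0))
  · rw [← Finset.sum_Ico_consecutive _ (Nat.le_add_right n (m + 1)) hM]
    refine (abs_add_le _ _).trans (add_le_add (hfirst _ le_rfl) ?_)
    have hs := sin_half_ne ht htp
    have h1 : |∑ k ∈ Finset.Ico (n + (m + 1)) M, ψ k * Real.cos (k * t + θ)| ≤
        2 * (ψ ((n + (m + 1) : ℕ) : ℝ) * (π / (2 * |t|))) := by
      simp_rw [← cosAnti_sub hs]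
      refine abs_sum_Ico_mul_sub_le (fun k : ℕ => ψ k) _ hM (abs_cosAnti_le ht htp)
        (fun k hk => hψ0 k (by omega)) fun k hk => ?_
      refine h.le ?_ (by push_cast; linarith)
      exact_mod_cast (show 1 ≤ k by omega)
    have h2 : x * ψ ((n + (m + 1) : ℕ) : ℝ) ≤ ∫ u in (0 : ℝ)..x, ψ (n + u) := by
      have : ∫ u in (0 : ℝ)..x, ψ ((n + (m + 1) : ℕ) : ℝ) ≤ ∫ u in (0 : ℝ)..x, ψ (n + u) := by
        refine intervalIntegral.integral_mono_on hx0.le (by simp) (hint 0 x le_rfl hx0.le) ?_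
        intro u hu
        refine h.le (by linarith [hu.1]) ?_
        push_cast
        linarith [hu.2]
      simpa using this
    calc _ ≤ _ := h1
      _ = π * (x * ψ ((n + (m + 1) : ℕ) : ℝ)) := by rw [hx]; field_simp
      _ ≤ _ := by gcongr

/-- Asymptotics away from the origin for the tail kernel. -/
lemma MClass.abs_tail_add_le {ψ : ℝ → ℝ} (h : MClass ψ) {n M : ℕ} (hn : 1 ≤ n) (hnM : n ≤ M)
    {t θ : ℝ} (ht : t ≠ 0) (htp : |t| ≤ π) :
    |∑ k ∈ Finset.Ico n M, ψ k * Real.cos (k * t + θ) + ψ n * (Real.sin (n * t + θ) / t)| ≤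
      2 * ψ n + 7 * ((ψ n - ψ (n + 1 / |t|)) / |t|) + 2 * (ψ M / |t|) := by
  have hn' : (1 : ℝ) ≤ n := by exact_mod_cast hn
  have ht0 : 0 < |t| := abs_pos.2 ht
  have hx0 : 0 < 1 / |t| := by positivity
  have hs := sin_half_ne ht htp
  set x := 1 / |t| with hx
  set m := ⌊x⌋₊ with hm
  have hmx : (m : ℝ) ≤ x := Nat.floor_le hx0.le
  have hxm : x < m + 1 := Nat.lt_floor_add_one x
  have hψ0 : ∀ k ≥ n, 0 ≤ ψ ((k : ℕ) : ℝ) := fun k hk =>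
    (h.pos (by exact_mod_cast hn.trans hk)).le
  have hdec : ∀ k ≥ n, ψ ((k + 1 : ℕ) : ℝ) ≤ ψ (k : ℝ) := fun k hk =>
    h.le (by exact_mod_cast hn.trans hk) (by push_cast; linarith)
  set g := ψ n - ψ (n + x) with hg
  have hg0 : 0 ≤ g := sub_nonneg.2 (h.le hn' (by linarith))
  have hp2 := Real.pi_lt_d2
  have hp3 := Real.pi_gt_three
  have hfirst : ∀ b, n ≤ b → b ≤ n + m →
      |∑ k ∈ Finset.Ico n b, (ψ k - ψ ((k + 1 : ℕ) : ℝ)) * cosAnti t θ (k + 1)| ≤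
        π / 2 * (g / |t|) := by
    intro b hnb hb
    calc _ ≤ ∑ k ∈ Finset.Ico n b, (ψ k - ψ ((k + 1 : ℕ) : ℝ)) * (π / (2 * |t|)) := by
          refine (Finset.abs_sum_le_sum_abs _ _).trans (Finset.sum_le_sum fun k hk => ?_)
          have := sub_nonneg.2 (hdec k (Finset.mem_Ico.1 hk).1)
          rw [abs_mul, abs_of_nonneg this]
          exact mul_le_mul_of_nonneg_left (abs_cosAnti_le ht htp _) this
      _ = (ψ n - ψ b) * (π / (2 * |t|)) := by
          rw [← Finset.sum_mul]
          congr 1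
          have := Finset.sum_Ico_sub (fun k : ℕ => ψ k) hnb
          rw [← neg_sub (ψ b), ← this, ← Finset.sum_neg_distrib]
          simp
      _ ≤ g * (π / (2 * |t|)) := by
          gcongr
          refine sub_le_sub_left (h.le (by exact_mod_cast hn.trans hnb) ?_) _
          have : (b : ℝ) ≤ n + m := by exact_mod_cast hb
          linarith
      _ = _ := by field_simp
  have hD : |∑ k ∈ Finset.Ico n M, (ψ k - ψ ((k + 1 : ℕ) : ℝ)) * cosAnti t θ (k + 1)| ≤
      7 * (g / |t|) := by
    have hgt : 0 ≤ g / |t| := by positivity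
    rcases le_total M (n + m) with hM | hM
    · refine (hfirst M hnM hM).trans ?_
      gcongr
      linarith
    · rw [← Finset.sum_Ico_consecutive _ (Nat.le_add_right n m) hM]
      refine (abs_add_le _ _).trans ((add_le_add (hfirst _ (Nat.le_add_right n m) le_rfl)
        (?_ : _ ≤ π ^ 2 / 2 * (g / |t|))).trans ?_)
      · have h1 : |∑ k ∈ Finset.Ico (n + m) M,
            (ψ k - ψ ((k + 1 : ℕ) : ℝ)) * cosAnti t θ (k + 1)| ≤
            2 * ((ψ ((n + m : ℕ) : ℝ) - ψ ((n + m + 1 : ℕ) : ℝ)) * (π ^ 2 / (4 * t ^ 2))) := by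
          simp_rw [← cosAntiTwo_sub hs]
          refine abs_sum_Ico_mul_sub_le (fun k : ℕ => ψ k - ψ ((k + 1 : ℕ) : ℝ)) _ hM
            (abs_cosAntiTwo_le ht htp)
            (fun k hk => sub_nonneg.2 (hdec k (by omega))) fun k hk => ?_
          have := h.step_le (s := k) (by exact_mod_cast (show 1 ≤ k by omega))
          push_cast
          rw [add_assoc, one_add_one_eq_two]
          exact this
        have h2 : ψ ((n + m : ℕ) : ℝ) - ψ ((n + m + 1 : ℕ) : ℝ) ≤ |t| * g := by
          have hc1 := h.chord hn' hx0 hxm.le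
          have hxt : |t| * x = 1 := by rw [hx]; field_simp
          have hc2 : (m : ℝ) * (ψ n - ψ (n + (m + 1))) ≤ (m + 1) * (ψ n - ψ (n + m)) := by
            rcases Nat.eq_zero_or_pos m with h0 | h0
            · simp [h0]
            · exact h.chord hn' (by exact_mod_cast h0) (by linarith)
          push_cast
          rw [← add_assoc] at hc1 hc2
          have hm0 : (0 : ℝ) ≤ m := Nat.cast_nonneg _
          have hc3 : (ψ n - ψ (n + m + 1)) ≤ (m + 1) * (|t| * g) := by
            have := mul_le_mul_of_nonneg_left hc1 ht0.le
            calc _ = |t| * x * (ψ n - ψ (n + m + 1)) := by rw [hxt, one_mul]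
              _ ≤ _ := by linarith
          have hc4 : ((m : ℝ) + 1) * (ψ (n + m) - ψ (n + m + 1)) ≤ (m + 1) * (|t| * g) := by
            linarith
          exact le_of_mul_le_mul_left hc4 (by linarith)
        calc _ ≤ _ := h1
          _ ≤ 2 * ((|t| * g) * (π ^ 2 / (4 * t ^ 2))) := by gcongr
          _ = _ := by rw [← sq_abs t]; field_simp; ring
      · rw [← add_mul]
        gcongr
        nlinarith
  have hsum : ∑ k ∈ Finset.Ico n M, ψ k * Real.cos (k * t + θ) =
      ψ M * cosAnti t θ M - ψ n * cosAnti t θ n +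
        ∑ k ∈ Finset.Ico n M, (ψ k - ψ ((k + 1 : ℕ) : ℝ)) * cosAnti t θ (k + 1) := by
    simp_rw [← cosAnti_sub hs]
    exact sum_Ico_mul_sub (fun k : ℕ => ψ k) _ hnM
  have h1 : |ψ M * cosAnti t θ M| ≤ 2 * (ψ M / |t|) := by
    rw [abs_mul, abs_of_nonneg (hψ0 M hnM)]
    calc _ ≤ ψ M * (π / (2 * |t|)) :=
          mul_le_mul_of_nonneg_left (abs_cosAnti_le ht htp _) (hψ0 M hnM)
      _ = π / 2 * (ψ M / |t|) := by field_simp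
      _ ≤ _ := by
        have : 0 ≤ ψ M / |t| := div_nonneg (hψ0 M hnM) ht0.le
        gcongr; linarith
  have h2 : |ψ n * (cosAnti t θ n - Real.sin (n * t + θ) / t)| ≤ 2 * ψ n := by
    rw [abs_mul, abs_of_nonneg (hψ0 n le_rfl), mul_comm]
    exact mul_le_mul_of_nonneg_right (abs_cosAnti_sub_le ht htp n) (hψ0 n le_rfl)
  rw [hsum]
  rw [abs_le] at *
  constructor <;> linarith [h1.1, h1.2, h2.1, h2.2, hD.1, hD.2]

/-- The linear ramp kernel away from the origin. -/
lemma abs_ramp_sub_le {n p : ℕ} (hp : 1 ≤ p) (hpn : p ≤ n) {t θ : ℝ} (ht : t ≠ 0)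
    (htp : |t| ≤ π) :
    |∑ j ∈ Finset.range p, (j / p : ℝ) * Real.cos ((n - p + j : ℕ) * t + θ) -
      Real.sin (n * t + θ) / t| ≤ 2 + 5 / p / t ^ 2 := by
  have hs := sin_half_ne ht htp
  have hp0 : (0 : ℝ) < p := by exact_mod_cast hp
  set S : ℕ → ℝ := fun j => cosAnti t θ (n - p + j) with hS
  have e1 : ∑ j ∈ Finset.range p, (j / p : ℝ) * Real.cos ((n - p + j : ℕ) * t + θ) =
      S p - 1 / p * ∑ j ∈ Finset.range p, S (j + 1) := by
    rw [Finset.range_eq_Ico]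
    have := sum_Ico_mul_sub (fun j : ℕ => (j / p : ℝ)) S (Nat.zero_le p)
    simp only [hS, ← add_assoc, cosAnti_sub hs] at this
    rw [this, Finset.mul_sum, sub_eq_add_neg (cosAnti t θ (n - p + p)), ← Finset.sum_neg_distrib]
    simp only [CharP.cast_eq_zero, zero_div, zero_mul, sub_zero, hS, ← add_assoc]
    rw [div_self hp0.ne', one_mul]
    congr 1
    refine Finset.sum_congr rfl fun j _ => ?_
    push_cast
    field_simp
    ring
  have e2 : |∑ j ∈ Finset.range p, S (j + 1)| ≤ 5 / t ^ 2 := by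
    have : ∑ j ∈ Finset.range p, S (j + 1) =
        cosAntiTwo t θ (n - p + p) - cosAntiTwo t θ (n - p + 0) := by
      rw [← Finset.sum_range_sub (fun j => cosAntiTwo t θ (n - p + j))]
      refine Finset.sum_congr rfl fun j _ => ?_
      simp only [hS, ← add_assoc, cosAntiTwo_sub hs]
    rw [this]
    refine (abs_sub _ _).trans ((add_le_add (abs_cosAntiTwo_le ht htp _)
      (abs_cosAntiTwo_le ht htp _)).trans ?_)
    have ht2 : 0 < t ^ 2 := by positivity
    rw [← add_div, div_le_div_iff₀ (by positivity) ht2]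
    have hp2 := Real.pi_lt_d2
    have hp3 := Real.pi_gt_three
    have hpp : π ^ 2 + π ^ 2 ≤ 20 := by nlinarith
    calc _ ≤ 20 * t ^ 2 := by gcongr
      _ = _ := by ring
  have hSp : S p = cosAnti t θ n := by simp only [hS]; rw [Nat.sub_add_cancel hpn]
  have e3 := abs_cosAnti_sub_le (θ := θ) ht htp n
  rw [e1, hSp]
  have e4 : |1 / (p : ℝ) * ∑ j ∈ Finset.range p, S (j + 1)| ≤ 5 / p / t ^ 2 := by
    rw [abs_mul, abs_of_pos (by positivity)]
    calc _ ≤ 1 / (p : ℝ) * (5 / t ^ 2) := by gcongr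
      _ = _ := by field_simp
  rw [abs_le] at *
  constructor <;> linarith [e3.1, e3.2, e4.1, e4.2]

/-- The trivial bound for the linear ramp kernel. -/
lemma abs_ramp_le {n p : ℕ} {t θ : ℝ} :
    |∑ j ∈ Finset.range p, (j / p : ℝ) * Real.cos ((n - p + j : ℕ) * t + θ)| ≤ p := by
  refine (Finset.abs_sum_le_sum_abs _ _).trans ?_
  calc _ ≤ ∑ j ∈ Finset.range p, (1 : ℝ) := by
        refine Finset.sum_le_sum fun j hj => ?_
        have hj' : (j : ℝ) ≤ p := by exact_mod_cast (Finset.mem_range.1 hj).le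
        rw [abs_mul, abs_of_nonneg (by positivity)]
        exact mul_le_one₀ (div_le_one_of_le₀ hj' (Nat.cast_nonneg _)) (abs_nonneg _)
          (Real.abs_cos_le_one _)
    _ = p := by simp

/-! ### Integral estimates -/

lemma MprimeClass.integrableOn_shift_div {ψ : ℝ → ℝ} (h : MprimeClass ψ) {n : ℕ} (hn : 1 ≤ n)
    {x : ℝ} (hx : 0 < x) : IntegrableOn (fun t => ψ (t + n) / t) (Ioi x) := by
  have hn' : (1 : ℝ) ≤ n := by exact_mod_cast hn
  have hmeas : ∀ s ⊆ Ioi (0 : ℝ), MeasurableSet s →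
      AEStronglyMeasurable (fun t => ψ (t + n) / t) (volume.restrict s) := by
    intro s hs hsm
    have hm : Measurable (fun t : ℝ => ψ (max (t + n) 1) / t) :=
      (h.1.measurable_trunc.comp (measurable_id.add_const (n : ℝ))).div measurable_id
    refine hm.aestronglyMeasurable.congr ?_
    filter_upwards [ae_restrict_mem hsm] with t ht
    have : 0 < t := hs ht
    rw [max_eq_left (by linarith)]
  have h1 : IntegrableOn (fun t => ψ (t + n) / t) (Ioi 1) := by
    refine Integrable.mono' (h.2.mono_set Ioi_subset_Ici_self)
      (hmeas _ (Ioi_subset_Ioi zero_le_one) measurableSet_Ioi) ?_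
    filter_upwards [ae_restrict_mem measurableSet_Ioi] with t ht
    have ht1 : 1 < t := ht
    have := (h.1.pos (show 1 ≤ t + n by linarith)).le
    rw [Real.norm_eq_abs, abs_of_nonneg (by positivity)]
    gcongr
    exact h.1.le ht1.le (by linarith)
  have h2 : IntegrableOn (fun t => ψ (t + n) / t) (Ioc x 1) := by
    refine Integrable.mono' (g := fun _ => ψ 1 / x) (integrableOn_const measure_Ioc_lt_top.ne)
      (hmeas _ (fun t ht => hx.trans ht.1) measurableSet_Ioc) ?_
    filter_upwards [ae_restrict_mem measurableSet_Ioc] with t ht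
    have ht0 : 0 < t := hx.trans ht.1
    have := (h.1.pos (show 1 ≤ t + n by linarith)).le
    rw [Real.norm_eq_abs, abs_of_nonneg (by positivity)]
    have h1p := h.1.pos le_rfl
    have := h.1.le le_rfl (show 1 ≤ t + n by linarith)
    have := ht.1.le
    gcongr
  refine (h2.union h1).mono_set fun t ht => ?_
  rcases le_or_gt t 1 with h' | h'
  · exact Or.inl ⟨ht, h'⟩
  · exact Or.inr h'

lemma MClass.integral_shift_div_nonneg {ψ : ℝ → ℝ} (h : MClass ψ) {n : ℕ} (hn : 1 ≤ n)
    {x : ℝ} (hx : 0 < x) : 0 ≤ ∫ t in Ioi x, ψ (t + n) / t := by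
  refine setIntegral_nonneg measurableSet_Ioi fun t ht => ?_
  have ht0 : 0 < t := hx.trans ht
  rw [add_comm]
  exact div_nonneg (h.shift_pos hn ht0.le).le ht0.le

lemma MClass.integral_nonneg_aux {ψ : ℝ → ℝ} (h : MClass ψ) {n : ℕ} (hn : 1 ≤ n) {x : ℝ}
    (hx : 0 ≤ x) : 0 ≤ ∫ u in (0 : ℝ)..x, ψ (n + u) :=
  intervalIntegral.integral_nonneg hx fun _ hu => (h.shift_pos hn hu.1).le

lemma MprimeClass.lintegral_primitive_le {ψ : ℝ → ℝ} (h : MprimeClass ψ) {n : ℕ} (hn : 1 ≤ n)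
    {a : ℝ} (ha : 0 < a) :
    ∫⁻ t in Ioc 0 a, ENNReal.ofReal (∫ u in (0 : ℝ)..(1 / t), ψ (n + u)) ≤
      ENNReal.ofReal (ψ n + ∫ u in Ioi (1 / a), ψ (u + n) / u) := by
  have hn' : (1 : ℝ) ≤ n := by exact_mod_cast hn
  set w : ℝ → ENNReal := fun u => ENNReal.ofReal (ψ (max (u + n) 1)) with hw
  have hwm : Measurable w :=
    (h.1.measurable_trunc.comp (measurable_id.add_const (n : ℝ))).ennreal_ofReal
  have hw0 : ∀ u, 0 ≤ u → w u = ENNReal.ofReal (ψ (u + n)) := fun u hu => by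
    simp only [hw]; rw [max_eq_left (by linarith)]
  set D : Set (ℝ × ℝ) := {q | q.2 * q.1 ≤ 1} with hD
  have hDm : MeasurableSet D :=
    measurableSet_le (measurable_snd.mul measurable_fst) measurable_const
  have hE : ∫⁻ t in Ioc 0 a, ENNReal.ofReal (∫ u in (0 : ℝ)..(1 / t), ψ (n + u)) =
      ∫⁻ t in Ioc 0 a, ∫⁻ u in Ioi (0 : ℝ), D.indicator (fun q => w q.2) (t, u) := by
    refine setLIntegral_congr_fun measurableSet_Ioc fun t ht => ?_
    have ht0 : 0 < t := ht.1
    have hti : 0 ≤ 1 / t := by positivity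
    rw [intervalIntegral.integral_of_le hti, ofReal_integral_eq_lintegral_ofReal]
    · have : ∀ u, D.indicator (fun q => w q.2) (t, u) = (Iic (1 / t)).indicator w u := by
        intro u
        by_cases hu : u ≤ 1 / t
        · rw [indicator_of_mem (by simpa [hD] using (le_div_iff₀ ht0).1 hu),
            indicator_of_mem (mem_Iic.2 hu)]
        · rw [indicator_of_notMem (by simpa [hD] using fun h => hu ((le_div_iff₀ ht0).2 h)),
            indicator_of_notMem (by simpa using hu)]
      simp_rw [this]
      rw [setLIntegral_indicator measurableSet_Iic, Set.inter_comm, Ioi_inter_Iic]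
      refine setLIntegral_congr_fun measurableSet_Ioc fun u hu => ?_
      rw [hw0 u hu.1.le, add_comm]
    · exact (h.1.intervalIntegrable_shift hn le_rfl hti).1
    · filter_upwards [ae_restrict_mem measurableSet_Ioc] with u hu
      exact (h.1.shift_pos hn hu.1.le).le
  have hsplit : Ioi (0 : ℝ) = Ioc 0 (1 / a) ∪ Ioi (1 / a) :=
    (Ioc_union_Ioi_eq_Ioi (by positivity)).symm
  have hint := h.integrableOn_shift_div hn (show 0 < 1 / a by positivity)
  rw [hE, lintegral_lintegral_swap]
  · rw [hsplit]
    refine (lintegral_union_le _ _ _).trans ?_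
    rw [ENNReal.ofReal_add (h.1.pos hn').le (h.1.integral_shift_div_nonneg hn (by positivity)),
      ofReal_integral_eq_lintegral_ofReal hint]
    · refine add_le_add ?_ ?_
      · calc _ ≤ ∫⁻ u in Ioc 0 (1 / a), ENNReal.ofReal (ψ n * a) := by
              refine setLIntegral_mono measurable_const fun u hu => ?_
              calc _ ≤ ∫⁻ t in Ioc 0 a, ENNReal.ofReal (ψ n) := by
                    refine lintegral_mono fun t => ?_
                    refine (indicator_le_self _ _ _).trans ?_
                    simp only
                    rw [hw0 u hu.1.le]
                    exact ENNReal.ofReal_le_ofReal (h.1.le hn' (by linarith [hu.1]))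
                _ = _ := by
                    rw [setLIntegral_const, Real.volume_Ioc, sub_zero,
                      ENNReal.ofReal_mul (h.1.pos hn').le]
          _ = ENNReal.ofReal (ψ n) := by
              rw [setLIntegral_const, Real.volume_Ioc, sub_zero,
                ← ENNReal.ofReal_mul (mul_nonneg (h.1.pos hn').le ha.le)]
              congr 1
              field_simp
      · refine lintegral_mono_ae ?_
        filter_upwards [ae_restrict_mem measurableSet_Ioi] with u hu
        have hu0 : 0 < u := lt_trans (by positivity) (mem_Ioi.1 hu)
        calc _ ≤ ∫⁻ t in Ioc 0 a, (Iic (1 / u)).indicator (fun _ => w u) t := by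
              refine lintegral_mono fun t => ?_
              simp only
              by_cases ht : t ≤ 1 / u
              · rw [indicator_of_mem (mem_Iic.2 ht)]
                exact indicator_le_self _ _ _
              · rw [indicator_of_notMem]
                · exact zero_le
                · intro hq
                  exact ht ((le_div_iff₀ hu0).2 (by rw [mul_comm]; exact hq))
          _ ≤ ∫⁻ t in Ioc 0 (1 / u), w u := by
              rw [setLIntegral_indicator measurableSet_Iic]
              exact lintegral_mono_set fun t ht => ⟨ht.2.1, ht.1⟩
          _ = _ := by
              rw [setLIntegral_const, Real.volume_Ioc, sub_zero, hw0 u hu0.le,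
                ← ENNReal.ofReal_mul (h.1.pos (by linarith)).le]
              congr 1
              field_simp
    · filter_upwards [ae_restrict_mem measurableSet_Ioi] with u hu
      have hu0 : 0 < u := lt_trans (by positivity) (mem_Ioi.1 hu)
      exact div_nonneg (h.1.pos (by linarith)).le hu0.le
  · exact ((hwm.comp measurable_snd).indicator hDm).aemeasurable

lemma MprimeClass.integrableOn_primitive {ψ : ℝ → ℝ} (h : MprimeClass ψ) {n : ℕ} (hn : 1 ≤ n)
    {a : ℝ} (ha : 0 < a) :
    IntegrableOn (fun t => ∫ u in (0 : ℝ)..(1 / t), ψ (n + u)) (Ioc 0 a) := by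
  have hanti : AntitoneOn (fun t : ℝ => ∫ u in (0 : ℝ)..(1 / t), ψ (n + u)) (Ioc 0 a) := by
    intro s hs t ht hst
    have hst' : 1 / t ≤ 1 / s := one_div_le_one_div_of_le hs.1 hst
    have ht0 : 0 ≤ 1 / t := (one_div_pos.2 ht.1).le
    simp only
    rw [← intervalIntegral.integral_add_adjacent_intervals
      (h.1.intervalIntegrable_shift hn le_rfl ht0)
      (h.1.intervalIntegrable_shift hn ht0 (ht0.trans hst'))]
    refine le_add_of_nonneg_right (intervalIntegral.integral_nonneg hst' fun u hu => ?_)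
    exact (h.1.shift_pos hn (ht0.trans hu.1)).le
  refine ⟨(aemeasurable_restrict_of_antitoneOn measurableSet_Ioc hanti).aestronglyMeasurable, ?_⟩
  rw [hasFiniteIntegral_iff_ofReal]
  · exact (h.lintegral_primitive_le hn ha).trans_lt ENNReal.ofReal_lt_top
  · filter_upwards [ae_restrict_mem measurableSet_Ioc] with t ht
    exact h.1.integral_nonneg_aux hn (one_div_pos.2 ht.1).le

lemma MprimeClass.integral_primitive_le {ψ : ℝ → ℝ} (h : MprimeClass ψ) {n : ℕ} (hn : 1 ≤ n)
    {a : ℝ} (ha : 0 < a) :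
    ∫ t in Ioc 0 a, (∫ u in (0 : ℝ)..(1 / t), ψ (n + u)) ≤
      ψ n + ∫ u in Ioi (1 / a), ψ (u + n) / u := by
  have hn' : (1 : ℝ) ≤ n := by exact_mod_cast hn
  rw [integral_eq_lintegral_of_nonneg_ae _ (h.integrableOn_primitive hn ha).1]
  · refine ENNReal.toReal_le_of_le_ofReal ?_ (h.lintegral_primitive_le hn ha)
    exact add_nonneg (h.1.pos hn').le (h.1.integral_shift_div_nonneg hn (by positivity))
  · filter_upwards [ae_restrict_mem measurableSet_Ioc] with t ht
    exact h.1.integral_nonneg_aux hn (one_div_pos.2 ht.1).le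

lemma MprimeClass.integral_primitive_le_of_le {ψ : ℝ → ℝ} (h : MprimeClass ψ) {n : ℕ}
    (hn : 1 ≤ n) {b a : ℝ} (hb : 0 < b) (hba : b ≤ a) :
    ∫ t in Ioc 0 b, (∫ u in (0 : ℝ)..(1 / t), ψ (n + u)) ≤
      ψ n + ∫ u in Ioi (1 / a), ψ (u + n) / u := by
  refine (h.integral_primitive_le hn hb).trans ?_
  have ha := hb.trans_le hba
  refine add_le_add le_rfl ?_
  refine setIntegral_mono_set (h.integrableOn_shift_div hn (by positivity)) ?_
    (Ioi_subset_Ioi (one_div_le_one_div_of_le hb hba)).eventuallyLE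
  filter_upwards [ae_restrict_mem measurableSet_Ioi] with u hu
  have hu0 : 0 < u := lt_trans (by positivity) (mem_Ioi.1 hu)
  rw [add_comm]
  exact div_nonneg (h.1.shift_pos hn hu0.le).le hu0.le

lemma MClass.gap_div_nonneg {ψ : ℝ → ℝ} (h : MClass ψ) {n : ℕ} (hn : 1 ≤ n) {t : ℝ}
    (ht : 0 < t) : 0 ≤ (ψ n - ψ (n + 1 / t)) / t := by
  have hn' : (1 : ℝ) ≤ n := by exact_mod_cast hn
  have : 0 < 1 / t := by positivity
  exact div_nonneg (sub_nonneg.2 (h.le hn' (by linarith))) ht.le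

lemma MClass.aestronglyMeasurable_gap_div {ψ : ℝ → ℝ} (h : MClass ψ) {n : ℕ} (hn : 1 ≤ n)
    {s : Set ℝ} (hs : s ⊆ Ioi 0) (hsm : MeasurableSet s) :
    AEStronglyMeasurable (fun t => (ψ n - ψ (n + 1 / t)) / t) (volume.restrict s) := by
  have hn' : (1 : ℝ) ≤ n := by exact_mod_cast hn
  have hm : Measurable (fun t : ℝ => (ψ n - ψ (max (n + 1 / t) 1)) / t) :=
    (measurable_const.sub (h.measurable_trunc.comp
      ((measurable_const.div measurable_id).const_add (n : ℝ)))).div measurable_id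
  refine hm.aestronglyMeasurable.congr ?_
  filter_upwards [ae_restrict_mem hsm] with t ht
  have : 0 < t := hs ht
  have : 0 < 1 / t := by positivity
  rw [max_eq_left (by linarith)]

lemma MClass.integrableOn_gap_div_Ioi {ψ : ℝ → ℝ} (h : MClass ψ) {n : ℕ} (hn : 2 ≤ n)
    {a : ℝ} (ha : 0 < a) :
    IntegrableOn (fun t => (ψ n - ψ (n + 1 / t)) / t) (Ioi a) := by
  have hn' : (2 : ℝ) ≤ n := by exact_mod_cast hn
  refine Integrable.mono' (g := fun t => (ψ (n - 1) - ψ n) * t ^ (-2 : ℝ))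
    ((integrableOn_Ioi_rpow_of_lt (by norm_num) ha).const_mul _)
    (h.aestronglyMeasurable_gap_div (by omega) (Ioi_subset_Ioi ha.le) measurableSet_Ioi) ?_
  filter_upwards [ae_restrict_mem measurableSet_Ioi] with t ht
  have ht0 : 0 < t := ha.trans ht
  rw [Real.norm_eq_abs, abs_of_nonneg (h.gap_div_nonneg (by omega) ht0),
    Real.rpow_neg ht0.le, Real.rpow_two]
  have hc := h.chord (show (1 : ℝ) ≤ n - 1 by linarith) one_pos
    (show (1 : ℝ) ≤ 1 + 1 / t by have : 0 < 1 / t := by positivity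
                                 linarith)
  rw [sub_add_cancel, show (n : ℝ) - 1 + (1 + 1 / t) = n + 1 / t by ring] at hc
  have : ψ n - ψ (n + 1 / t) ≤ 1 / t * (ψ (n - 1) - ψ n) := by linarith
  calc _ ≤ (1 / t * (ψ (n - 1) - ψ n)) / t := by gcongr
    _ = _ := by field_simp

lemma MClass.integrableOn_gap_div_Ioc {ψ : ℝ → ℝ} (h : MClass ψ) {n : ℕ} (hn : 1 ≤ n)
    {a : ℝ} (ha : 0 < a) (b : ℝ) :
    IntegrableOn (fun t => (ψ n - ψ (n + 1 / t)) / t) (Ioc a b) ∧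
      ∫ t in Ioc a b, (ψ n - ψ (n + 1 / t)) / t ≤ ψ n / a * max (b - a) 0 := by
  have hn' : (1 : ℝ) ≤ n := by exact_mod_cast hn
  have hpt : ∀ t ∈ Ioc a b, ‖(ψ n - ψ (n + 1 / t)) / t‖ ≤ ψ n / a := by
    intro t ht
    have ht0 : 0 < t := ha.trans ht.1
    rw [Real.norm_eq_abs, abs_of_nonneg (h.gap_div_nonneg hn ht0)]
    have h1 := h.shift_pos hn (show 0 ≤ 1 / t by positivity)
    have h2 := h.pos hn'
    have := ht.1.le
    gcongr
    linarith
  constructor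
  · refine Integrable.mono' (g := fun _ => ψ n / a) (integrableOn_const measure_Ioc_lt_top.ne)
      (h.aestronglyMeasurable_gap_div hn (fun t ht => ha.trans ht.1) measurableSet_Ioc) ?_
    filter_upwards [ae_restrict_mem measurableSet_Ioc] with t ht using hpt t ht
  · have := norm_setIntegral_le_of_norm_le_const (μ := volume) measure_Ioc_lt_top hpt
    rw [Real.volume_real_Ioc] at this
    exact (le_abs_self _).trans this

lemma MClass.integral_gap_div_le {ψ : ℝ → ℝ} (h : MClass ψ) {n : ℕ} (hn : 1 ≤ n)
    {a K : ℝ} (hK : 0 < K) (ha : K / n ≤ a) :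
    ∫ t in Ioc a π, (ψ n - ψ (n + 1 / t)) / t ≤
      π / K * ψ n + ∫ t in Ioi a, (ψ n - ψ (n + 1 / t)) / t := by
  have hn' : (1 : ℝ) ≤ n := by exact_mod_cast hn
  have ha0 : 0 < a := lt_of_lt_of_le (by positivity) ha
  have hψ := h.pos hn'
  have hE : 0 ≤ ∫ t in Ioi a, (ψ n - ψ (n + 1 / t)) / t :=
    setIntegral_nonneg measurableSet_Ioi fun t ht => h.gap_div_nonneg hn (ha0.trans ht)
  rcases Nat.lt_or_ge n 2 with h2 | h2
  · obtain rfl : n = 1 := by omega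
    rw [Nat.cast_one, div_one] at ha
    refine ((h.integrableOn_gap_div_Ioc hn ha0 π).2.trans ?_).trans (le_add_of_nonneg_right hE)
    calc _ ≤ ψ (1 : ℕ) / K * π := by
          gcongr
          exact max_le (by linarith) pi_pos.le
      _ = _ := by ring
  · refine le_trans ?_ (le_add_of_nonneg_left (by positivity))
    refine setIntegral_mono_set (h.integrableOn_gap_div_Ioi h2 ha0) ?_
      Ioc_subset_Ioi_self.eventuallyLE
    filter_upwards [ae_restrict_mem measurableSet_Ioi] with t ht
    exact h.gap_div_nonneg hn (ha0.trans ht)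

/-! ### Convergence of Fourier series -/

/-- If the symmetric partial sums of the Fourier series of a continuous function form a Cauchy
sequence in the uniform norm, they converge to the function (the zeroth term being counted
twice). -/
lemma tendsto_sum_fourier_of_cauchySeq {T : ℝ} [Fact (0 < T)] (F : C(AddCircle T, ℂ))
    (hC : CauchySeq fun N : ℕ => ∑ k ∈ Finset.range N,
      (fourierCoeff F (k : ℤ) • fourier (T := T) (k : ℤ) +
        fourierCoeff F (-(k : ℤ)) • fourier (T := T) (-(k : ℤ)))) :
    Tendsto (fun N : ℕ => ∑ k ∈ Finset.range N,
      (fourierCoeff F (k : ℤ) • fourier (T := T) (k : ℤ) +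
        fourierCoeff F (-(k : ℤ)) • fourier (T := T) (-(k : ℤ)))) atTop
      (nhds (F + fourierCoeff F 0 • fourier (T := T) 0)) := by
  obtain ⟨G, hG⟩ := cauchySeq_tendsto_of_complete hC
  set Λ := ContinuousMap.toLp (E := ℂ) 2 (AddCircle.haarAddCircle (T := T)) ℂ
  have h1 := hasSum_fourier_series_L2 (Λ F)
  simp_rw [Λ, fourierCoeff_toLp] at h1
  have h2 := h1.nat_add_neg.tendsto_sum_nat
  have h3 := (Λ.continuous.tendsto G).comp hG
  have h4 : (fun N : ℕ => ∑ k ∈ Finset.range N, (fourierCoeff F (k : ℤ) • fourierLp 2 (k : ℤ) +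
      fourierCoeff F (-(k : ℤ)) • fourierLp 2 (-(k : ℤ)))) =
      Λ ∘ (fun N : ℕ => ∑ k ∈ Finset.range N,
      (fourierCoeff F (k : ℤ) • fourier (T := T) (k : ℤ) +
        fourierCoeff F (-(k : ℤ)) • fourier (T := T) (-(k : ℤ)))) := by
    funext N
    simp only [Function.comp_apply, map_sum, map_add, map_smul]
    rfl
  rw [h4] at h2
  have h5 := tendsto_nhds_unique h3 h2
  have h6 : Λ G = Λ (F + fourierCoeff F 0 • fourier (T := T) 0) := by
    rw [h5, map_add, map_smul]
  rw [← ContinuousMap.toLp_injective (𝕜 := ℂ) (AddCircle.haarAddCircle (T := T)) h6]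
  exact hG

/-- A continuous `2π`-periodic function as a complex-valued function on the circle. -/
def circleLift (f : ℝ → ℝ) (hf : Continuous f) (hp : Periodic2pi f) :
    C(AddCircle (2 * π), ℂ) where
  toFun := Function.Periodic.lift (f := fun x => (f x : ℂ)) (c := 2 * π)
    (fun x => congrArg _ (hp x))
  continuous_toFun := continuous_coinduced_dom.mpr (Complex.continuous_ofReal.comp hf)

lemma circleLift_coe (f : ℝ → ℝ) (hf : Continuous f) (hp : Periodic2pi f) (x : ℝ) :
    circleLift f hf hp (x : AddCircle (2 * π)) = (f x : ℂ) :=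
  rfl

lemma fourier_two_pi_coe (n : ℤ) (x : ℝ) :
    fourier n (x : AddCircle (2 * π)) =
      ((Real.cos (n * x) : ℝ) : ℂ) + ((Real.sin (n * x) : ℝ) : ℂ) * Complex.I := by
  rw [fourier_coe_apply, Complex.ofReal_cos, Complex.ofReal_sin, ← Complex.exp_mul_I]
  congr 1
  have : (π : ℂ) ≠ 0 := by exact_mod_cast pi_ne_zero
  push_cast
  field_simp

lemma fourierCoeff_circleLift [Fact (0 < 2 * π)] (f : ℝ → ℝ) (hf : Continuous f)
    (hp : Periodic2pi f) (n : ℤ) :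
    fourierCoeff (circleLift f hf hp) n =
      (((1 / (2 * π)) * ∫ x in (-π)..π, f x * Real.cos (n * x) : ℝ) : ℂ) -
      (((1 / (2 * π)) * ∫ x in (-π)..π, f x * Real.sin (n * x) : ℝ) : ℂ) * Complex.I := by
  rw [fourierCoeff_eq_intervalIntegral _ n (-π), show -π + 2 * π = π by ring]
  simp_rw [circleLift_coe, fourier_two_pi_coe]
  have e : ∀ x : ℝ, (((Real.cos ((-n : ℤ) * x) : ℝ) : ℂ) +
      ((Real.sin ((-n : ℤ) * x) : ℝ) : ℂ) * Complex.I) • (f x : ℂ) =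
      ((f x * Real.cos (n * x) : ℝ) : ℂ) - ((f x * Real.sin (n * x) : ℝ) : ℂ) * Complex.I := by
    intro x
    rw [Int.cast_neg, neg_mul, Real.cos_neg, Real.sin_neg]
    push_cast
    rw [smul_eq_mul]
    ring
  simp_rw [e]
  rw [intervalIntegral.integral_sub, intervalIntegral.integral_mul_const,
    intervalIntegral.integral_ofReal, intervalIntegral.integral_ofReal, Complex.real_smul]
  · push_cast; ring
  · exact (by fun_prop : Continuous _).intervalIntegrable _ _
  · exact (by fun_prop : Continuous _).intervalIntegrable _ _

lemma sum_fourier_circleLift_coe [Fact (0 < 2 * π)] (f : ℝ → ℝ) (hf : Continuous f)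
    (hp : Periodic2pi f) (s : Finset ℕ) (x : ℝ) :
    (∑ k ∈ s,
      (fourierCoeff (circleLift f hf hp) (k : ℤ) • fourier (T := 2 * π) (k : ℤ) +
        fourierCoeff (circleLift f hf hp) (-(k : ℤ)) • fourier (T := 2 * π) (-(k : ℤ))))
        (x : AddCircle (2 * π)) =
      ((∑ k ∈ s, (fourierA f k * Real.cos (k * x) + fourierB f k * Real.sin (k * x)) : ℝ) : ℂ) := by
  rw [ContinuousMap.sum_apply, Complex.ofReal_sum]
  refine Finset.sum_congr rfl fun k _ => ?_
  rw [ContinuousMap.add_apply, ContinuousMap.smul_apply, ContinuousMap.smul_apply,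
    fourier_two_pi_coe, fourier_two_pi_coe, fourierCoeff_circleLift, fourierCoeff_circleLift]
  have hs : ∫ x in (-π)..π, f x * Real.sin ((-(k : ℤ) : ℤ) * x) =
      -∫ x in (-π)..π, f x * Real.sin (k * x) := by
    rw [← intervalIntegral.integral_neg]
    congr 1; funext y
    rw [Int.cast_neg, neg_mul, Real.sin_neg, Int.cast_natCast]; ring
  have hc : ∫ x in (-π)..π, f x * Real.cos ((-(k : ℤ) : ℤ) * x) =
      ∫ x in (-π)..π, f x * Real.cos (k * x) := by
    congr 1; funext y
    rw [Int.cast_neg, neg_mul, Real.cos_neg, Int.cast_natCast]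
  rw [hs, hc, Int.cast_neg, neg_mul, Real.cos_neg, Real.sin_neg, Int.cast_natCast]
  unfold fourierA fourierB
  generalize ∫ x in (-π)..π, f x * Real.cos (k * x) = I₁
  generalize ∫ x in (-π)..π, f x * Real.sin (k * x) = I₂
  generalize Real.cos (k * x) = c
  generalize Real.sin (k * x) = s
  have : (π : ℂ) ≠ 0 := by exact_mod_cast pi_ne_zero
  push_cast
  rw [smul_eq_mul, smul_eq_mul]
  field_simp
  linear_combination (-2 * (I₂ : ℂ) * s) * Complex.I_sq

lemma SInf.ae_abs_le {φ : ℝ → ℝ} (h : SInf φ) (s : Set ℝ) :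
    ∀ᵐ t ∂(volume.restrict s), |φ t| ≤ 1 := ae_restrict_of_ae h.2.2

lemma SInf.integrableOn_mul {φ g : ℝ → ℝ} (h : SInf φ) {s : Set ℝ} (hg : IntegrableOn g s) :
    IntegrableOn (fun t => φ t * g t) s := by
  refine Integrable.mono' hg.norm (h.1.aestronglyMeasurable.mul hg.1) ?_
  filter_upwards [h.ae_abs_le s] with t ht
  rw [norm_mul]
  exact mul_le_of_le_one_left (norm_nonneg _) ht

lemma SInf.intervalIntegrable_mul {φ g : ℝ → ℝ} (h : SInf φ) (hg : Continuous g) (a b : ℝ) :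
    IntervalIntegrable (fun t => φ t * g t) volume a b :=
  ⟨h.integrableOn_mul (hg.intervalIntegrable a b).1,
    h.integrableOn_mul (hg.intervalIntegrable a b).2⟩

lemma SInf.abs_integral_mul_le {φ g : ℝ → ℝ} (h : SInf φ) (hg : Continuous g) {a b : ℝ}
    (hab : a ≤ b) : |∫ t in a..b, φ t * g t| ≤ ∫ t in a..b, |g t| := by
  rw [intervalIntegral.integral_of_le hab, intervalIntegral.integral_of_le hab]
  refine norm_integral_le_of_norm_le (f := fun t => φ t * g t) (hg.abs.intervalIntegrable a b).1 ?_
  filter_upwards [h.ae_abs_le _] with t ht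
  rw [norm_mul]
  exact mul_le_of_le_one_left (norm_nonneg _) ht

/-- The harmonics of `f` in terms of its `(ψ, β)`-derivative. -/
lemma IsPsiDeriv.harmonic_eq {ψ : ℕ → ℝ} {β : ℝ} {f φ : ℝ → ℝ} (h : IsPsiDeriv ψ β f φ) {k : ℕ}
    (hk : 1 ≤ k) (hψ : ψ k ≠ 0) (x : ℝ) :
    fourierA f k * Real.cos (k * x) + fourierB f k * Real.sin (k * x) =
      1 / π * ∫ t in (-π)..π, φ t * (ψ k * Real.cos (k * (t - x) + β * π / 2)) := by
  obtain ⟨hA, hB⟩ := h.2.2 k hk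
  set θ := β * π / 2
  have e : ∀ t, φ t * (ψ k * Real.cos (k * (t - x) + θ)) =
      ψ k * Real.cos (k * x - θ) * (φ t * Real.cos (k * t)) +
        ψ k * Real.sin (k * x - θ) * (φ t * Real.sin (k * t)) := by
    intro t
    rw [show k * (t - x) + θ = k * t - (k * x - θ) by ring, Real.cos_sub]; ring
  simp_rw [e]
  rw [intervalIntegral.integral_add, intervalIntegral.integral_const_mul,
    intervalIntegral.integral_const_mul]
  · have hA' : ψ k * fourierA φ k = fourierA f k * Real.cos θ + fourierB f k * Real.sin θ := by
      rw [hA]; field_simp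
    have hB' : ψ k * fourierB φ k = fourierB f k * Real.cos θ - fourierA f k * Real.sin θ := by
      rw [hB]; field_simp
    have hr : 1 / π * (ψ k * Real.cos (k * x - θ) * (∫ t in (-π)..π, φ t * Real.cos (k * t)) +
        ψ k * Real.sin (k * x - θ) * ∫ t in (-π)..π, φ t * Real.sin (k * t)) =
        (ψ k * fourierA φ k) * Real.cos (k * x - θ) +
          (ψ k * fourierB φ k) * Real.sin (k * x - θ) := by
      unfold fourierA fourierB; ring
    rw [hr, hA', hB', Real.cos_sub, Real.sin_sub]
    linear_combination (-(fourierA f k * Real.cos (k * x)) -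
      fourierB f k * Real.sin (k * x)) * Real.sin_sq_add_cos_sq θ
  · exact (h.1.intervalIntegrable_mul (by fun_prop) _ _).const_mul _
  · exact (h.1.intervalIntegrable_mul (by fun_prop) _ _).const_mul _

lemma integrable_comp_abs_of_integrable {f : ℝ → ℝ} (hf : Integrable f) :
    Integrable fun t : ℝ => f |t| := by
  rw [← integrableOn_univ, ← Iic_union_Ioi (a := (0 : ℝ))]
  refine IntegrableOn.union ?_ ?_
  · refine hf.comp_neg.integrableOn.congr_fun (fun t ht => ?_) measurableSet_Iic
    rw [abs_of_nonpos (show t ≤ 0 from ht)]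
  · refine hf.integrableOn.congr_fun (fun t ht => ?_) measurableSet_Ioi
    rw [abs_of_pos (show 0 < t from ht)]

lemma abs_integral_le_of_le_comp_abs {F B : ℝ → ℝ} {r : ℝ} (hr : 0 ≤ r)
    (hB : IntegrableOn B (Ioc 0 r)) (hF : ∀ᵐ t, 0 < |t| → |t| ≤ r → |F t| ≤ B |t|) :
    |∫ t in (-r)..r, F t| ≤ 2 * ∫ t in Ioc 0 r, B t := by
  set D : ℝ → ℝ := (Ioc 0 r).indicator B with hD
  have hDi : Integrable fun t : ℝ => D |t| :=
    integrable_comp_abs_of_integrable ((integrable_indicator_iff measurableSet_Ioc).2 hB)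
  rw [intervalIntegral.integral_of_le (by linarith)]
  calc |∫ t in Ioc (-r) r, F t| ≤ ∫ t in Ioc (-r) r, D |t| := by
        refine norm_integral_le_of_norm_le (f := F) hDi.integrableOn ?_
        have h0 : ∀ᵐ t : ℝ ∂(volume.restrict (Ioc (-r) r)), t ≠ 0 :=
          ae_restrict_of_ae (Measure.ae_ne volume 0)
        filter_upwards [ae_restrict_mem measurableSet_Ioc, h0, ae_restrict_of_ae hF]
          with t ht ht0 hFt
        have htr : |t| ≤ r := abs_le.2 ⟨ht.1.le, ht.2⟩
        rw [hD, indicator_of_mem (show |t| ∈ Ioc 0 r from ⟨abs_pos.2 ht0, htr⟩)]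
        exact hFt (abs_pos.2 ht0) htr
    _ = ∫ t, D |t| := by
        rw [← integral_Icc_eq_integral_Ioc]
        refine setIntegral_eq_integral_of_forall_compl_eq_zero fun t ht => ?_
        exact indicator_of_notMem (fun h => ht (abs_le.1 h.2)) _
    _ = 2 * ∫ t in Ioi 0, D t := integral_comp_abs
    _ = 2 * ∫ t in Ioc 0 r, B t := by
        rw [hD, setIntegral_indicator measurableSet_Ioc,
          inter_eq_self_of_subset_right Ioc_subset_Ioi_self]

/-- The `L¹`-norms of blocks of the kernel. -/
lemma MprimeClass.integral_abs_block_le {ψ : ℝ → ℝ} (h : MprimeClass ψ) {n M : ℕ} (hn : 1 ≤ n)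
    (θ : ℝ) :
    ∫ t in (-π)..π, |∑ k ∈ Finset.Ico n M, ψ k * Real.cos (k * t + θ)| ≤
      2 * (π * ψ n + (1 + π) * (ψ n + ∫ t in Ioi (1 / π), ψ (t + n) / t)) := by
  set G : ℝ → ℝ := fun t => ∫ u in (0 : ℝ)..(1 / t), ψ (n + u) with hG
  have hGi : IntegrableOn G (Ioc 0 π) := h.integrableOn_primitive hn pi_pos
  have hc : IntegrableOn (fun _ : ℝ => ψ n) (Ioc 0 π) := integrable_const _
  refine (le_abs_self _).trans ((abs_integral_le_of_le_comp_abs pi_pos.le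
    (B := fun t => ψ n + (1 + π) * G t) (hc.add (hGi.const_mul _))
    (Eventually.of_forall fun t ht htp => ?_)).trans ?_)
  · rw [abs_abs]
    exact h.1.abs_tail_le_integral hn (abs_pos.1 ht) htp
  · rw [integral_add hc (hGi.const_mul _), integral_const_mul,
      setIntegral_const, Real.volume_real_Ioc_of_le pi_pos.le, sub_zero, smul_eq_mul]
    have := h.integral_primitive_le hn pi_pos
    have := pi_pos
    gcongr

lemma MprimeClass.tendsto_blockBound {ψ : ℝ → ℝ} (h : MprimeClass ψ) :
    Tendsto (fun n : ℕ => 2 * (π * ψ (n + 1 : ℕ) + (1 + π) * (ψ (n + 1 : ℕ) +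
      ∫ t in Ioi (1 / π), ψ (t + (n + 1 : ℕ)) / t))) atTop (nhds 0) := by
  have hc : Tendsto (fun n : ℕ => ((n + 1 : ℕ) : ℝ)) atTop atTop :=
    tendsto_natCast_atTop_atTop.comp (tendsto_add_atTop_nat 1)
  have h1 : Tendsto (fun n : ℕ => ψ (n + 1 : ℕ)) atTop (nhds 0) := h.1.2.2.comp hc
  have hpos : 0 < 1 / π := one_div_pos.2 pi_pos
  have h2 : Tendsto (fun n : ℕ => ∫ t in Ioi (1 / π), ψ (t + (n + 1 : ℕ)) / t) atTop
      (nhds (∫ t in Ioi (1 / π), (0 : ℝ))) := by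
    refine tendsto_integral_of_dominated_convergence (fun t => ψ (t + (1 : ℕ)) / t)
      (fun n => (h.integrableOn_shift_div (Nat.le_add_left 1 n) hpos).1)
      (h.integrableOn_shift_div le_rfl hpos) (fun n => ?_) ?_
    · filter_upwards [ae_restrict_mem measurableSet_Ioi] with t ht
      have ht0 : 0 < t := hpos.trans ht
      have h1 : (1 : ℝ) ≤ t + (1 : ℕ) := by push_cast; linarith
      have h2 : t + (1 : ℕ) ≤ t + (n + 1 : ℕ) := by push_cast; linarith [n.cast_nonneg (α := ℝ)]
      rw [Real.norm_eq_abs, abs_of_nonneg (div_nonneg (h.1.pos (h1.trans h2)).le ht0.le)]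
      gcongr
      exact h.1.le h1 h2
    · filter_upwards with t
      have := (h.1.2.2.comp (tendsto_atTop_add_const_left _ t hc)).div_const t
      simpa using this
  rw [integral_zero] at h2
  have := ((h1.const_mul π).add ((h1.add h2).const_mul (1 + π))).const_mul 2
  simpa using this

/-- The Fourier series of a function of the class converges at the origin. -/
lemma IsPsiDeriv.tendsto_sum_fourierA {ψ : ℝ → ℝ} (h : MprimeClass ψ) {β : ℝ} {f φ : ℝ → ℝ}
    (hf : Continuous f) (hp : Periodic2pi f) (hd : IsPsiDeriv (fun k : ℕ => ψ k) β f φ) :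
    Tendsto (fun N : ℕ => fourierA f 0 / 2 + ∑ k ∈ Finset.Ico 1 (N + 1), fourierA f k) atTop
      (nhds (f 0)) := by
  have : Fact (0 < 2 * π) := ⟨two_pi_pos⟩
  set F := circleLift f hf hp with hF
  set Q : ℕ → C(AddCircle (2 * π), ℂ) := fun N => ∑ k ∈ Finset.range N,
    (fourierCoeff F (k : ℤ) • fourier (T := 2 * π) (k : ℤ) +
      fourierCoeff F (-(k : ℤ)) • fourier (T := 2 * π) (-(k : ℤ))) with hQ
  have hQc : CauchySeq fun N => Q (N + 1) := by
    refine cauchySeq_of_le_tendsto_0' _ (fun m M hmM => ?_) h.tendsto_blockBound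
    rw [dist_comm, dist_eq_norm]
    have hb0 : 0 ≤ 2 * (π * ψ (m + 1 : ℕ) + (1 + π) * (ψ (m + 1 : ℕ) +
      ∫ t in Ioi (1 / π), ψ (t + (m + 1 : ℕ)) / t)) := by
      have h1 := (h.1.pos (t := (m + 1 : ℕ)) (by exact_mod_cast Nat.le_add_left 1 m)).le
      have h2 := h.1.integral_shift_div_nonneg (Nat.le_add_left 1 m) (one_div_pos.2 pi_pos)
      have := pi_pos
      positivity
    rw [ContinuousMap.norm_le _ hb0]
    intro y
    induction y using QuotientAddGroup.induction_on with
    | H x =>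
    rw [ContinuousMap.sub_apply]
    simp only [hQ]
    rw [sum_fourier_circleLift_coe, sum_fourier_circleLift_coe, ← Complex.ofReal_sub,
      ← Finset.sum_Ico_eq_sub _ (Nat.succ_le_succ hmM), Complex.norm_real, Real.norm_eq_abs]
    have e : ∑ k ∈ Finset.Ico (m + 1) (M + 1),
        (fourierA f k * Real.cos (k * x) + fourierB f k * Real.sin (k * x)) =
        1 / π * ∫ t in (-π)..π, φ t * ∑ k ∈ Finset.Ico (m + 1) (M + 1),
          ψ k * Real.cos (k * (t - x) + β * π / 2) := by
      simp_rw [Finset.mul_sum]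
      rw [intervalIntegral.integral_finsetSum, Finset.mul_sum]
      · refine Finset.sum_congr rfl fun k hk => ?_
        have hk1 : 1 ≤ k := by have := (Finset.mem_Ico.1 hk).1; omega
        exact hd.harmonic_eq hk1 (h.1.pos (by exact_mod_cast hk1)).ne' x
      · intro k _
        exact hd.1.intervalIntegrable_mul (by fun_prop) _ _
    rw [e, abs_mul, abs_of_pos (one_div_pos.2 pi_pos)]
    set D : ℝ → ℝ := fun t => |∑ k ∈ Finset.Ico (m + 1) (M + 1),
          ψ k * Real.cos (k * t + β * π / 2)| with hD
    have hDp : Function.Periodic D (2 * π) := by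
      intro t
      simp only [hD]
      congr 1
      refine Finset.sum_congr rfl fun k _ => ?_
      rw [show k * (t + 2 * π) + β * π / 2 = k * t + β * π / 2 + k * (2 * π) by ring,
        Real.cos_add_nat_mul_two_pi]
    have h1 : |∫ t in (-π)..π, φ t * ∑ k ∈ Finset.Ico (m + 1) (M + 1),
          ψ k * Real.cos (k * (t - x) + β * π / 2)| ≤ ∫ t in (-π)..π, D t := by
      refine (hd.1.abs_integral_mul_le (by fun_prop) (by linarith [pi_pos])).trans_eq ?_
      rw [intervalIntegral.integral_comp_sub_right D x]
      have := hDp.intervalIntegral_add_eq (-π - x) (-π)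
      rw [show -π - x + 2 * π = π - x by ring, show -π + 2 * π = π by ring] at this
      exact this
    refine (mul_le_of_le_one_left (abs_nonneg _) ?_).trans
      (h1.trans (h.integral_abs_block_le (Nat.le_add_left 1 m) _))
    rw [div_le_one pi_pos]
    linarith [Real.pi_gt_three]
  have hlim := tendsto_sum_fourier_of_cauchySeq F
    ((cauchySeq_shift 1).1 hQc)
  have hev : Tendsto (fun N => (Q (N + 1)) ((0 : ℝ) : AddCircle (2 * π))) atTop
      (nhds ((F + fourierCoeff F 0 • fourier (T := 2 * π) 0) ((0 : ℝ) : AddCircle (2 * π)))) :=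
    ((continuous_eval_const _).tendsto _).comp
      (hlim.comp (tendsto_add_atTop_nat 1))
  have hre := (Complex.continuous_re.tendsto _).comp hev
  have hv : ((F + fourierCoeff F 0 • fourier (T := 2 * π) 0)
      ((0 : ℝ) : AddCircle (2 * π))).re = f 0 + fourierA f 0 / 2 := by
    rw [ContinuousMap.add_apply, ContinuousMap.smul_apply, hF, circleLift_coe,
      fourierCoeff_circleLift, fourier_zero]
    simp [fourierA]
    ring
  rw [hv] at hre
  have := hre.sub_const (fourierA f 0 / 2)
  rw [add_sub_cancel_right] at this
  refine this.congr fun N => ?_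
  simp only [Function.comp_apply, hQ]
  rw [sum_fourier_circleLift_coe, Complex.ofReal_re, Finset.sum_range_eq_add_Ico _ (Nat.succ_pos N)]
  simp
  ring

/-! ### Deviations of the sums `U^ψ_{n,p}` -/

lemma harmonicTerm_zero_right (f : ℝ → ℝ) {k : ℕ} (hk : 1 ≤ k) :
    harmonicTerm f k 0 = fourierA f k := by
  rw [harmonicTerm, if_neg (by omega)]
  simp

lemma lambdaU_mul {ψ : ℕ → ℝ} {n p j : ℕ} (hpn : p ≤ n) (hψ : ψ (n - p + j) ≠ 0) :
    (1 - lambdaU ψ n p (n - p + j)) * ψ (n - p + j) = ψ n * (j / p) := by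
  rcases Nat.eq_zero_or_pos j with rfl | hj
  · simp [lambdaU]
  · rw [lambdaU, if_neg (by omega)]
    push_cast [hpn]
    field_simp
    ring

/-- The integral representation of the deviation of `U^ψ_{n,p}` from a partial Fourier sum. -/
lemma IsPsiDeriv.sum_sub_Usum {ψ : ℝ → ℝ} (h : MClass ψ) {β : ℝ} {f φ : ℝ → ℝ}
    (hd : IsPsiDeriv (fun k : ℕ => ψ k) β f φ) {n p N : ℕ} (hp : 1 ≤ p) (hpn : p ≤ n)
    (hnN : n ≤ N) :
    fourierA f 0 / 2 + ∑ k ∈ Finset.Ico 1 N, fourierA f k - Usum (fun k : ℕ => ψ k) n p f 0 =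
      1 / π * ∫ t in (-π)..π, φ t *
        (ψ n * ∑ j ∈ Finset.range p, (j / p : ℝ) * Real.cos ((n - p + j : ℕ) * t + β * π / 2) +
          ∑ k ∈ Finset.Ico n N, ψ k * Real.cos (k * t + β * π / 2)) := by
  have ha : ∀ k : ℕ, 1 ≤ k → fourierA f k =
      1 / π * ∫ t in (-π)..π, φ t * (ψ k * Real.cos (k * t + β * π / 2)) := by
    intro k hk
    have := hd.harmonic_eq hk (h.pos (by exact_mod_cast hk)).ne' 0
    simpa using this
  have h0 : fourierA f 0 / 2 + ∑ k ∈ Finset.Ico 1 N, fourierA f k =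
      ∑ k ∈ Finset.range N, harmonicTerm f k 0 := by
    rw [Finset.sum_range_eq_add_Ico _ (by omega), harmonicTerm, if_pos rfl]
    exact congrArg _ (Finset.sum_congr rfl fun k hk =>
      (harmonicTerm_zero_right f (Finset.mem_Ico.1 hk).1).symm)
  have h1 : ∑ k ∈ Finset.range N, harmonicTerm f k 0 - Usum (fun k : ℕ => ψ k) n p f 0 =
      ∑ k ∈ Finset.range n, (1 - lambdaU (fun k : ℕ => ψ k) n p k) * harmonicTerm f k 0 +
        ∑ k ∈ Finset.Ico n N, fourierA f k := by
    rw [Usum, ← Finset.sum_range_add_sum_Ico _ hnN, add_sub_right_comm, ← Finset.sum_sub_distrib]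
    congr 1
    · exact Finset.sum_congr rfl fun k _ => by ring
    · exact Finset.sum_congr rfl fun k hk =>
        harmonicTerm_zero_right f (by have := (Finset.mem_Ico.1 hk).1; omega)
  have h2 : ∑ k ∈ Finset.range n, (1 - lambdaU (fun k : ℕ => ψ k) n p k) * harmonicTerm f k 0 =
      ∑ j ∈ Finset.range p, 1 / π * ∫ t in (-π)..π,
        φ t * (ψ n * ((j / p : ℝ) * Real.cos ((n - p + j : ℕ) * t + β * π / 2))) := by
    nth_rewrite 1 [← Nat.sub_add_cancel hpn]
    rw [Finset.sum_range_add, Finset.sum_eq_zero, zero_add]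
    · refine Finset.sum_congr rfl fun j _ => ?_
      rcases Nat.eq_zero_or_pos j with rfl | hj
      · simp [lambdaU]
      · have hk : 1 ≤ n - p + j := by omega
        have hl := lambdaU_mul (ψ := fun k : ℕ => ψ k) (j := j) hpn
          (h.pos (by exact_mod_cast hk)).ne'
        rw [harmonicTerm_zero_right f hk, ha _ hk, mul_left_comm,
          ← intervalIntegral.integral_const_mul]
        congr 2; funext t
        linear_combination φ t * Real.cos ((n - p + j : ℕ) * t + β * π / 2) * hl
    · intro k hk
      rw [lambdaU, if_pos (Finset.mem_range.1 hk).le, sub_self, zero_mul]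
  rw [h0, h1, h2]
  simp_rw [mul_add, Finset.mul_sum]
  rw [intervalIntegral.integral_add, intervalIntegral.integral_finsetSum,
    intervalIntegral.integral_finsetSum, mul_add, Finset.mul_sum, Finset.mul_sum]
  · congr 1
    exact Finset.sum_congr rfl fun k hk =>
      ha k (by have := (Finset.mem_Ico.1 hk).1; omega)
  · exact fun k _ => hd.1.intervalIntegrable_mul (by fun_prop) _ _
  · exact fun k _ => hd.1.intervalIntegrable_mul (by fun_prop) _ _
  · simp_rw [← Finset.mul_sum]
    exact hd.1.intervalIntegrable_mul (by fun_prop) _ _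
  · simp_rw [← Finset.mul_sum]
    exact hd.1.intervalIntegrable_mul (by fun_prop) _ _

lemma setIntegral_preimage_comp_div (F : ℝ → ℝ) {S : Set ℝ} (hS : MeasurableSet S) (c : ℝ) :
    ∫ t in (fun t => t / c) ⁻¹' S, F (t / c) = |c| * ∫ t in S, F t := by
  have hm : MeasurableSet ((fun t : ℝ => t / c) ⁻¹' S) := (measurable_id.div_const c) hS
  rw [← integral_indicator hS, ← integral_indicator hm, ← smul_eq_mul,
    ← Measure.integral_comp_div]
  rfl

/-- The set `{t | b < |t| < c}` (for `0 ≤ b`). -/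
def annulus (b c : ℝ) : Set ℝ := Ioo (-c) (-b) ∪ Ioo b c

lemma measurableSet_annulus (b c : ℝ) : MeasurableSet (annulus b c) :=
  measurableSet_Ioo.union measurableSet_Ioo

lemma mem_annulus {b c t : ℝ} (hb : 0 ≤ b) : t ∈ annulus b c ↔ b < |t| ∧ |t| < c := by
  simp only [annulus, mem_union, mem_Ioo]
  rcases le_total 0 t with ht | ht
  · rw [abs_of_nonneg ht]
    constructor
    · rintro (h | h)
      · exact absurd h.2 (by linarith)
      · exact h
    · exact Or.inr
  · rw [abs_of_nonpos ht]
    constructor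
    · rintro (h | h)
      · exact ⟨by linarith, by linarith⟩
      · exact absurd h.1 (by linarith)
    · exact fun h => Or.inl ⟨by linarith, by linarith⟩

lemma integral_annulus_comp_div (φ : ℝ → ℝ) (θ b c : ℝ) {n : ℕ} (hn : 1 ≤ n) :
    ∫ t in annulus (b * n) (c * n), φ (t / n) * Real.sin (t + θ) / t =
      ∫ t in annulus b c, φ t * (Real.sin (n * t + θ) / t) := by
  have hn0 : (0 : ℝ) < n := by exact_mod_cast hn
  have hpre : (fun t : ℝ => t / n) ⁻¹' annulus b c = annulus (b * n) (c * n) := by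
    ext t
    simp only [annulus, mem_preimage, mem_union, mem_Ioo, lt_div_iff₀ hn0, div_lt_iff₀ hn0, neg_mul]
  have := setIntegral_preimage_comp_div (fun u => φ u * Real.sin (n * u + θ) / (n * u))
    (measurableSet_annulus b c) n
  rw [hpre, abs_of_pos hn0, ← integral_const_mul] at this
  have e₁ : ∀ t : ℝ, φ (t / n) * Real.sin (n * (t / n) + θ) / (n * (t / n)) =
      φ (t / n) * Real.sin (t + θ) / t := fun t => by rw [mul_div_cancel₀ _ hn0.ne']
  have e₂ : ∀ t : ℝ, n * (φ t * Real.sin (n * t + θ) / (n * t)) =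
      φ t * (Real.sin (n * t + θ) / t) := fun t => by
    rw [← mul_div_assoc, mul_div_mul_left _ _ hn0.ne', mul_div_assoc]
  simpa only [e₁, e₂] using this

lemma SInf.integrableOn_annulus {φ : ℝ → ℝ} (h : SInf φ) (ω θ c : ℝ) {b : ℝ} (hb : 0 < b) :
    IntegrableOn (fun t => φ t * (Real.sin (ω * t + θ) / t)) (annulus b c) := by
  refine h.integrableOn_mul (Measure.integrableOn_of_bounded (M := 1 / b) ?_ ?_ ?_)
  · exact ((measure_union_le _ _).trans_lt (by simp [Real.volume_Ioo])).ne
  · exact (by fun_prop : Measurable _).aestronglyMeasurable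
  · filter_upwards [ae_restrict_mem (measurableSet_annulus b c)] with t ht
    have := ((mem_annulus hb.le).1 ht).1
    rw [Real.norm_eq_abs, abs_div]
    have := Real.abs_sin_le_one (ω * t + θ)
    gcongr

lemma integral_inv_sq_le {x : ℝ} (hx : 0 < x) {y : ℝ} (hxy : x ≤ y) :
    IntegrableOn (fun t : ℝ => 1 / t ^ 2) (Ioc x y) ∧ ∫ t in Ioc x y, 1 / t ^ 2 ≤ 1 / x := by
  have e : ∀ t : ℝ, 1 / t ^ 2 = t ^ (-2 : ℤ) := fun t => by
    rw [zpow_neg, one_div]; norm_cast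
  have h0 : (0 : ℝ) ∉ uIcc x y := by
    rw [uIcc_of_le hxy]; exact fun h => absurd h.1 (not_le.2 hx)
  simp_rw [e]
  refine ⟨(intervalIntegral.intervalIntegrable_zpow (Or.inr h0)).1, ?_⟩
  rw [← intervalIntegral.integral_of_le hxy, integral_zpow (Or.inr ⟨by norm_num, h0⟩)]
  have : 0 < y⁻¹ := inv_pos.2 (hx.trans_le hxy)
  norm_num
  linarith

/-- The data `b`, `c`, `σ` of the annulus `b < |t| < c` and of the sign of the principal term, for
`P = 1 / p` and `a = α(n)`. -/
def IsPrincipal (P a b c σ : ℝ) : Prop :=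
  (a ≤ P ∧ b = a ∧ c = P ∧ σ = -1) ∨ (P < a ∧ a ≤ 1 ∧ b = P ∧ c = a ∧ σ = 1) ∨
    (1 < a ∧ b = P ∧ c = 1 ∧ σ = 1)

lemma IsPrincipal.pos {P a b c σ : ℝ} (h : IsPrincipal P a b c σ) (hP : 0 < P) (ha : 0 < a) :
    0 < b := by
  rcases h with h | h | h <;> linarith

lemma IsPrincipal.le_one {P a b c σ : ℝ} (h : IsPrincipal P a b c σ) (hP : P ≤ 1) : c ≤ 1 := by
  rcases h with h | h | h <;> linarith

/-- The combination of the two asymptotic estimates on each of the ranges of `x = |t|`. -/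
lemma IsPrincipal.abs_combination_le {P a b c σ : ℝ} (h : IsPrincipal P a b c σ) (hP : P ≤ 1)
    {L H s q l e x w : ℝ} (hq : 0 ≤ q) (hl : 0 ≤ l) (hxa : x ≠ a) (hxP : x ≠ P) (hx1 : x ≠ 1)
    (hL₁ : x ≤ P → |L| ≤ l) (hL₂ : P < x → |L - s| ≤ 2 + l)
    (hH₁ : x ≤ a → |H| ≤ q + e) (hH₂ : a < x → |H + q * s| ≤ 2 * q + e)
    (hs : 1 < x → |s| ≤ 1) (hw₁ : b < x → x < c → w = s) (hw₂ : ¬(b < x ∧ x < c) → w = 0) :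
    |q * L + H - σ * q * w| ≤ 5 * q + q * l + e := by
  have m₁ : ∀ {y z : ℝ}, |y| ≤ z → |q * y| ≤ q * z := fun hy => by
    rw [abs_mul, abs_of_nonneg hq]; gcongr
  have hql : 0 ≤ q * l := mul_nonneg hq hl
  rcases lt_or_gt_of_ne hxP with hxP | hxP <;> rcases lt_or_gt_of_ne hxa with hxa | hxa
  · have hw : w = 0 := hw₂ (by rcases h with h | h | h <;> rintro ⟨h₁, h₂⟩ <;> linarith)
    have h₁ := abs_le.1 (m₁ (hL₁ hxP.le))
    have h₂ := abs_le.1 (hH₁ hxa.le)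
    rw [hw]
    exact abs_le.2 ⟨by linarith, by linarith⟩
  · obtain ⟨hw, hσ⟩ : w = s ∧ σ = -1 := by
      rcases h with ⟨_, rfl, rfl, h⟩ | h | h
      · exact ⟨hw₁ hxa hxP, h⟩
      · linarith
      · linarith
    have h₁ := abs_le.1 (m₁ (hL₁ hxP.le))
    have h₂ := abs_le.1 (hH₂ hxa)
    rw [hw, hσ]
    exact abs_le.2 ⟨by linarith, by linarith⟩
  · have h₁ := abs_le.1 (m₁ (hL₂ hxP))
    have h₂ := abs_le.1 (hH₁ hxa.le)
    have hσ : σ = 1 := by rcases h with h | h | h <;> linarith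
    by_cases hx : b < x ∧ x < c
    · rw [hw₁ hx.1 hx.2, hσ]
      exact abs_le.2 ⟨by linarith, by linarith⟩
    · have hx1' : 1 < x := by
        refine lt_of_le_of_ne (not_lt.1 fun hlt => hx ?_) hx1.symm
        rcases h with h | h | h
        · linarith
        · exact ⟨by linarith, by linarith⟩
        · exact ⟨by linarith, by linarith⟩
      have h₃ := abs_le.1 (m₁ (hs hx1'))
      rw [hw₂ hx]
      exact abs_le.2 ⟨by linarith, by linarith⟩
  · have hw : w = 0 := hw₂ (by rcases h with h | h | h <;> rintro ⟨h₁, h₂⟩ <;> linarith)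
    have h₁ := abs_le.1 (m₁ (hL₂ hxP))
    have h₂ := abs_le.1 (hH₂ hxa)
    rw [hw]
    exact abs_le.2 ⟨by linarith, by linarith⟩

/-- The majorant of the difference between the kernel of the deviation and its principal part. -/
def kernelBound (ψ : ℝ → ℝ) (n p : ℕ) (a δ t : ℝ) : ℝ :=
  5 * ψ n + ψ n * ((Ioc 0 (1 / p : ℝ)).indicator (fun _ => (p : ℝ)) t +
    5 / p * (Ioc (1 / p : ℝ) π).indicator (fun t => 1 / t ^ 2) t) +
  ((1 + π) * (Ioc 0 (min a π)).indicator (fun t => ∫ u in (0 : ℝ)..(1 / t), ψ (n + u)) t +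
    7 * (Ioc a π).indicator (fun t => (ψ n - ψ (n + 1 / t)) / t) t + 2 * δ / a)

lemma MprimeClass.integral_kernelBound_le {ψ : ℝ → ℝ} (h : MprimeClass ψ) {n p : ℕ} (hp : 1 ≤ p)
    (hpn : p ≤ n) {K a : ℝ} (hK : 0 < K) (ha : K / n ≤ a) (δ : ℝ) :
    IntegrableOn (kernelBound ψ n p a δ) (Ioc 0 π) ∧
      ∫ t in Ioc 0 π, kernelBound ψ n p a δ t ≤
        (5 * π + 6) * ψ n + (1 + π) * (ψ n + ∫ u in Ioi (1 / a), ψ (u + n) / u) +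
          7 * (π / K * ψ n + ∫ t in Ioi a, (ψ n - ψ (n + 1 / t)) / t) + 2 * π * δ / a := by
  have hn : 1 ≤ n := hp.trans hpn
  have hn0 : (0 : ℝ) < n := by exact_mod_cast hn
  have hp0 : (0 : ℝ) < p := by exact_mod_cast hp
  have ha0 : 0 < a := (div_pos hK hn0).trans_le ha
  have hP : (1 / p : ℝ) ≤ π := by
    have : (1 : ℝ) ≤ p := by exact_mod_cast hp
    rw [div_le_iff₀ hp0]
    nlinarith [Real.pi_gt_three]
  have hP0 : 0 < (1 / p : ℝ) := one_div_pos.2 hp0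
  have hc : ∀ r : ℝ, IntegrableOn (fun _ : ℝ => r) (Ioc 0 π) := fun r => integrable_const _
  have hi : ∀ {g : ℝ → ℝ} {x y : ℝ}, IntegrableOn g (Ioc x y) → 0 ≤ x → y ≤ π →
      IntegrableOn ((Ioc x y).indicator g) (Ioc 0 π) ∧
        ∫ t in Ioc 0 π, (Ioc x y).indicator g t = ∫ t in Ioc x y, g t := by
    intro g x y hg hx hy
    refine ⟨((integrable_indicator_iff measurableSet_Ioc).2 hg).integrableOn, ?_⟩
    rw [setIntegral_indicator measurableSet_Ioc,
      inter_eq_self_of_subset_right (Ioc_subset_Ioc hx hy)]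
  obtain ⟨i₁, v₁⟩ := hi (g := fun _ => (p : ℝ)) (x := 0) (y := 1 / p)
    (integrable_const _) le_rfl hP
  obtain ⟨i₂, v₂⟩ := hi (integral_inv_sq_le hP0 hP).1 hP0.le le_rfl
  have hm0 : 0 < min a π := lt_min ha0 pi_pos
  obtain ⟨i₃, v₃⟩ := hi (h.integrableOn_primitive hn hm0) le_rfl (min_le_right _ _)
  obtain ⟨i₄, v₄⟩ := hi (h.1.integrableOn_gap_div_Ioc hn ha0 π).1 ha0.le le_rfl
  set g₁ := (Ioc 0 (1 / p : ℝ)).indicator fun _ => (p : ℝ)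
  set g₂ := (Ioc (1 / p : ℝ) π).indicator fun t => 1 / t ^ 2
  set g₃ := (Ioc 0 (min a π)).indicator fun t => ∫ u in (0 : ℝ)..(1 / t), ψ (n + u)
  set g₄ := (Ioc a π).indicator fun t => (ψ n - ψ (n + 1 / t)) / t
  have hk : kernelBound ψ n p a δ = fun t => 5 * ψ n + ψ n * (g₁ t + 5 / p * g₂ t) +
    ((1 + π) * g₃ t + 7 * g₄ t + 2 * δ / a) := rfl
  have e₁ : IntegrableOn (fun t => ψ n * (g₁ t + 5 / p * g₂ t)) (Ioc 0 π) :=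
    (i₁.add (i₂.const_mul (5 / p))).const_mul (ψ n)
  have e₂ : IntegrableOn (fun t => 5 * ψ n + ψ n * (g₁ t + 5 / p * g₂ t)) (Ioc 0 π) :=
    (hc (5 * ψ n)).add e₁
  have e₃ : IntegrableOn (fun t => (1 + π) * g₃ t + 7 * g₄ t) (Ioc 0 π) :=
    (i₃.const_mul (1 + π)).add (i₄.const_mul 7)
  have e₄ : IntegrableOn (fun t => (1 + π) * g₃ t + 7 * g₄ t + 2 * δ / a) (Ioc 0 π) :=
    e₃.add (hc (2 * δ / a))
  refine ⟨e₂.add e₄, ?_⟩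
  have b₂ := (integral_inv_sq_le hP0 hP).2
  have b₃ := h.integral_primitive_le_of_le hn hm0 (min_le_left a π)
  have b₄ := h.1.integral_gap_div_le hn hK ha
  have hψ := h.1.pos (t := n) (by exact_mod_cast hn)
  have hv : ∫ t in Ioc 0 π, kernelBound ψ n p a δ t =
      π * (5 * ψ n) + ψ n * (1 / p * p + 5 / p * ∫ t in Ioc (1 / p : ℝ) π, 1 / t ^ 2) +
        ((1 + π) * (∫ t in Ioc 0 (min a π), ∫ u in (0 : ℝ)..(1 / t), ψ (n + u)) +
          7 * (∫ t in Ioc a π, (ψ n - ψ (n + 1 / t)) / t) + π * (2 * δ / a)) := by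
    rw [hk, integral_add e₂ e₄, integral_add (hc _) e₁, integral_add e₃ (hc _),
      integral_add (i₃.const_mul _) (i₄.const_mul _), integral_const_mul _ g₃,
      integral_const_mul _ g₄, integral_const_mul _ fun t => g₁ t + 5 / p * g₂ t, integral_add i₁ (i₂.const_mul _), integral_const_mul _ g₂, v₁, v₂, v₃, v₄,
      setIntegral_const, setIntegral_const, setIntegral_const,
      Real.volume_real_Ioc_of_le pi_pos.le, Real.volume_real_Ioc_of_le hP0.le]
    simp only [sub_zero, smul_eq_mul]
  have b₂' : (1 / p * p : ℝ) + 5 / p * ∫ t in Ioc (1 / p : ℝ) π, 1 / t ^ 2 ≤ 6 := by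
    rw [one_div_one_div] at b₂
    calc _ ≤ (1 / p * p : ℝ) + 5 / p * p := by gcongr
      _ = 6 := by field_simp; norm_num
  have := mul_le_mul_of_nonneg_left b₂' hψ.le
  have := mul_le_mul_of_nonneg_left b₃ (by linarith [pi_pos] : 0 ≤ 1 + π)
  rw [hv]
  have : π * (2 * δ / a) = 2 * π * δ / a := by ring
  linarith

/-- The pointwise estimate of the kernel of the deviation. -/
lemma MClass.abs_kernel_sub_le {ψ : ℝ → ℝ} (h : MClass ψ) {n p N : ℕ} (hp : 1 ≤ p)
    (hpn : p ≤ n) (hnN : n ≤ N) {a b c σ : ℝ} (ha : 0 < a)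
    (hprin : IsPrincipal (1 / p) a b c σ) (θ : ℝ) {t : ℝ} (ht : 0 < |t|) (htp : |t| ≤ π)
    (hta : |t| ≠ a) (htP : |t| ≠ 1 / p) (ht1 : |t| ≠ 1) :
    |ψ n * ∑ j ∈ Finset.range p, (j / p : ℝ) * Real.cos ((n - p + j : ℕ) * t + θ) +
      ∑ k ∈ Finset.Ico n N, ψ k * Real.cos (k * t + θ) -
      σ * ψ n * (annulus b c).indicator (fun t => Real.sin (n * t + θ) / t) t| ≤
      kernelBound ψ n p a (ψ N) |t| := by
  have hn : 1 ≤ n := hp.trans hpn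
  have hp0 : (0 : ℝ) < p := by exact_mod_cast hp
  have hP : (1 / p : ℝ) ≤ 1 := (div_le_one hp0).2 (by exact_mod_cast hp)
  have hP0 : 0 < (1 / p : ℝ) := one_div_pos.2 hp0
  have ht0 : t ≠ 0 := abs_pos.1 ht
  have hψn : 0 < ψ n := h.pos (by exact_mod_cast hn)
  have hψN : 0 < ψ N := h.pos (by exact_mod_cast hn.trans hnN)
  have hb := hprin.pos hP0 ha
  have n₁ := indicator_nonneg (s := Ioc 0 (1 / p : ℝ)) (f := fun _ => (p : ℝ))
    (fun _ _ => hp0.le) |t|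
  have n₂ := indicator_nonneg (s := Ioc (1 / p : ℝ) π) (f := fun t : ℝ => 1 / t ^ 2)
    (fun _ _ => by positivity) |t|
  have n₃ := indicator_nonneg (s := Ioc 0 (min a π))
    (f := fun t => ∫ u in (0 : ℝ)..(1 / t), ψ (n + u))
    (fun t ht => h.integral_nonneg_aux hn (one_div_pos.2 ht.1).le) |t|
  have n₄ := indicator_nonneg (s := Ioc a π) (f := fun t => (ψ n - ψ (n + 1 / t)) / t)
    (fun t ht => h.gap_div_nonneg hn (ha.trans ht.1)) |t|
  have n₅ : 0 ≤ 2 * ψ N / a := by positivity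
  have n₆ : 0 ≤ 1 + π := by linarith [pi_pos]
  refine hprin.abs_combination_le hP (s := Real.sin (n * t + θ) / t) (x := |t|) hψn.le
    (by positivity) hta htP ht1 (fun hx => ?_) (fun hx => ?_) (fun hx => ?_)
    (fun hx => ?_) (fun hx => ?_) (fun h₁ h₂ => ?_) (fun h₁ => ?_)
  · rw [indicator_of_mem (show |t| ∈ Ioc 0 (1 / p : ℝ) from ⟨ht, hx⟩)]
    have : 0 ≤ (5 / p : ℝ) * (Ioc (1 / p : ℝ) π).indicator (fun t : ℝ => 1 / t ^ 2) |t| := by positivity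
    exact (abs_ramp_le ..).trans (by linarith)
  · rw [indicator_of_mem (show |t| ∈ Ioc (1 / p : ℝ) π from ⟨hx, htp⟩)]
    have := abs_ramp_sub_le hp hpn (θ := θ) ht0 htp
    rw [sq_abs]
    rw [div_eq_mul_one_div (5 / p : ℝ)] at this
    linarith
  · rw [indicator_of_mem (show |t| ∈ Ioc 0 (min a π) from ⟨ht, le_min hx htp⟩)]
    have := h.abs_tail_le_integral hn (θ := θ) (M := N) ht0 htp
    linarith
  · rw [indicator_of_mem (show |t| ∈ Ioc a π from ⟨hx, htp⟩)]
    have h₁ := h.abs_tail_add_le hn hnN (θ := θ) ht0 htp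
    have h₂ : ψ N / |t| ≤ ψ N / a := by gcongr
    have h₃ : 2 * (ψ N / a) = 2 * ψ N / a := by ring
    have h₄ := mul_nonneg n₆ n₃
    linarith
  · rw [abs_div]
    exact div_le_one_of_le₀ ((Real.abs_sin_le_one _).trans hx.le) (abs_nonneg _)
  · exact indicator_of_mem ((mem_annulus hb.le).2 ⟨h₁, h₂⟩) _
  · exact indicator_of_notMem (fun h₂ => h₁ ((mem_annulus hb.le).1 h₂)) _

lemma ae_abs_ne (x : ℝ) : ∀ᵐ t : ℝ, |t| ≠ x := by
  filter_upwards [Measure.ae_ne volume x, Measure.ae_ne volume (-x)] with t h₁ h₂ h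
  rcases abs_choice t with e | e
  · exact h₁ (e.symm.trans h)
  · exact h₂ (by linarith)

/-- The deviation of `U^ψ_{n,p}` from a partial Fourier sum is close to its principal part. -/
lemma MprimeClass.abs_partial_deviation_le {ψ : ℝ → ℝ} (h : MprimeClass ψ) {β : ℝ} {f φ : ℝ → ℝ}
    (hd : IsPsiDeriv (fun k : ℕ => ψ k) β f φ) {n p N : ℕ} (hp : 1 ≤ p) (hpn : p ≤ n)
    (hnN : n ≤ N) {K a b c σ : ℝ} (hK : 0 < K) (ha : K / n ≤ a)
    (hprin : IsPrincipal (1 / p) a b c σ) :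
    |fourierA f 0 / 2 + ∑ k ∈ Finset.Ico 1 N, fourierA f k - Usum (fun k : ℕ => ψ k) n p f 0 -
        σ * (ψ n / π) * ∫ t in annulus (b * n) (c * n),
          φ (t / n) * Real.sin (t + β * π / 2) / t| ≤
      2 * ((5 * π + 6) * ψ n + (1 + π) * (ψ n + ∫ u in Ioi (1 / a), ψ (u + n) / u) +
          7 * (π / K * ψ n + ∫ t in Ioi a, (ψ n - ψ (n + 1 / t)) / t) + 2 * π * ψ N / a) := by
  have hn : 1 ≤ n := hp.trans hpn
  have hn0 : (0 : ℝ) < n := by exact_mod_cast hn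
  have hp0 : (0 : ℝ) < p := by exact_mod_cast hp
  have ha0 : 0 < a := (div_pos hK hn0).trans_le ha
  have hP : (1 / p : ℝ) ≤ 1 := (div_le_one hp0).2 (by exact_mod_cast hp)
  have hb := hprin.pos (one_div_pos.2 hp0) ha0
  have hc := hprin.le_one hP
  set θ := β * π / 2
  set s : ℝ → ℝ := fun t => Real.sin (n * t + θ) / t with hs
  have hsub : annulus b c ⊆ Ioc (-π) π := fun t ht => by
    have := ((mem_annulus hb.le).1 ht).2
    have := abs_lt.1 (this.trans_le (hc.trans (by linarith [Real.pi_gt_three] : (1 : ℝ) ≤ π)))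
    exact ⟨this.1, this.2.le⟩
  have hind : ∀ t, φ t * (annulus b c).indicator s t =
      (annulus b c).indicator (fun t => φ t * s t) t := fun t => by
    by_cases ht : t ∈ annulus b c <;> simp [ht]
  have hint : IntervalIntegrable (fun t => φ t * (annulus b c).indicator s t) volume (-π) π := by
    simp_rw [hind]
    rw [intervalIntegrable_iff_integrableOn_Ioc_of_le (by linarith [pi_pos])]
    exact ((integrable_indicator_iff (measurableSet_annulus b c)).2
      (hd.1.integrableOn_annulus n θ c hb)).integrableOn
  have hval : ∫ t in annulus b c, φ t * s t =
      ∫ t in (-π)..π, φ t * (annulus b c).indicator s t := by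
    simp_rw [hind]
    rw [intervalIntegral.integral_of_le (by linarith [pi_pos]),
      setIntegral_indicator (measurableSet_annulus b c), inter_eq_self_of_subset_right hsub]
  rw [hd.sum_sub_Usum h.1 hp hpn hnN, integral_annulus_comp_div φ θ b c hn, hval]
  set k : ℝ → ℝ := fun t =>
    ψ n * ∑ j ∈ Finset.range p, (j / p : ℝ) * Real.cos ((n - p + j : ℕ) * t + θ) +
      ∑ k ∈ Finset.Ico n N, ψ k * Real.cos (k * t + θ) with hk
  have hkc : Continuous k := by fun_prop
  have e : 1 / π * (∫ t in (-π)..π, φ t * k t) -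
      σ * (ψ n / π) * ∫ t in (-π)..π, φ t * (annulus b c).indicator s t =
      1 / π * ∫ t in (-π)..π, φ t * (k t - σ * ψ n * (annulus b c).indicator s t) := by
    have : ∀ t, φ t * (k t - σ * ψ n * (annulus b c).indicator s t) =
        φ t * k t - σ * ψ n * (φ t * (annulus b c).indicator s t) := fun t => by ring
    simp_rw [this]
    rw [intervalIntegral.integral_sub (hd.1.intervalIntegrable_mul hkc _ _) (hint.const_mul _),
      intervalIntegral.integral_const_mul]
    ring
  obtain ⟨hBi, hB⟩ := h.integral_kernelBound_le hp hpn hK ha (ψ N)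
  rw [e, abs_mul, abs_of_pos (one_div_pos.2 pi_pos)]
  refine (mul_le_of_le_one_left (abs_nonneg _) ?_).trans
    ((abs_integral_le_of_le_comp_abs pi_pos.le hBi ?_).trans (by linarith))
  · rw [div_le_one pi_pos]
    linarith [Real.pi_gt_three]
  · filter_upwards [hd.1.2.2, ae_abs_ne a, ae_abs_ne (1 / p), ae_abs_ne 1]
      with t hφ hta htP ht1 ht htp
    rw [abs_mul]
    exact (mul_le_of_le_one_left (abs_nonneg _) hφ).trans
      (h.1.abs_kernel_sub_le hp hpn hnN ha0 hprin θ ht htp hta htP ht1)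

/-- The deviation of `U^ψ_{n,p}` at the origin is close to its principal part. -/
lemma MprimeClass.abs_deviation_le {ψ : ℝ → ℝ} (h : MprimeClass ψ) {β : ℝ} {f φ : ℝ → ℝ}
    (hf : Continuous f) (hper : Periodic2pi f)
    (hd : IsPsiDeriv (fun k : ℕ => ψ k) β f φ) {n p : ℕ} (hp : 1 ≤ p) (hpn : p ≤ n)
    {K a b c σ : ℝ} (hK : 0 < K) (ha : K / n ≤ a) (hprin : IsPrincipal (1 / p) a b c σ) :
    |f 0 - Usum (fun k : ℕ => ψ k) n p f 0 -
        σ * (ψ n / π) * ∫ t in annulus (b * n) (c * n),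
          φ (t / n) * Real.sin (t + β * π / 2) / t| ≤
      2 * (14 + 6 * π + 7 * (π / K)) * (ψ n + (∫ u in Ioi (1 / a), ψ (u + n) / u) +
        ∫ t in Ioi a, (ψ n - ψ (n + 1 / t)) / t) := by
  have hn : 1 ≤ n := hp.trans hpn
  have hn0 : (0 : ℝ) < n := by exact_mod_cast hn
  have ha0 : 0 < a := (div_pos hK hn0).trans_le ha
  set T := ∫ u in Ioi (1 / a), ψ (u + n) / u
  set E := ∫ t in Ioi a, (ψ n - ψ (n + 1 / t)) / t
  have hT : 0 ≤ T := h.1.integral_shift_div_nonneg hn (one_div_pos.2 ha0)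
  have hE : 0 ≤ E := setIntegral_nonneg measurableSet_Ioi
    fun t ht => h.1.gap_div_nonneg hn (ha0.trans ht)
  have hψ : 0 < ψ n := h.1.pos (by exact_mod_cast hn)
  have hψ0 : Tendsto (fun N : ℕ => ψ (N + 1 : ℕ)) atTop (nhds 0) :=
    h.1.2.2.comp (tendsto_natCast_atTop_atTop.comp (tendsto_add_atTop_nat 1))
  have hl := (((IsPsiDeriv.tendsto_sum_fourierA h hf hper hd).sub_const
    (Usum (fun k : ℕ => ψ k) n p f 0)).sub_const (σ * (ψ n / π) *
      ∫ t in annulus (b * n) (c * n), φ (t / n) * Real.sin (t + β * π / 2) / t)).abs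
  have hr := (((hψ0.const_mul (2 * π)).div_const a).const_add ((5 * π + 6) * ψ n +
    (1 + π) * (ψ n + T) + 7 * (π / K * ψ n + E))).const_mul 2
  refine (le_of_tendsto_of_tendsto hl hr ?_).trans ?_
  · filter_upwards [eventually_ge_atTop n] with N hN
    exact h.abs_partial_deviation_le hd hp hpn (hN.trans (Nat.le_succ N)) hK ha hprin
  · have := pi_pos
    have hπK : 0 ≤ π / K := by positivity
    rw [mul_zero, zero_div, add_zero]
    nlinarith [mul_nonneg hπK hT, mul_nonneg hπK hE, mul_pos this hψ, mul_nonneg this.le hT,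
      mul_nonneg this.le hE]

/-- Lemma 1: for `ψ ∈ M'` and `K > 0` there is a constant `C`
(depending only on `ψ` and `K`, uniform in `β`, `n`, `p` and `f`) such that for any
sequence `α(n) ≥ K/n` and every `f ∈ C^ψ_{β,∞}` with `(ψ,β)`-derivative `φf`:
`|ρ_{n,p}(f;0) - (-1)^s (ψ(n)/π) ∫_{I_{α_n}} φf(t/n) sin(t+βπ/2)/t dt| ≤ C r_n`, where
`r_n = ψ(n) + ∫_{1/α(n)}^∞ ψ(t+n)/t dt + ∫_{α(n)}^∞ (ψ(n) - ψ(n+1/t))/t dt`. -/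
theorem statement7 (ψ : ℝ → ℝ) (hψ : MprimeClass ψ) (K : ℝ) (hK : 0 < K) :
    ∃ C : ℝ, ∀ a : ℕ → ℝ, (∀ n : ℕ, 1 ≤ n → K / n ≤ a n) →
      ∀ (β : ℝ) (n p : ℕ), 1 ≤ p → p ≤ n → ∀ f φf : ℝ → ℝ,
      Continuous f → Periodic2pi f → IsPsiDeriv (fun k : ℕ => ψ k) β f φf →
      |(f 0 - Usum (fun k : ℕ => ψ k) n p f 0) -
        (if a n ≤ 1 / p then (-1 : ℝ) else 1) * (ψ n / π) *
          ∫ t in (if a n ≤ 1 / p then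
                    Ioo (-((n : ℝ) / p)) (-(a n * n)) ∪ Ioo (a n * n) ((n : ℝ) / p)
                  else if a n ≤ 1 then
                    Ioo (-(a n * n)) (-((n : ℝ) / p)) ∪ Ioo ((n : ℝ) / p) (a n * n)
                  else
                    Ioo (-(n : ℝ)) (-((n : ℝ) / p)) ∪ Ioo ((n : ℝ) / p) (n : ℝ)),
            φf (t / n) * Real.sin (t + β * π / 2) / t| ≤
        C * (ψ n + (∫ t in Ioi (1 / a n), ψ (t + n) / t) +
          ∫ t in Ioi (a n), (ψ n - ψ (n + 1 / t)) / t) := by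
  refine ⟨2 * (14 + 6 * π + 7 * (π / K)), fun a ha β n p hp hpn f φ hf hper hd => ?_⟩
  have hK' := ha n (hp.trans hpn)
  have hdiv : (n : ℝ) / p = 1 / p * n := by ring
  rw [hdiv]
  split_ifs with h₁ h₂
  · exact hψ.abs_deviation_le hf hper hd hp hpn hK hK' (Or.inl ⟨h₁, rfl, rfl, rfl⟩)
  · exact hψ.abs_deviation_le hf hper hd hp hpn hK hK'
      (Or.inr (Or.inl ⟨not_le.1 h₁, h₂, rfl, rfl, rfl⟩))
  · have := hψ.abs_deviation_le hf hper hd hp hpn hK hK'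
      (Or.inr (Or.inr ⟨not_le.1 h₂, rfl, rfl, rfl⟩))
    rw [one_mul (n : ℝ)] at this
    exact this
end
end
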